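/- arXiv:2506.09635 — 3 statements merged into one kernel-verified Lean document; each statement's English description precedes it below -/
import Mathlib

section
/- Fix an integer n ≥ 3, a real number ν with 0 < ν ≤ (n-2)/2, and a smooth function φ : ℝ → [0,1] with support contained in [1/2, 2]. For t ∈ ℝ and r₁, r₂ > 0 set K^l_ν(t, r₁, r₂) = (r₁r₂)^{-(n-2)/2} ∫_0^∞ e^{itρ} J_ν(r₁ρ) J_ν(r₂ρ) φ(ρ) ρ dρ, and for a bounded measurable g : (0,∞) → ℂ with compact support in (0,∞) define (T_ν g)(t, r₁) = ∫_0^∞ K^l_ν(t, r₁, r₂) g(r₂) r₂^{n-1} dr₂. Then for every p with 2 ≤ p and p·(n-2-2ν) < 2n there is a constant C (depending only on ν, n, p, φ) such that for all t ∈ ℝ and all such g: ‖(T_ν g)(t, ·)‖_{L^p((0,∞), r^{n-1}dr)} ≤ C (1+|t|)^{-((n-1)/2)(1-2/p)} ‖g‖_{L^{p'}((0,∞), r^{n-1}dr)}, where p' is the conjugate exponent of p. -/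
open MeasureTheory

/-- The Bessel function of order `ν`, defined for `ν > -1/2` and `r > 0` by the
Poisson integral representation
`J_ν(r) = (r/2)^ν / (Γ(ν+1/2)Γ(1/2)) ∫_{-1}^{1} e^{isr} (1-s²)^{ν-1/2} ds`. -/
noncomputable def besselJ (ν r : ℝ) : ℂ :=
  (((r / 2) ^ ν / (Real.Gamma (ν + 1 / 2) * Real.Gamma (1 / 2)) : ℝ) : ℂ) *
    ∫ s in (-1 : ℝ)..1,
      Complex.exp (Complex.I * (s : ℂ) * (r : ℂ)) * (((1 - s ^ 2) ^ (ν - 1 / 2) : ℝ) : ℂ)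

/-- The localized kernel
`K^l_ν(t, r₁, r₂) = (r₁r₂)^{-(n-2)/2} ∫_0^∞ e^{itρ} J_ν(r₁ρ) J_ν(r₂ρ) φ(ρ) ρ dρ`. -/
noncomputable def Kl (n : ℕ) (ν : ℝ) (φ : ℝ → ℝ) (t r₁ r₂ : ℝ) : ℂ :=
  (((r₁ * r₂) ^ (-((n : ℝ) - 2) / 2) : ℝ) : ℂ) *
    ∫ ρ in Set.Ioi (0 : ℝ),
      Complex.exp (Complex.I * (t : ℂ) * (ρ : ℂ)) * besselJ ν (r₁ * ρ) *
        besselJ ν (r₂ * ρ) * (φ ρ : ℂ) * (ρ : ℂ)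

/-- The operator `(T_ν g)(t, r₁) = ∫_0^∞ K^l_ν(t, r₁, r₂) g(r₂) r₂^{n-1} dr₂`. -/
noncomputable def Tnu (n : ℕ) (ν : ℝ) (φ : ℝ → ℝ) (g : ℝ → ℂ) (t r₁ : ℝ) : ℂ :=
  ∫ r₂ in Set.Ioi (0 : ℝ), Kl n ν φ t r₁ r₂ * g r₂ * ((r₂ ^ (n - 1) : ℝ) : ℂ)

/-- The measure `r^{n-1} dr` on `(0,∞)`. -/
noncomputable def rMeasure (n : ℕ) : Measure ℝ :=
  (volume.restrict (Set.Ioi (0 : ℝ))).withDensity fun r => ENNReal.ofReal (r ^ (n - 1))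


/-- Laplace-Fourier transform. -/
noncomputable def Lap (ψ : ℝ → ℂ) (z : ℂ) : ℂ := ∫ ρ : ℝ, Complex.exp (z * (ρ : ℂ)) * ψ ρ

lemma hasCompactSupport_of_tsupport_subset {ψ : ℝ → ℂ} {a b : ℝ} (h : tsupport ψ ⊆ Set.Icc a b) :
    HasCompactSupport ψ := isCompact_Icc.of_isClosed_subset (isClosed_tsupport _) h

lemma integrable_exp_mul {ψ : ℝ → ℂ} (hc : Continuous ψ) (hs : HasCompactSupport ψ) (z : ℂ) :
    Integrable (fun ρ : ℝ => Complex.exp (z * (ρ : ℂ)) * ψ ρ) := by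
  apply Continuous.integrable_of_hasCompactSupport
  · fun_prop
  · exact hs.mul_left

lemma Lap_deriv {ψ : ℝ → ℂ} (hψ : ContDiff ℝ (⊤ : ℕ∞) ψ) (hs : HasCompactSupport ψ) (z : ℂ) :
    z * Lap ψ z = - Lap (deriv ψ) z := by
  have hd : ContDiff ℝ (⊤ : ℕ∞) (deriv ψ) := ContDiff.iterate_deriv 1 hψ
  have h := integral_mul_deriv_eq_deriv_mul_of_integrable
    (u := fun ρ : ℝ => Complex.exp (z * (ρ : ℂ))) (u' := fun ρ : ℝ => z * Complex.exp (z * (ρ : ℂ)))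
    (v := ψ) (v' := deriv ψ) ?_ ?_ ?_ ?_ ?_
  · unfold Lap
    rw [h, neg_neg, ← integral_const_mul]
    simp only [mul_assoc]
  · intro x _
    have h1 : HasDerivAt (fun ρ : ℝ => z * (ρ : ℂ)) (z * 1) x :=
      (Complex.ofRealCLM.hasDerivAt (x := x)).const_mul z
    have := h1.cexp
    rw [mul_one, mul_comm] at this
    exact this
  · intro x _
    exact (hψ.differentiable (by simp) x).hasDerivAt
  · exact integrable_exp_mul hd.continuous hs.deriv z
  · have := (integrable_exp_mul hψ.continuous hs z).const_mul z
    convert this using 1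
    ext x
    simp [mul_assoc]
  · exact integrable_exp_mul hψ.continuous hs z

lemma Lap_bound0 {a b : ℝ} (N : ℕ) : ∀ {ψ : ℝ → ℂ}, ContDiff ℝ (⊤ : ℕ∞) ψ →
    tsupport ψ ⊆ Set.Icc a b → ∃ C : ℝ, 0 ≤ C ∧ ∀ z : ℂ, z.re ≤ 0 →
      ‖z‖ ^ N * ‖Lap ψ z‖ ≤ C * Real.exp (a * z.re) := by
  induction N with
  | zero =>
    intro ψ hψ hs
    refine ⟨∫ ρ, ‖ψ ρ‖, integral_nonneg fun _ => norm_nonneg _, fun z hz => ?_⟩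
    rw [pow_zero, one_mul, mul_comm, ← integral_const_mul]
    refine norm_integral_le_of_norm_le ?_ (Filter.Eventually.of_forall fun ρ => ?_)
    · exact ((hψ.continuous.integrable_of_hasCompactSupport
        (hasCompactSupport_of_tsupport_subset hs)).norm).const_mul _
    · by_cases h : ψ ρ = 0
      · simp [h]
      · have h2 : ρ ∈ Set.Icc a b := hs (subset_tsupport _ h)
        rw [norm_mul, Complex.norm_exp]
        gcongr
        simp only [Complex.mul_re, Complex.ofReal_re, Complex.ofReal_im, mul_zero, sub_zero]
        nlinarith [h2.1]
  | succ N ih =>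
    intro ψ hψ hs
    obtain ⟨C, hC, h⟩ := ih (ContDiff.iterate_deriv 1 hψ)
      ((tsupport_deriv_subset (f := ψ)).trans hs)
    refine ⟨C, hC, fun z hz => ?_⟩
    have := h z hz
    rw [Function.iterate_one, ← norm_neg (Lap (deriv ψ) z),
      ← Lap_deriv hψ (hasCompactSupport_of_tsupport_subset hs), norm_mul] at this
    rw [pow_succ, mul_assoc]
    exact this

lemma one_add_pow_le (x : ℝ) (hx : 0 ≤ x) (N : ℕ) : (1 + x) ^ N ≤ 2 ^ N * (1 + x ^ N) := by
  rcases le_total x 1 with h | h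
  · calc (1 + x) ^ N ≤ 2 ^ N := by gcongr; linarith
      _ ≤ _ := by nlinarith [pow_pos (two_pos : (0:ℝ) < 2) N, pow_nonneg hx N]
  · calc (1 + x) ^ N ≤ (2 * x) ^ N := by gcongr; linarith
      _ = 2 ^ N * x ^ N := mul_pow _ _ _
      _ ≤ _ := by nlinarith [pow_pos (two_pos : (0:ℝ) < 2) N, pow_nonneg hx N]

lemma Lap_bound {a b : ℝ} (N : ℕ) {ψ : ℝ → ℂ} (hψ : ContDiff ℝ (⊤ : ℕ∞) ψ)
    (hs : tsupport ψ ⊆ Set.Icc a b) : ∃ C : ℝ, 0 ≤ C ∧ ∀ z : ℂ, z.re ≤ 0 →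
      ‖Lap ψ z‖ ≤ C * Real.exp (a * z.re) * ((1 + |z.im|) ^ N)⁻¹ := by
  obtain ⟨C0, hC0, h0⟩ := Lap_bound0 0 hψ hs
  obtain ⟨C1, hC1, h1⟩ := Lap_bound0 N hψ hs
  refine ⟨2 ^ N * (C0 + C1), by positivity, fun z hz => ?_⟩
  rw [le_mul_inv_iff₀ (by positivity)]
  have h0 := h0 z hz
  have h1 := h1 z hz
  rw [pow_zero, one_mul] at h0
  have hi : |z.im| ^ N ≤ ‖z‖ ^ N := by gcongr; exact Complex.abs_im_le_norm z
  calc ‖Lap ψ z‖ * (1 + |z.im|) ^ N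
      ≤ ‖Lap ψ z‖ * (2 ^ N * (1 + ‖z‖ ^ N)) := by
        gcongr
        exact (one_add_pow_le _ (abs_nonneg _) N).trans (by gcongr)
    _ = 2 ^ N * (‖Lap ψ z‖ + ‖z‖ ^ N * ‖Lap ψ z‖) := by ring
    _ ≤ 2 ^ N * (C0 * Real.exp (a * z.re) + C1 * Real.exp (a * z.re)) := by gcongr
    _ = _ := by ring

/-- Smoothness of `χ(ρ) ρ^ν` for `χ` supported away from zero. -/
lemma contDiff_mul_rpow {a b ν : ℝ} (ha : 0 < a) {χ : ℝ → ℝ} (hχ : ContDiff ℝ (⊤ : ℕ∞) χ)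
    (hs : tsupport χ ⊆ Set.Icc a b) :
    ContDiff ℝ (⊤ : ℕ∞) (fun ρ => ((χ ρ * ρ ^ ν : ℝ) : ℂ)) := by
  apply Complex.ofRealCLM.contDiff.comp (g := Complex.ofRealCLM) (f := fun ρ => χ ρ * ρ ^ ν)
  rw [contDiff_iff_contDiffAt]
  intro x
  by_cases hx : x ∈ tsupport χ
  · have : 0 < x := ha.trans_le (hs hx).1
    exact hχ.contDiffAt.mul (contDiffAt_id.rpow_const_of_ne this.ne')
  · have : (fun ρ => χ ρ * ρ ^ ν) =ᶠ[nhds x] fun _ => 0 := by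
      have := notMem_tsupport_iff_eventuallyEq.1 hx
      filter_upwards [this] with y hy
      simp [hy]
    exact contDiffAt_const.congr_of_eventuallyEq this

lemma tsupport_mul_rpow {a b ν : ℝ} {χ : ℝ → ℝ} (hs : tsupport χ ⊆ Set.Icc a b) :
    tsupport (fun ρ => ((χ ρ * ρ ^ ν : ℝ) : ℂ)) ⊆ Set.Icc a b := by
  refine subset_trans ?_ hs
  apply closure_mono
  intro x hx
  simp only [Function.mem_support, ne_eq] at hx ⊢
  contrapose! hx
  simp [hx]

/-- The holomorphic weight `(1 - z²)^μ`. -/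
noncomputable def qw (μ : ℝ) (z : ℂ) : ℂ := (1 - z ^ 2) ^ (μ : ℂ)

lemma one_sub_sq_re (x y : ℝ) : (1 - ((x : ℂ) + y * Complex.I) ^ 2).re = 1 - x ^ 2 + y ^ 2 := by
  simp [pow_two]; ring

lemma one_sub_sq_slit {x y : ℝ} (h : 0 < 1 - x ^ 2 + y ^ 2) :
    1 - ((x : ℂ) + y * Complex.I) ^ 2 ∈ Complex.slitPlane := by
  left; rw [one_sub_sq_re]; exact h

lemma qw_differentiableAt (μ : ℝ) {z : ℂ} (h : 0 < 1 - z.re ^ 2 + z.im ^ 2) :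
    DifferentiableAt ℂ (qw μ) z := by
  have := one_sub_sq_slit h
  rw [Complex.re_add_im] at this
  unfold qw
  exact DifferentiableAt.cpow_const (by fun_prop) this

lemma norm_one_sub_sq_le (s y : ℝ) (hs : |s| ≤ 1) (hy0 : 0 ≤ y) (hy : y ≤ 1) :
    ‖1 - ((s : ℂ) + y * Complex.I) ^ 2‖ ≤ 5 := by
  have h1 : ‖(s : ℂ) + y * Complex.I‖ ≤ 2 := by
    refine (norm_add_le _ _).trans ?_
    simp only [Complex.norm_real, norm_mul, Complex.norm_I, mul_one, Real.norm_eq_abs,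
      abs_of_nonneg hy0]
    linarith
  refine (norm_sub_le _ _).trans ?_
  rw [norm_pow, norm_one]
  nlinarith [norm_nonneg ((s : ℂ) + y * Complex.I)]

lemma rpow_bound_mid {μ s X : ℝ} (hs : -1 < s) (hs' : s < 1) (h1 : 1 - s ^ 2 ≤ X) (h2 : X ≤ 5) :
    X ^ μ ≤ (1 - s) ^ μ + (1 + s) ^ μ + 5 ^ μ := by
  have hX : 0 < X := by nlinarith
  have p1 := Real.rpow_nonneg (x := 1 - s) (by linarith) μ
  have p2 := Real.rpow_nonneg (x := 1 + s) (by linarith) μ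
  have p3 := Real.rpow_nonneg (x := 5) (by norm_num) μ
  rcases le_total 0 μ with h | h
  · have := Real.rpow_le_rpow hX.le h2 h
    linarith
  · rcases le_total 0 s with h0 | h0
    · have := Real.rpow_le_rpow_of_nonpos (x := 1 - s) (y := X) (by linarith) (by nlinarith) h
      linarith
    · have := Real.rpow_le_rpow_of_nonpos (x := 1 + s) (y := X) (by linarith) (by nlinarith) h
      linarith

lemma intervalIntegrable_bnd {μ : ℝ} (hμ : -1 < μ) :
    IntervalIntegrable (fun s : ℝ => (1 - s) ^ μ + (1 + s) ^ μ + 5 ^ μ) volume (-1) 1 := by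
  refine (IntervalIntegrable.add ?_ ?_).add intervalIntegrable_const
  · have := (intervalIntegral.intervalIntegrable_rpow' (a := 2) (b := 0) hμ).comp_sub_left 1
    norm_num at this
    exact this
  · have := (intervalIntegral.intervalIntegrable_rpow' (a := 0) (b := 2) hμ).comp_add_left 1
    norm_num at this
    exact this

/-- Bound on the weight on the horizontal strips. -/
lemma norm_qw_mid {μ s y : ℝ} (hs : -1 < s) (hs' : s < 1) (hy0 : 0 ≤ y) (hy : y ≤ 1) :
    ‖qw μ ((s : ℂ) + y * Complex.I)‖ ≤ (1 - s) ^ μ + (1 + s) ^ μ + 5 ^ μ := by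
  rw [qw, Complex.norm_cpow_real]
  refine rpow_bound_mid hs hs' ?_ (norm_one_sub_sq_le s y (abs_le.2 ⟨hs.le, hs'.le⟩) hy0 hy)
  refine le_trans ?_ (Complex.re_le_norm _)
  rw [one_sub_sq_re]
  nlinarith

/-- Bound on the weight on the vertical sides. -/
lemma norm_qw_side {μ e y : ℝ} (he : e ^ 2 = 1) (hy0 : 0 < y) (hy : y ≤ 1) :
    ‖qw μ ((e : ℂ) + y * Complex.I)‖ ≤ (2 ^ μ + 3 ^ μ) * y ^ μ := by
  rw [qw, Complex.norm_cpow_real]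
  have hc : (1 - ((e : ℂ) + y * Complex.I) ^ 2) = y * (y - 2 * e * Complex.I) := by
    have : (e : ℂ) ^ 2 = 1 := by exact_mod_cast he
    ring_nf
    rw [this, Complex.I_sq]
    ring
  have hea : |e| = 1 := by
    rw [← sq_abs] at he
    nlinarith [abs_nonneg e]
  have h1 : 2 * y ≤ ‖1 - ((e : ℂ) + y * Complex.I) ^ 2‖ := by
    rw [hc, norm_mul, Complex.norm_real, Real.norm_eq_abs, abs_of_pos hy0, mul_comm]
    gcongr
    refine le_trans ?_ (Complex.abs_im_le_norm _)
    simp [hea]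
  have h2 : ‖1 - ((e : ℂ) + y * Complex.I) ^ 2‖ ≤ 3 * y := by
    rw [hc, norm_mul, Complex.norm_real, Real.norm_eq_abs, abs_of_pos hy0, mul_comm]
    gcongr
    refine (norm_sub_le _ _).trans ?_
    simp only [Complex.norm_real, norm_mul, Complex.norm_I, mul_one, Real.norm_eq_abs, hea,
      abs_of_pos hy0, Complex.norm_two]
    linarith
  rw [add_mul, ← Real.mul_rpow (by norm_num) hy0.le, ← Real.mul_rpow (by norm_num) hy0.le]
  have p1 := Real.rpow_nonneg (x := 2 * y) (by linarith) μ
  have p2 := Real.rpow_nonneg (x := 3 * y) (by linarith) μ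
  rcases le_total 0 μ with h | h
  · have := Real.rpow_le_rpow (norm_nonneg _) h2 h
    linarith
  · have := Real.rpow_le_rpow_of_nonpos (by linarith) h1 h
    linarith

lemma qw_side_integrable {μ e : ℝ} (hμ : -1 < μ) (he : e ^ 2 = 1) :
    IntegrableOn (fun y : ℝ => qw μ ((e : ℂ) + y * Complex.I)) (Set.Ioc 0 1) := by
  have hb : IntegrableOn (fun y : ℝ => (2 ^ μ + 3 ^ μ) * y ^ μ) (Set.Ioc 0 1) := by
    rw [← intervalIntegrable_iff_integrableOn_Ioc_of_le zero_le_one]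
    exact (intervalIntegral.intervalIntegrable_rpow' hμ).const_mul _
  refine Integrable.mono' hb ?_ ?_
  · refine ContinuousOn.aestronglyMeasurable ?_ measurableSet_Ioc
    intro y hy
    apply ContinuousAt.continuousWithinAt
    refine ContinuousAt.comp (g := qw μ) (f := fun y : ℝ => (e : ℂ) + y * Complex.I) ?_
      (by fun_prop)
    apply (qw_differentiableAt μ _).continuousAt
    have := hy.1
    simp [he]
    positivity
  · refine (ae_restrict_mem measurableSet_Ioc).mono fun y hy => ?_
    exact norm_qw_side he hy.1 hy.2

lemma qw_mid_integrable {μ y : ℝ} (hμ : -1 < μ) (hy0 : 0 ≤ y) (hy : y ≤ 1) :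
    IntegrableOn (fun s : ℝ => qw μ ((s : ℂ) + y * Complex.I)) (Set.Ioo (-1) 1) := by
  have hb := intervalIntegrable_bnd hμ
  rw [intervalIntegrable_iff_integrableOn_Ioo_of_le (by norm_num)] at hb
  refine Integrable.mono' hb ?_ ?_
  · refine ContinuousOn.aestronglyMeasurable ?_ measurableSet_Ioo
    intro s hs
    apply ContinuousAt.continuousWithinAt
    refine ContinuousAt.comp (g := qw μ) (f := fun s : ℝ => (s : ℂ) + y * Complex.I) ?_
      (by fun_prop)
    apply (qw_differentiableAt μ _).continuousAt
    simp
    nlinarith [hs.1, hs.2]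
  · refine (ae_restrict_mem measurableSet_Ioo).mono fun s hs => ?_
    exact norm_qw_mid hs.1 hs.2 hy0 hy

lemma qw_real {μ s : ℝ} (hs : -1 < s) (hs' : s < 1) :
    qw μ (s : ℂ) = (((1 - s ^ 2) ^ μ : ℝ) : ℂ) := by
  rw [qw, Complex.ofReal_cpow (by nlinarith)]
  push_cast
  rfl

/-- The integrand of the contour integral. -/
noncomputable def cint (μ R : ℝ) (z : ℂ) : ℂ := Complex.exp (Complex.I * z * R) * qw μ z

lemma cint_differentiableAt (μ R : ℝ) {z : ℂ} (h : 0 < 1 - z.re ^ 2 + z.im ^ 2) :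
    DifferentiableAt ℂ (cint μ R) z := by
  unfold cint
  exact DifferentiableAt.mul (by fun_prop) (qw_differentiableAt μ h)

lemma cint_rect (μ R δ : ℝ) (h0 : 0 < δ) (h1 : δ < 1) :
    (∫ s in (-1 : ℝ)..1, cint μ R (s + δ * Complex.I)) -
      (∫ s in (-1 : ℝ)..1, cint μ R (s + (1 : ℝ) * Complex.I)) +
      Complex.I • (∫ y in δ..1, cint μ R ((1 : ℝ) + y * Complex.I)) -
      Complex.I • (∫ y in δ..1, cint μ R ((-1 : ℝ) + y * Complex.I)) = 0 := by
  have := Complex.integral_boundary_rect_eq_zero_of_differentiableOn (cint μ R)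
    ((-1 : ℝ) + δ * Complex.I) ((1 : ℝ) + (1 : ℝ) * Complex.I) ?_
  · simpa using this
  · intro z hz
    apply (cint_differentiableAt μ R _).differentiableWithinAt
    simp [Complex.mem_reProdIm, h1.le] at hz
    obtain ⟨⟨a, b⟩, c, d⟩ := hz
    nlinarith

lemma cint_side_tendsto {μ e : ℝ} (R : ℝ) (hμ : -1 < μ) (he : e ^ 2 = 1) :
    Filter.Tendsto (fun δ : ℝ => ∫ y in δ..1, cint μ R ((e : ℝ) + y * Complex.I))
      (nhdsWithin 0 (Set.Ioi 0)) (nhds (∫ y in (0:ℝ)..1, cint μ R ((e : ℝ) + y * Complex.I))) := by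
  have hi : IntervalIntegrable (fun y : ℝ => cint μ R ((e : ℝ) + y * Complex.I)) volume 0 1 := by
    have h := qw_side_integrable hμ he
    rw [← intervalIntegrable_iff_integrableOn_Ioc_of_le zero_le_one] at h
    exact h.continuousOn_mul (Continuous.continuousOn (by fun_prop))
  have := intervalIntegral.continuousOn_primitive_interval_left
    (f := fun y : ℝ => cint μ R ((e : ℝ) + y * Complex.I)) (a := 0) (b := 1) (μ := volume) ?_
  · have h2 := this 0 (by simp)
    refine h2.tendsto.mono_left ?_
    rw [nhdsWithin_le_iff, Set.uIcc_of_le zero_le_one]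
    filter_upwards [Ioo_mem_nhdsGT (zero_lt_one' ℝ)] with x hx using ⟨hx.1.le, hx.2.le⟩
  · rw [Set.uIcc_of_le zero_le_one]
    rwa [← intervalIntegrable_iff_integrableOn_Icc_of_le zero_le_one]

lemma cint_mid_tendsto {μ : ℝ} (R : ℝ) (hμ : -1 < μ) :
    Filter.Tendsto (fun δ : ℝ => ∫ s in (-1 : ℝ)..1, cint μ R (s + δ * Complex.I))
      (nhdsWithin 0 (Set.Ioi 0)) (nhds (∫ s in (-1 : ℝ)..1, cint μ R s)) := by
  apply intervalIntegral.tendsto_integral_filter_of_dominated_convergence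
    (fun s => Real.exp |R| * ((1 - s) ^ μ + (1 + s) ^ μ + 5 ^ μ))
  · filter_upwards [self_mem_nhdsWithin] with δ hδ
    have hδ : 0 < δ := hδ
    refine ContinuousOn.aestronglyMeasurable ?_ measurableSet_uIoc
    intro s hs
    rw [Set.uIoc_of_le (by norm_num)] at hs
    apply ContinuousAt.continuousWithinAt
    refine ContinuousAt.comp (g := cint μ R) (f := fun s : ℝ => (s : ℂ) + δ * Complex.I) ?_
      (by fun_prop)
    apply (cint_differentiableAt μ R _).continuousAt
    simp
    nlinarith [hs.1, hs.2]
  · filter_upwards [Ioo_mem_nhdsGT (zero_lt_one' ℝ)] with δ hδ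
    have h1 : ∀ᵐ s : ℝ, s ≠ 1 := by simp [ae_iff]
    filter_upwards [h1] with s hs1 hs
    rw [Set.uIoc_of_le (by norm_num)] at hs
    rw [cint, norm_mul]
    gcongr
    · rw [Complex.norm_exp]
      gcongr
      simp
      have := neg_abs_le R
      have := abs_nonneg R
      nlinarith [hδ.1, hδ.2]
    · exact norm_qw_mid hs.1 (lt_of_le_of_ne hs.2 hs1) hδ.1.le hδ.2.le
  · exact (intervalIntegrable_bnd hμ).const_mul _
  · have h1 : ∀ᵐ s : ℝ, s ≠ 1 := by simp [ae_iff]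
    filter_upwards [h1] with s hs1 hs
    rw [Set.uIoc_of_le (by norm_num)] at hs
    have hs2 := lt_of_le_of_ne hs.2 hs1
    have hc : ContinuousAt (cint μ R) ((s : ℂ) + ((0 : ℝ) : ℂ) * Complex.I) := by
      apply (cint_differentiableAt μ R _).continuousAt
      have := hs.1
      simp only [Complex.ofReal_zero, zero_mul, add_zero, Complex.ofReal_re, Complex.ofReal_im]
      nlinarith
    have hc2 := ContinuousAt.comp (g := cint μ R)
      (f := fun δ : ℝ => (s : ℂ) + δ * Complex.I) (x := 0) hc (by fun_prop)
    have := hc2.tendsto.mono_left (nhdsWithin_le_nhds (s := Set.Ioi 0))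
    simpa [Function.comp_def] using this

lemma cint_shift {μ : ℝ} (R : ℝ) (hμ : -1 < μ) :
    (∫ s in (-1 : ℝ)..1, cint μ R s) =
      (∫ s in (-1 : ℝ)..1, cint μ R (s + (1 : ℝ) * Complex.I)) -
      Complex.I • (∫ y in (0:ℝ)..1, cint μ R ((1 : ℝ) + y * Complex.I)) +
      Complex.I • (∫ y in (0:ℝ)..1, cint μ R ((-1 : ℝ) + y * Complex.I)) := by
  have ht := (((cint_mid_tendsto R hμ).sub_const
    (∫ s in (-1 : ℝ)..1, cint μ R (s + (1 : ℝ) * Complex.I))).add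
    ((cint_side_tendsto (e := 1) R hμ (by norm_num)).const_smul Complex.I)).sub
    ((cint_side_tendsto (e := -1) R hμ (by norm_num)).const_smul Complex.I)
  have h0 : Filter.Tendsto (fun _ : ℝ => (0 : ℂ)) (nhdsWithin 0 (Set.Ioi 0)) (nhds 0) :=
    tendsto_const_nhds
  have hE := tendsto_nhds_unique (ht.congr' ?_) h0
  · linear_combination hE
  · filter_upwards [Ioo_mem_nhdsGT (zero_lt_one' ℝ)] with δ hδ
    exact cint_rect μ R δ hδ.1 hδ.2

lemma bessel_integral_eq {ν : ℝ} (R : ℝ) :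
    (∫ s in (-1 : ℝ)..1,
      Complex.exp (Complex.I * (s : ℂ) * (R : ℂ)) * (((1 - s ^ 2) ^ (ν - 1 / 2) : ℝ) : ℂ)) =
    ∫ s in (-1 : ℝ)..1, cint (ν - 1 / 2) R s := by
  apply intervalIntegral.integral_congr_ae
  have h1 : ∀ᵐ s : ℝ, s ≠ 1 := by simp [ae_iff]
  filter_upwards [h1] with s hs1 hs
  rw [Set.uIoc_of_le (by norm_num)] at hs
  rw [cint, qw_real hs.1 (lt_of_le_of_ne hs.2 hs1)]

lemma fubini_Lap {a b : ℝ} (ha : 0 < a) {ψ : ℝ → ℂ} (hψ : Continuous ψ)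
    (hs : tsupport ψ ⊆ Set.Icc a b) {m : Measure ℝ} [SFinite m] {q : ℝ → ℂ} (hq : Integrable q m)
    {h : ℝ → ℂ} (hh : Continuous h) (hre : ∀ᵐ u ∂m, (h u).re ≤ 0) :
    ∫ ρ : ℝ, ψ ρ * ∫ u, q u * Complex.exp (h u * ρ) ∂m = ∫ u, q u * Lap ψ (h u) ∂m := by
  have hψi : Integrable ψ := hψ.integrable_of_hasCompactSupport
    (hasCompactSupport_of_tsupport_subset hs)
  have hI : Integrable (Function.uncurry fun (ρ : ℝ) (u : ℝ) =>
      ψ ρ * (q u * Complex.exp (h u * ρ))) (volume.prod m) := by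
    refine Integrable.mono' (g := fun z : ℝ × ℝ => ‖ψ z.1‖ * ‖q z.2‖)
      (hψi.norm.mul_prod hq.norm) ?_ ?_
    · refine AEStronglyMeasurable.mul ?_ (AEStronglyMeasurable.mul ?_ ?_)
      · exact (hψ.comp continuous_fst).aestronglyMeasurable
      · exact hq.aestronglyMeasurable.comp_snd
      · refine Continuous.aestronglyMeasurable ?_
        fun_prop
    · have hre2 : ∀ᵐ z : ℝ × ℝ ∂(volume.prod m), (h z.2).re ≤ 0 :=
        Measure.quasiMeasurePreserving_snd.ae hre
      filter_upwards [hre2] with z hz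
      rw [Function.uncurry_apply_pair, norm_mul, norm_mul]
      by_cases h0 : ψ z.1 = 0
      · simp [h0]
      · have h2 : z.1 ∈ Set.Icc a b := hs (subset_tsupport _ h0)
        gcongr
        refine mul_le_of_le_one_right (norm_nonneg _) ?_
        rw [Complex.norm_exp, Real.exp_le_one_iff]
        simp only [Complex.mul_re, Complex.ofReal_re, Complex.ofReal_im, mul_zero, sub_zero]
        nlinarith [h2.1]
  calc ∫ ρ : ℝ, ψ ρ * ∫ u, q u * Complex.exp (h u * ρ) ∂m
      = ∫ ρ : ℝ, ∫ u, ψ ρ * (q u * Complex.exp (h u * ρ)) ∂m := by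
        simp only [integral_const_mul]
    _ = ∫ u, (∫ ρ : ℝ, ψ ρ * (q u * Complex.exp (h u * ρ))) ∂m := integral_integral_swap hI
    _ = _ := by
        congr 1
        ext u
        rw [Lap, ← integral_const_mul]
        congr 1
        ext ρ
        ring

lemma fubini_integrable {a b : ℝ} (ha : 0 < a) {ψ : ℝ → ℂ} (hψ : Continuous ψ)
    (hs : tsupport ψ ⊆ Set.Icc a b) {m : Measure ℝ} [SFinite m] {q : ℝ → ℂ} (hq : Integrable q m)
    {h : ℝ → ℂ} (hh : Continuous h) (hre : ∀ᵐ u ∂m, (h u).re ≤ 0) :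
    Integrable fun ρ : ℝ => ψ ρ * ∫ u, q u * Complex.exp (h u * ρ) ∂m := by
  have hψi : Integrable ψ := hψ.integrable_of_hasCompactSupport
    (hasCompactSupport_of_tsupport_subset hs)
  have hI : Integrable (Function.uncurry fun (ρ : ℝ) (u : ℝ) =>
      ψ ρ * (q u * Complex.exp (h u * ρ))) (volume.prod m) := by
    refine Integrable.mono' (g := fun z : ℝ × ℝ => ‖ψ z.1‖ * ‖q z.2‖)
      (hψi.norm.mul_prod hq.norm) ?_ ?_
    · refine AEStronglyMeasurable.mul ?_ (AEStronglyMeasurable.mul ?_ ?_)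
      · exact (hψ.comp continuous_fst).aestronglyMeasurable
      · exact hq.aestronglyMeasurable.comp_snd
      · refine Continuous.aestronglyMeasurable ?_
        fun_prop
    · have hre2 : ∀ᵐ z : ℝ × ℝ ∂(volume.prod m), (h z.2).re ≤ 0 :=
        Measure.quasiMeasurePreserving_snd.ae hre
      filter_upwards [hre2] with z hz
      rw [Function.uncurry_apply_pair, norm_mul, norm_mul]
      by_cases h0 : ψ z.1 = 0
      · simp [h0]
      · have h2 : z.1 ∈ Set.Icc a b := hs (subset_tsupport _ h0)
        gcongr
        refine mul_le_of_le_one_right (norm_nonneg _) ?_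
        rw [Complex.norm_exp, Real.exp_le_one_iff]
        simp only [Complex.mul_re, Complex.ofReal_re, Complex.ofReal_im, mul_zero, sub_zero]
        nlinarith [h2.1]
  have := hI.integral_prod_left
  simpa only [Function.uncurry_apply_pair, integral_const_mul] using this

lemma exp_poly_bound (a : ℝ) (ha : 0 < a) (m : ℕ) :
    ∃ D : ℝ, 0 ≤ D ∧ ∀ r : ℝ, 0 ≤ r → Real.exp (-(a * r)) * (1 + r) ^ m ≤ D := by
  refine ⟨m.factorial / a ^ m * Real.exp a, by positivity, fun r hr => ?_⟩
  have h := Real.pow_div_factorial_le_exp (a * (1 + r)) (by positivity) m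
  rw [div_le_iff₀ (by positivity), mul_pow, mul_add, mul_one, Real.exp_add] at h
  rw [div_mul_eq_mul_div, le_div_iff₀ (by positivity)]
  calc Real.exp (-(a * r)) * (1 + r) ^ m * a ^ m
      = Real.exp (-(a * r)) * (a ^ m * (1 + r) ^ m) := by ring
    _ ≤ Real.exp (-(a * r)) * (Real.exp a * Real.exp (a * r) * m.factorial) := by gcongr
    _ = m.factorial * Real.exp a * (Real.exp (-(a * r)) * Real.exp (a * r)) := by ring
    _ = _ := by rw [← Real.exp_add]; simp

lemma exp_poly_bound' (a κ : ℝ) (ha : 0 < a) (N : ℕ) :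
    ∃ D : ℝ, 0 ≤ D ∧ ∀ r : ℝ, 0 ≤ r →
      Real.exp (-(a * r)) * (1 + 2 * r) ^ N ≤ D * (1 + r) ^ (-κ) := by
  obtain ⟨K, hK⟩ := exists_nat_ge κ
  obtain ⟨D, hD, h⟩ := exp_poly_bound a ha (N + K)
  refine ⟨2 ^ N * D, by positivity, fun r hr => ?_⟩
  rw [Real.rpow_neg (by positivity), ← div_eq_mul_inv, le_div_iff₀ (by positivity)]
  have h1 : (1 + r) ^ κ ≤ (1 + r) ^ K := by
    rw [← Real.rpow_natCast]
    exact Real.rpow_le_rpow_of_exponent_le (by linarith) hK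
  calc Real.exp (-(a * r)) * (1 + 2 * r) ^ N * (1 + r) ^ κ
      ≤ Real.exp (-(a * r)) * (2 * (1 + r)) ^ N * (1 + r) ^ K := by
        gcongr
        linarith
    _ = 2 ^ N * (Real.exp (-(a * r)) * (1 + r) ^ (N + K)) := by rw [mul_pow, pow_add]; ring
    _ ≤ _ := by gcongr; exact h r hr

lemma gamma_bound (a μ : ℝ) (ha : 0 < a) (hμ : -1 < μ) (r : ℝ) (hr : 0 ≤ r) :
    ∫ y in Set.Ioc (0:ℝ) 1, y ^ μ * Real.exp (-(a * r * y)) ≤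
      Real.exp a * (1 / a) ^ (μ + 1) * Real.Gamma (μ + 1) * (1 + r) ^ (-(μ + 1)) := by
  have hpos : 0 < a * (1 + r) := by positivity
  have hI := Real.integral_rpow_mul_exp_neg_mul_Ioi (a := μ + 1) (by linarith) hpos
  have hG := Real.Gamma_pos_of_pos (s := μ + 1) (by linarith)
  simp only [add_sub_cancel_right] at hI
  have hInt0 : IntegrableOn (fun y : ℝ => y ^ μ * Real.exp (-(a * (1 + r) * y))) (Set.Ioi 0) := by
    by_contra hcon
    rw [integral_undef hcon] at hI
    have : 0 < (1 / (a * (1 + r))) ^ (μ + 1) * Real.Gamma (μ + 1) := by positivity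
    linarith
  have e1 : (1 / (a * (1 + r))) ^ (μ + 1) = (1 / a) ^ (μ + 1) * (1 + r) ^ (-(μ + 1)) := by
    rw [Real.rpow_neg (by positivity), ← Real.inv_rpow (by positivity),
      ← Real.mul_rpow (by positivity) (by positivity)]
    congr 1
    field_simp
  calc ∫ y in Set.Ioc (0:ℝ) 1, y ^ μ * Real.exp (-(a * r * y))
      ≤ ∫ y in Set.Ioc (0:ℝ) 1, Real.exp a * (y ^ μ * Real.exp (-(a * (1 + r) * y))) := by
        apply integral_mono_of_nonneg
        · refine (ae_restrict_mem measurableSet_Ioc).mono fun y hy => ?_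
          have := Real.rpow_nonneg hy.1.le μ
          positivity
        · exact (hInt0.mono_set Set.Ioc_subset_Ioi_self).const_mul _
        · refine (ae_restrict_mem measurableSet_Ioc).mono fun y hy => ?_
          have := Real.rpow_nonneg hy.1.le μ
          have h2 : Real.exp (-(a * r * y)) ≤ Real.exp a * Real.exp (-(a * (1 + r) * y)) := by
            rw [← Real.exp_add]
            gcongr
            nlinarith [hy.2]
          calc y ^ μ * Real.exp (-(a * r * y))
              ≤ y ^ μ * (Real.exp a * Real.exp (-(a * (1 + r) * y))) := by gcongr
            _ = _ := by ring
    _ = Real.exp a * ∫ y in Set.Ioc (0:ℝ) 1, (y ^ μ * Real.exp (-(a * (1 + r) * y))) :=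
        integral_const_mul _ _
    _ ≤ Real.exp a * ∫ y in Set.Ioi (0:ℝ), (y ^ μ * Real.exp (-(a * (1 + r) * y))) := by
        refine mul_le_mul_of_nonneg_left (setIntegral_mono_set hInt0 ?_ ?_) (Real.exp_pos a).le
        · refine (ae_restrict_mem measurableSet_Ioi).mono fun y hy => ?_
          have := Real.rpow_nonneg (le_of_lt (Set.mem_Ioi.1 hy)) μ
          simp only [Pi.zero_apply]
          positivity
        · exact Set.Ioc_subset_Ioi_self.eventuallyLE
    _ = _ := by rw [hI, e1]; ring

lemma weight_shift (x r s : ℝ) (hr : 0 ≤ r) (hs : -1 ≤ s) (hs' : s ≤ 1) (N : ℕ) :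
    ((1 + |x + s * r|) ^ N)⁻¹ ≤ (1 + 2 * r) ^ N * ((1 + |x + r|) ^ N)⁻¹ := by
  rw [← div_eq_mul_inv, inv_eq_one_div, div_le_div_iff₀ (by positivity) (by positivity), one_mul,
    ← mul_pow]
  gcongr
  have h1 : |x + r| ≤ |x + s * r| + |(1 - s) * r| := by
    have := abs_add_le (x + s * r) ((1 - s) * r)
    ring_nf at this ⊢
    exact this
  rw [abs_of_nonneg (a := (1 - s) * r) (by apply mul_nonneg <;> linarith)] at h1
  nlinarith [abs_nonneg (x + s * r), mul_nonneg hr (abs_nonneg (x + s * r))]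

lemma piece_mid {a b μ κ : ℝ} (ha : 0 < a) (hμ : -1 < μ) (N : ℕ) {ψ : ℝ → ℂ}
    (hψ : ContDiff ℝ (⊤ : ℕ∞) ψ) (hs : tsupport ψ ⊆ Set.Icc a b) :
    ∃ C : ℝ, 0 ≤ C ∧ ∀ r x : ℝ, 0 ≤ r →
      ‖∫ s : ℝ in Set.Ioc (-1) 1, qw μ (s + (1 : ℝ) * Complex.I) *
        Lap ψ (Complex.I * (x + (s + (1 : ℝ) * Complex.I) * r))‖ ≤
      C * (1 + r) ^ (-κ) * ((1 + |x + r|) ^ N)⁻¹ := by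
  obtain ⟨C, hC, hL⟩ := Lap_bound N hψ hs
  obtain ⟨D, hD, hDb⟩ := exp_poly_bound' a κ ha N
  have hq := qw_mid_integrable (y := 1) hμ (by norm_num) (by norm_num)
  rw [← integrableOn_Ioc_iff_integrableOn_Ioo] at hq
  set Q := ∫ s : ℝ in Set.Ioc (-1) 1, ‖qw μ (s + (1 : ℝ) * Complex.I)‖ with hQ
  have hQ0 : 0 ≤ Q := integral_nonneg fun _ => norm_nonneg _
  refine ⟨Q * (C * D), by positivity, fun r x hr => ?_⟩
  have hE : Q * (C * D) * (1 + r) ^ (-κ) * ((1 + |x + r|) ^ N)⁻¹ =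
    ∫ s : ℝ in Set.Ioc (-1) 1, ‖qw μ (s + (1 : ℝ) * Complex.I)‖ *
      (C * D * (1 + r) ^ (-κ) * ((1 + |x + r|) ^ N)⁻¹) := by
    rw [integral_mul_const]; ring
  rw [hE]
  refine norm_integral_le_of_norm_le (hq.norm.mul_const _) ?_
  refine (ae_restrict_mem measurableSet_Ioc).mono fun s hs => ?_
  rw [norm_mul]
  gcongr
  have hz := hL (Complex.I * (x + (s + (1 : ℝ) * Complex.I) * r)) (by simp [hr])
  have hre : (Complex.I * (x + (s + (1 : ℝ) * Complex.I) * r)).re = - r := by simp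
  have him : (Complex.I * (x + (s + (1 : ℝ) * Complex.I) * r)).im = x + s * r := by simp
  rw [hre, him] at hz
  refine hz.trans ?_
  calc C * Real.exp (a * -r) * ((1 + |x + s * r|) ^ N)⁻¹
      ≤ C * Real.exp (a * -r) * ((1 + 2 * r) ^ N * ((1 + |x + r|) ^ N)⁻¹) := by
        gcongr
        exact weight_shift x r s hr hs.1.le hs.2 N
    _ = C * (Real.exp (-(a * r)) * (1 + 2 * r) ^ N) * ((1 + |x + r|) ^ N)⁻¹ := by
        rw [mul_neg]; ring
    _ ≤ C * (D * (1 + r) ^ (-κ)) * ((1 + |x + r|) ^ N)⁻¹ := by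
        exact mul_le_mul_of_nonneg_right (mul_le_mul_of_nonneg_left (hDb r hr) hC)
          (by positivity)
    _ = _ := by ring

lemma piece_side {a b μ e : ℝ} (ha : 0 < a) (hμ : -1 < μ) (he : e ^ 2 = 1) (N : ℕ) {ψ : ℝ → ℂ}
    (hψ : ContDiff ℝ (⊤ : ℕ∞) ψ) (hs : tsupport ψ ⊆ Set.Icc a b) :
    ∃ C : ℝ, 0 ≤ C ∧ ∀ r x : ℝ, 0 ≤ r →
      ‖∫ y : ℝ in Set.Ioc 0 1, qw μ (e + y * Complex.I) *
        Lap ψ (Complex.I * (x + (e + y * Complex.I) * r))‖ ≤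
      C * (1 + r) ^ (-(μ + 1)) * ((1 + |x + e * r|) ^ N)⁻¹ := by
  obtain ⟨C, hC, hL⟩ := Lap_bound N hψ hs
  have hG := Real.Gamma_pos_of_pos (s := μ + 1) (by linarith)
  refine ⟨(2 ^ μ + 3 ^ μ) * C * (Real.exp a * (1 / a) ^ (μ + 1) * Real.Gamma (μ + 1)),
    by positivity, fun r x hr => ?_⟩
  have hInt0 : IntegrableOn (fun y : ℝ => y ^ μ * Real.exp (-(a * r * y))) (Set.Ioc 0 1) := by
    rw [← intervalIntegrable_iff_integrableOn_Ioc_of_le zero_le_one]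
    exact (intervalIntegral.intervalIntegrable_rpow' hμ).mul_continuousOn
      (Continuous.continuousOn (by fun_prop))
  calc _ ≤ ∫ y : ℝ in Set.Ioc 0 1, ((2 ^ μ + 3 ^ μ) * C * ((1 + |x + e * r|) ^ N)⁻¹) *
        (y ^ μ * Real.exp (-(a * r * y))) := by
        refine norm_integral_le_of_norm_le (hInt0.const_mul _) ?_
        refine (ae_restrict_mem measurableSet_Ioc).mono fun y hy => ?_
        rw [norm_mul]
        have hy0 := hy.1
        have hre : (Complex.I * (x + (e + y * Complex.I) * r)).re = - (y * r) := by simp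
        have him : (Complex.I * (x + (e + y * Complex.I) * r)).im = x + e * r := by simp
        have hz := hL (Complex.I * (x + (e + y * Complex.I) * r))
          (by rw [hre]; have : 0 ≤ y * r := by positivity
              linarith)
        rw [hre, him] at hz
        calc _ ≤ (2 ^ μ + 3 ^ μ) * y ^ μ *
              (C * Real.exp (a * -(y * r)) * ((1 + |x + e * r|) ^ N)⁻¹) := by
              gcongr
              exact norm_qw_side he hy.1 hy.2
          _ = _ := by
              rw [show a * -(y * r) = -(a * r * y) by ring]
              ring
    _ = ((2 ^ μ + 3 ^ μ) * C * ((1 + |x + e * r|) ^ N)⁻¹) *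
        ∫ y : ℝ in Set.Ioc 0 1, (y ^ μ * Real.exp (-(a * r * y))) := integral_const_mul _ _
    _ ≤ ((2 ^ μ + 3 ^ μ) * C * ((1 + |x + e * r|) ^ N)⁻¹) *
        (Real.exp a * (1 / a) ^ (μ + 1) * Real.Gamma (μ + 1) * (1 + r) ^ (-(μ + 1))) := by
        gcongr
        exact gamma_bound a μ ha hμ r hr
    _ = _ := by ring

/-- Fourier transform of a localized Bessel function. -/
noncomputable def Bf (ν : ℝ) (χ : ℝ → ℝ) (r x : ℝ) : ℂ :=
  ∫ ρ : ℝ, Complex.exp (Complex.I * x * ρ) * (besselJ ν (r * ρ) * (χ ρ : ℂ))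

lemma piece_form (μ r x ρ : ℝ) (m : Measure ℝ) (ζ : ℝ → ℂ) :
    Complex.exp (Complex.I * x * ρ) * ∫ u, cint μ (r * ρ) (ζ u) ∂m =
      ∫ u, qw μ (ζ u) * Complex.exp (Complex.I * (x + ζ u * r) * ρ) ∂m := by
  rw [← integral_const_mul]
  congr 1
  ext u
  rw [cint, show Complex.I * (x + ζ u * r) * ρ = Complex.I * x * ρ +
    Complex.I * ζ u * ((r * ρ : ℝ) : ℂ) by push_cast; ring, Complex.exp_add]
  ring

lemma Bf_eq {a b ν : ℝ} (ha : 0 < a) (hν : 0 < ν) {χ : ℝ → ℝ} (hχ : ContDiff ℝ (⊤ : ℕ∞) χ)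
    (hs : tsupport χ ⊆ Set.Icc a b) (r x : ℝ) (hr : 0 < r) :
    Bf ν χ r x = (((r / 2) ^ ν / (Real.Gamma (ν + 1 / 2) * Real.Gamma (1 / 2)) : ℝ) : ℂ) *
      ((∫ s : ℝ in Set.Ioc (-1) 1, qw (ν - 1 / 2) (s + (1 : ℝ) * Complex.I) *
        Lap (fun ρ => ((χ ρ * ρ ^ ν : ℝ) : ℂ)) (Complex.I * (x + (s + (1 : ℝ) * Complex.I) * r)))
      - Complex.I * (∫ y : ℝ in Set.Ioc 0 1, qw (ν - 1 / 2) ((1 : ℝ) + y * Complex.I) *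
        Lap (fun ρ => ((χ ρ * ρ ^ ν : ℝ) : ℂ)) (Complex.I * (x + ((1 : ℝ) + y * Complex.I) * r)))
      + Complex.I * (∫ y : ℝ in Set.Ioc 0 1, qw (ν - 1 / 2) ((-1 : ℝ) + y * Complex.I) *
        Lap (fun ρ => ((χ ρ * ρ ^ ν : ℝ) : ℂ))
          (Complex.I * (x + ((-1 : ℝ) + y * Complex.I) * r)))) := by
  set ψ : ℝ → ℂ := fun ρ => ((χ ρ * ρ ^ ν : ℝ) : ℂ) with hψdef
  have hψ : ContDiff ℝ (⊤ : ℕ∞) ψ := contDiff_mul_rpow ha hχ hs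
  have hψs : tsupport ψ ⊆ Set.Icc a b := tsupport_mul_rpow hs
  have hμ : -1 < ν - 1 / 2 := by linarith
  have hq1 := qw_mid_integrable (y := 1) hμ (by norm_num) (by norm_num)
  rw [← integrableOn_Ioc_iff_integrableOn_Ioo] at hq1
  have hq2 := qw_side_integrable (e := 1) hμ (by norm_num)
  have hq3 := qw_side_integrable (e := -1) hμ (by norm_num)
  have c1 : Continuous fun s : ℝ => Complex.I * ((x : ℂ) + (s + (1 : ℝ) * Complex.I) * r) := by
    fun_prop
  have c2 : Continuous fun y : ℝ => Complex.I * ((x : ℂ) + ((1 : ℝ) + y * Complex.I) * r) := by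
    fun_prop
  have c3 : Continuous fun y : ℝ => Complex.I * ((x : ℂ) + ((-1 : ℝ) + y * Complex.I) * r) := by
    fun_prop
  have n1 : ∀ᵐ s : ℝ ∂(volume.restrict (Set.Ioc (-1) 1)),
      (Complex.I * ((x : ℂ) + (s + (1 : ℝ) * Complex.I) * r)).re ≤ 0 :=
    Filter.Eventually.of_forall fun s => by simp [hr.le]
  have n2 : ∀ e : ℝ, ∀ᵐ y : ℝ ∂(volume.restrict (Set.Ioc 0 1)),
      (Complex.I * ((x : ℂ) + ((e : ℝ) + y * Complex.I) * r)).re ≤ 0 := fun e =>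
    (ae_restrict_mem measurableSet_Ioc).mono fun y hy => by
      have : 0 ≤ y * r := mul_nonneg hy.1.le hr.le
      simpa using this
  rw [← fubini_Lap ha hψ.continuous hψs hq1 c1 n1, ← fubini_Lap ha hψ.continuous hψs hq2 c2 (n2 1),
    ← fubini_Lap ha hψ.continuous hψs hq3 c3 (n2 (-1))]
  have I1 := fubini_integrable ha hψ.continuous hψs hq1 c1 n1
  have I2 := (fubini_integrable ha hψ.continuous hψs hq2 c2 (n2 1)).const_mul Complex.I
  have I3 := (fubini_integrable ha hψ.continuous hψs hq3 c3 (n2 (-1))).const_mul Complex.I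
  have hadd := integral_add (I1.sub I2) I3
  have hsub := integral_sub I1 I2
  simp only [Pi.sub_apply, integral_const_mul] at hadd hsub
  rw [hsub] at hadd
  rw [← hadd, ← integral_const_mul, Bf]
  congr 1
  ext ρ
  by_cases h0 : χ ρ = 0
  · simp [h0, hψdef]
  have hρ : 0 < ρ := ha.trans_le (hs (subset_tsupport _ h0)).1
  rw [besselJ, bessel_integral_eq, cint_shift _ hμ]
  rw [← piece_form _ r x ρ _ (fun s : ℝ => (s : ℂ) + (1 : ℝ) * Complex.I),
    ← piece_form _ r x ρ _ (fun y : ℝ => ((1 : ℝ) : ℂ) + y * Complex.I),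
    ← piece_form _ r x ρ _ (fun y : ℝ => ((-1 : ℝ) : ℂ) + y * Complex.I)]
  rw [intervalIntegral.integral_of_le (by norm_num), intervalIntegral.integral_of_le (by norm_num),
    intervalIntegral.integral_of_le (by norm_num)]
  have hp : (r * ρ / 2) ^ ν = (r / 2) ^ ν * ρ ^ ν := by
    rw [← Real.mul_rpow (by positivity) hρ.le]
    congr 1
    ring
  rw [hp]
  simp only [hψdef, smul_eq_mul]
  push_cast
  ring

lemma Bf_bound {a b ν : ℝ} (ha : 0 < a) (hν : 0 < ν) {χ : ℝ → ℝ} (hχ : ContDiff ℝ (⊤ : ℕ∞) χ)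
    (hs : tsupport χ ⊆ Set.Icc a b) (N : ℕ) : ∃ C : ℝ, 0 ≤ C ∧ ∀ r x : ℝ, 0 < r →
      ‖Bf ν χ r x‖ ≤ C * (r ^ ν * (1 + r) ^ (-(ν + 1 / 2))) *
        (((1 + |x + r|) ^ N)⁻¹ + ((1 + |x - r|) ^ N)⁻¹) := by
  have hψ := contDiff_mul_rpow (ν := ν) ha hχ hs
  have hψs := tsupport_mul_rpow (ν := ν) hs
  have hμ : -1 < ν - 1 / 2 := by linarith
  obtain ⟨C1, hC1, h1⟩ := piece_mid (κ := ν + 1 / 2) ha hμ N hψ hψs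
  obtain ⟨C2, hC2, h2⟩ := piece_side (e := 1) ha hμ (by norm_num) N hψ hψs
  obtain ⟨C3, hC3, h3⟩ := piece_side (e := -1) ha hμ (by norm_num) N hψ hψs
  have hG := Real.Gamma_pos_of_pos (s := ν + 1 / 2) (by linarith)
  have hG2 := Real.Gamma_pos_of_pos (s := 1 / 2) (by norm_num)
  set c := (1 / 2) ^ ν / (Real.Gamma (ν + 1 / 2) * Real.Gamma (1 / 2)) with hc
  have hc0 : 0 ≤ c := by positivity
  refine ⟨c * (C1 + C2 + C3), by positivity, fun r x hr => ?_⟩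
  rw [Bf_eq ha hν hχ hs r x hr, norm_mul]
  have h1 := h1 r x hr.le
  have h2 := h2 r x hr.le
  have h3 := h3 r x hr.le
  have hk : ν - 1 / 2 + 1 = ν + 1 / 2 := by ring
  rw [hk] at h2 h3
  rw [one_mul] at h2
  rw [neg_one_mul, ← sub_eq_add_neg] at h3
  have hcr : ‖(((r / 2) ^ ν / (Real.Gamma (ν + 1 / 2) * Real.Gamma (1 / 2)) : ℝ) : ℂ)‖ =
      c * r ^ ν := by
    rw [Complex.norm_real, Real.norm_of_nonneg (by positivity), hc, div_eq_mul_one_div r 2,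
      Real.mul_rpow hr.le (by norm_num)]
    ring
  rw [hcr]
  set X := ((1 + |x + r|) ^ N)⁻¹
  set Y := ((1 + |x - r|) ^ N)⁻¹
  have hX : 0 ≤ X := by positivity
  have hY : 0 ≤ Y := by positivity
  set P := (1 + r) ^ (-(ν + 1 / 2))
  have hP : 0 ≤ P := by positivity
  calc _ ≤ c * r ^ ν * (C1 * P * X + C2 * P * X + C3 * P * Y) := by
        gcongr
        refine (norm_add_le _ _).trans (add_le_add ((norm_sub_le _ _).trans (add_le_add h1 ?_)) ?_)
        · rw [norm_mul, Complex.norm_I, one_mul]; exact h2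
        · rw [norm_mul, Complex.norm_I, one_mul]; exact h3
    _ ≤ c * r ^ ν * (P * ((C1 + C2 + C3) * (X + Y))) := by
        gcongr
        have : C1 * P * X + C2 * P * X + C3 * P * Y = P * (C1 * X + C2 * X + C3 * Y) := by ring
        rw [this]
        gcongr
        nlinarith [mul_nonneg hC1 hY, mul_nonneg hC2 hY, mul_nonneg hC3 hX]
    _ = _ := by ring

lemma besselJ_continuous {ν : ℝ} (hν : 0 < ν) : Continuous (besselJ ν) := by
  unfold besselJ
  have hμ : -1 < ν - 1 / 2 := by linarith
  refine Continuous.mul ?_ ?_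
  · refine Complex.continuous_ofReal.comp ?_
    refine Continuous.div_const ?_ _
    exact (continuous_id.div_const 2).rpow_const fun _ => Or.inr hν.le
  · apply intervalIntegral.continuous_of_dominated_interval
      (bound := fun s => (1 - s) ^ (ν - 1 / 2) + (1 + s) ^ (ν - 1 / 2) + 5 ^ (ν - 1 / 2))
    · intro r
      apply Measurable.aestronglyMeasurable
      refine Measurable.mul (by fun_prop) ?_
      exact Complex.measurable_ofReal.comp (by fun_prop)
    · intro r
      have h1 : ∀ᵐ s : ℝ, s ≠ 1 := by simp [ae_iff]
      filter_upwards [h1] with s hs1 hs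
      rw [Set.uIoc_of_le (by norm_num)] at hs
      rw [← qw_real hs.1 (lt_of_le_of_ne hs.2 hs1), norm_mul]
      have : ‖Complex.exp (Complex.I * s * r)‖ = 1 := by
        rw [Complex.norm_exp]; simp
      rw [this, one_mul]
      have := norm_qw_mid (μ := ν - 1 / 2) (y := 0) hs.1 (lt_of_le_of_ne hs.2 hs1) le_rfl
        zero_le_one
      simpa using this
    · exact intervalIntegrable_bnd hμ
    · refine Filter.Eventually.of_forall fun s _ => ?_
      fun_prop

/-- The polynomial decay weight. -/
noncomputable def hw (N : ℕ) (u : ℝ) : ℝ := ((1 + |u|) ^ N)⁻¹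

lemma hw_nonneg (N : ℕ) (u : ℝ) : 0 ≤ hw N u := by unfold hw; positivity

lemma hw_neg (N : ℕ) (u : ℝ) : hw N (-u) = hw N u := by simp [hw]

lemma hw_continuous (N : ℕ) : Continuous (hw N) := by
  unfold hw
  refine Continuous.inv₀ (by fun_prop) fun x => by positivity

lemma hw_integrable {N : ℕ} (hN : 2 ≤ N) : Integrable (hw N) := by
  have := integrable_one_add_norm (E := ℝ) (μ := volume) (r := N)
    (by simp; exact_mod_cast hN)
  refine this.congr (Filter.Eventually.of_forall fun x => ?_)
  simp only [hw, Real.norm_eq_abs]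
  rw [Real.rpow_neg (by positivity), Real.rpow_natCast]

lemma hw_mul (N : ℕ) (a b : ℝ) : hw N a * hw N b ≤ 2 ^ N * hw N (a - b) * (hw N a + hw N b) := by
  have key : ∀ a b : ℝ, |a| ≤ |b| → hw N a * hw N b ≤ 2 ^ N * hw N (a - b) * (hw N a + hw N b) := by
    intro a b h
    have h1 : hw N b ≤ 2 ^ N * hw N (a - b) := by
      unfold hw
      rw [← div_eq_mul_inv, inv_eq_one_div, div_le_div_iff₀ (by positivity) (by positivity),
        one_mul, ← mul_pow]
      gcongr
      have := abs_sub a b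
      linarith
    have := hw_nonneg N a
    have := hw_nonneg N b
    have := hw_nonneg N (a - b)
    calc hw N a * hw N b ≤ hw N a * (2 ^ N * hw N (a - b)) := by gcongr
      _ ≤ (hw N a + hw N b) * (2 ^ N * hw N (a - b)) := by gcongr; linarith
      _ = _ := by ring
  rcases le_total |a| |b| with h | h
  · exact key a b h
  · have := key b a h
    rw [← hw_neg N (b - a), neg_sub] at this
    linarith

lemma hw_affine_integrable {N : ℕ} (hN : 2 ≤ N) (A : ℝ) :
    Integrable fun w : ℝ => hw N (2 * Real.pi * w + A) :=
  ((hw_integrable hN).comp_add_right A).comp_mul_left' (by positivity)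

lemma hw_affine_integral (N : ℕ) (A : ℝ) :
    ∫ w : ℝ, hw N (2 * Real.pi * w + A) = (2 * Real.pi)⁻¹ * ∫ u, hw N u := by
  have := Measure.integral_comp_mul_left (fun u => hw N (u + A)) (2 * Real.pi)
  rw [this, integral_add_right_eq_self (hw N) A, smul_eq_mul, abs_of_pos (by positivity)]

lemma fourier_Bf (ν : ℝ) (χ : ℝ → ℝ) (r w : ℝ) :
    FourierTransform.fourier (fun ρ : ℝ => besselJ ν (r * ρ) * (χ ρ : ℂ)) w =
      Bf ν χ r (-(2 * Real.pi * w)) := by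
  rw [Real.fourier_eq', Bf]
  congr 1
  ext ρ
  rw [smul_eq_mul]
  congr 2
  simp
  ring

lemma fJ_continuous {ν : ℝ} (hν : 0 < ν) {χ : ℝ → ℝ} (hχ : Continuous χ) (r : ℝ) :
    Continuous (fun ρ : ℝ => besselJ ν (r * ρ) * (χ ρ : ℂ)) :=
  ((besselJ_continuous hν).comp (by fun_prop)).mul (by fun_prop)

lemma fJ_integrable {a b ν : ℝ} (hν : 0 < ν) {χ : ℝ → ℝ} (hχ : Continuous χ)
    (hs : tsupport χ ⊆ Set.Icc a b) (r : ℝ) :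
    Integrable (fun ρ : ℝ => besselJ ν (r * ρ) * (χ ρ : ℂ)) := by
  have hcs : HasCompactSupport χ := isCompact_Icc.of_isClosed_subset (isClosed_tsupport _) hs
  refine (fJ_continuous hν hχ r).integrable_of_hasCompactSupport ?_
  exact (hcs.comp_left (g := fun x : ℝ => (x : ℂ)) (by simp)).mul_left

lemma Bf_continuous {a b ν : ℝ} (hν : 0 < ν) {χ : ℝ → ℝ} (hχ : Continuous χ)
    (hs : tsupport χ ⊆ Set.Icc a b) (r : ℝ) : Continuous (Bf ν χ r) := by
  unfold Bf
  refine continuous_of_dominated (bound := fun ρ => ‖besselJ ν (r * ρ) * (χ ρ : ℂ)‖)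
    ?_ ?_ (fJ_integrable hν hχ hs r).norm ?_
  · intro x
    exact ((by fun_prop : Continuous fun ρ : ℝ => Complex.exp (Complex.I * x * ρ)).mul
      (fJ_continuous hν hχ r)).aestronglyMeasurable
  · intro x
    refine Filter.Eventually.of_forall fun ρ => ?_
    rw [norm_mul]
    have : ‖Complex.exp (Complex.I * x * ρ)‖ = 1 := by
      rw [Complex.norm_exp]; simp
    rw [this, one_mul]
  · refine Filter.Eventually.of_forall fun ρ => ?_
    fun_prop

lemma Bf_integrable {a b ν : ℝ} (ha : 0 < a) (hν : 0 < ν) {χ : ℝ → ℝ}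
    (hχ : ContDiff ℝ (⊤ : ℕ∞) χ) (hs : tsupport χ ⊆ Set.Icc a b) (r : ℝ) (hr : 0 < r) :
    Integrable (fun w : ℝ => Bf ν χ r (-(2 * Real.pi * w))) := by
  obtain ⟨C, hC, h⟩ := Bf_bound ha hν hχ hs 2
  refine Integrable.mono' (((hw_affine_integrable (N := 2) le_rfl (-r)).add
    (hw_affine_integrable (N := 2) le_rfl r)).const_mul
      (C * (r ^ ν * (1 + r) ^ (-(ν + 1 / 2))))) ?_ ?_
  · exact ((Bf_continuous hν hχ.continuous hs r).comp (by fun_prop)).aestronglyMeasurable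
  · refine Filter.Eventually.of_forall fun w => ?_
    refine (h r (-(2 * Real.pi * w)) hr).trans (le_of_eq ?_)
    congr 1
    simp only [Pi.add_apply]
    rw [← hw_neg 2 (_ + -r), ← hw_neg 2 (_ + r)]
    unfold hw
    congr 5 <;> ring_nf

/-- Convolution identity for the kernel. -/
lemma kernel_conv {a b ν : ℝ} (ha : 0 < a) (hν : 0 < ν) {χ₁ χ₂ : ℝ → ℝ}
    (hχ₁ : ContDiff ℝ (⊤ : ℕ∞) χ₁) (hs₁ : tsupport χ₁ ⊆ Set.Icc a b)
    (hχ₂ : ContDiff ℝ (⊤ : ℕ∞) χ₂) (hs₂ : tsupport χ₂ ⊆ Set.Icc a b) (t r₁ r₂ : ℝ)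
    (hr₂ : 0 < r₂) :
    ∫ ρ : ℝ, Complex.exp (Complex.I * t * ρ) * (besselJ ν (r₁ * ρ) * (χ₁ ρ : ℂ)) *
      (besselJ ν (r₂ * ρ) * (χ₂ ρ : ℂ)) =
    ∫ w : ℝ, Bf ν χ₂ r₂ (-(2 * Real.pi * w)) * Bf ν χ₁ r₁ (t + 2 * Real.pi * w) := by
  set f₁ : ℝ → ℂ := fun ρ : ℝ => besselJ ν (r₁ * ρ) * (χ₁ ρ : ℂ) with hf₁
  set f₂ : ℝ → ℂ := fun ρ : ℝ => besselJ ν (r₂ * ρ) * (χ₂ ρ : ℂ) with hf₂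
  have i₁ : Integrable f₁ := fJ_integrable hν hχ₁.continuous hs₁ r₁
  have i₂ : Integrable f₂ := fJ_integrable hν hχ₂.continuous hs₂ r₂
  have hF : FourierTransform.fourier f₂ = fun w => Bf ν χ₂ r₂ (-(2 * Real.pi * w)) := by
    ext w
    exact fourier_Bf ν χ₂ r₂ w
  have iB := Bf_integrable ha hν hχ₂ hs₂ r₂ hr₂
  have hinv := Continuous.fourierInv_fourier_eq (fJ_continuous hν hχ₂.continuous r₂) i₂
    (by rw [hF]; exact iB)
  rw [hF] at hinv
  have hinv2 : ∀ ρ : ℝ, f₂ ρ = ∫ w : ℝ, Complex.exp ((2 * Real.pi * (ρ * w) : ℝ) * Complex.I) *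
      Bf ν χ₂ r₂ (-(2 * Real.pi * w)) := by
    intro ρ
    have := congrFun hinv ρ
    rw [Real.fourierInv_eq'] at this
    refine this.symm.trans ?_
    rfl
  have hI : Integrable (Function.uncurry fun (ρ w : ℝ) =>
      (Complex.exp (Complex.I * t * ρ) * f₁ ρ) *
      (Complex.exp ((2 * Real.pi * (ρ * w) : ℝ) * Complex.I) * Bf ν χ₂ r₂ (-(2 * Real.pi * w))))
      (volume.prod volume) := by
    refine Integrable.mono' (g := fun z : ℝ × ℝ => ‖f₁ z.1‖ * ‖Bf ν χ₂ r₂ (-(2 * Real.pi * z.2))‖)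
      (i₁.norm.mul_prod iB.norm) ?_ ?_
    · apply Continuous.aestronglyMeasurable
      have cB := Bf_continuous hν hχ₂.continuous hs₂ r₂
      have c1 : Continuous f₁ := fJ_continuous hν hχ₁.continuous r₁
      unfold Function.uncurry
      fun_prop
    · refine Filter.Eventually.of_forall fun z => ?_
      have h1 : ‖Complex.exp (Complex.I * t * z.1)‖ = 1 := by
        rw [Complex.norm_exp]; simp
      have h2 : ‖Complex.exp ((2 * Real.pi * (z.1 * z.2) : ℝ) * Complex.I)‖ = 1 :=
        Complex.norm_exp_ofReal_mul_I _
      simp only [Function.uncurry, norm_mul, h1, h2, one_mul]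
      exact le_rfl
  calc _ = ∫ ρ : ℝ, ∫ w : ℝ, (Complex.exp (Complex.I * t * ρ) * f₁ ρ) *
      (Complex.exp ((2 * Real.pi * (ρ * w) : ℝ) * Complex.I) *
        Bf ν χ₂ r₂ (-(2 * Real.pi * w))) := by
        congr 1
        ext ρ
        rw [integral_const_mul, ← hinv2]
    _ = ∫ w : ℝ, ∫ ρ : ℝ, (Complex.exp (Complex.I * t * ρ) * f₁ ρ) *
      (Complex.exp ((2 * Real.pi * (ρ * w) : ℝ) * Complex.I) *
        Bf ν χ₂ r₂ (-(2 * Real.pi * w))) := integral_integral_swap hI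
    _ = _ := by
        congr 1
        ext w
        rw [Bf.eq_1 ν χ₁, ← integral_const_mul]
        congr 1
        ext ρ
        rw [show Complex.I * ((t + 2 * Real.pi * w : ℝ) : ℂ) * ρ = Complex.I * t * ρ +
          ((2 * Real.pi * (ρ * w) : ℝ) : ℂ) * Complex.I by push_cast; ring, Complex.exp_add]
        simp only [hf₁]
        ring

/-- The four-term decay weight. -/
noncomputable def S4 (N : ℕ) (t r₁ r₂ : ℝ) : ℝ :=
  hw N (t + r₁ + r₂) + hw N (t + r₁ - r₂) + hw N (t - r₁ + r₂) + hw N (t - r₁ - r₂)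

lemma kernel_bound {a b ν : ℝ} (ha : 0 < a) (hν : 0 < ν) {χ₁ χ₂ : ℝ → ℝ}
    (hχ₁ : ContDiff ℝ (⊤ : ℕ∞) χ₁) (hs₁ : tsupport χ₁ ⊆ Set.Icc a b)
    (hχ₂ : ContDiff ℝ (⊤ : ℕ∞) χ₂) (hs₂ : tsupport χ₂ ⊆ Set.Icc a b) (N : ℕ) (hN : 2 ≤ N) :
    ∃ C : ℝ, 0 ≤ C ∧ ∀ t r₁ r₂ : ℝ, 0 < r₁ → 0 < r₂ →
    ‖∫ ρ : ℝ, Complex.exp (Complex.I * t * ρ) * (besselJ ν (r₁ * ρ) * (χ₁ ρ : ℂ)) *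
      (besselJ ν (r₂ * ρ) * (χ₂ ρ : ℂ))‖ ≤
      C * (r₁ ^ ν * (1 + r₁) ^ (-(ν + 1 / 2))) * (r₂ ^ ν * (1 + r₂) ^ (-(ν + 1 / 2))) *
        S4 N t r₁ r₂ := by
  obtain ⟨C1, hC1, h1⟩ := Bf_bound ha hν hχ₁ hs₁ N
  obtain ⟨C2, hC2, h2⟩ := Bf_bound ha hν hχ₂ hs₂ N
  set H := (2 * Real.pi)⁻¹ * ∫ u, hw N u with hH
  have hH0 : 0 ≤ H := mul_nonneg (by positivity) (integral_nonneg fun u => hw_nonneg N u)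
  refine ⟨C1 * C2 * 2 ^ N * (4 * H), by positivity, fun t r₁ r₂ hr₁ hr₂ => ?_⟩
  rw [kernel_conv ha hν hχ₁ hs₁ hχ₂ hs₂ t r₁ r₂ hr₂]
  set m₁ := r₁ ^ ν * (1 + r₁) ^ (-(ν + 1 / 2)) with hm₁
  set m₂ := r₂ ^ ν * (1 + r₂) ^ (-(ν + 1 / 2)) with hm₂
  have hm₁0 : 0 ≤ m₁ := by positivity
  have hm₂0 : 0 ≤ m₂ := by positivity
  have hS : 0 ≤ S4 N t r₁ r₂ := by
    unfold S4
    have := hw_nonneg N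
    linarith [this (t + r₁ + r₂), this (t + r₁ - r₂), this (t - r₁ + r₂), this (t - r₁ - r₂)]
  set c := C1 * C2 * 2 ^ N * m₁ * m₂ * S4 N t r₁ r₂ with hc
  have hInt0 := ((((hw_affine_integrable hN (-r₂)).add (hw_affine_integrable hN r₂)).add
    (hw_affine_integrable hN (t + r₁))).add (hw_affine_integrable hN (t - r₁))).const_mul c
  refine (norm_integral_le_of_norm_le hInt0 (Filter.Eventually.of_forall fun w => ?_)).trans
    (le_of_eq ?_)
  · rw [norm_mul]
    have b2 := h2 r₂ (-(2 * Real.pi * w)) hr₂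
    have b1 := h1 r₁ (t + 2 * Real.pi * w) hr₁
    set u := 2 * Real.pi * w
    have e1 : ((1 + |-u + r₂|) ^ N)⁻¹ = hw N (u + -r₂) := by
      rw [← hw_neg, hw]; congr 4; ring
    have e2 : ((1 + |-u - r₂|) ^ N)⁻¹ = hw N (u + r₂) := by
      rw [← hw_neg, hw]; congr 4; ring
    have e3 : ((1 + |t + u + r₁|) ^ N)⁻¹ = hw N (u + (t + r₁)) := by
      rw [hw]; congr 4; ring
    have e4 : ((1 + |t + u - r₁|) ^ N)⁻¹ = hw N (u + (t - r₁)) := by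
      rw [hw]; congr 4; ring
    rw [e1, e2] at b2
    rw [e3, e4] at b1
    have p1 := hw_mul N (u + (t + r₁)) (u + -r₂)
    have p2 := hw_mul N (u + (t + r₁)) (u + r₂)
    have p3 := hw_mul N (u + (t - r₁)) (u + -r₂)
    have p4 := hw_mul N (u + (t - r₁)) (u + r₂)
    rw [show u + (t + r₁) - (u + -r₂) = t + r₁ + r₂ by ring] at p1
    rw [show u + (t + r₁) - (u + r₂) = t + r₁ - r₂ by ring] at p2
    rw [show u + (t - r₁) - (u + -r₂) = t - r₁ + r₂ by ring] at p3
    rw [show u + (t - r₁) - (u + r₂) = t - r₁ - r₂ by ring] at p4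
    simp only [Pi.add_apply]
    have g1 := hw_nonneg N (u + (t + r₁))
    have g2 := hw_nonneg N (u + (t - r₁))
    have g3 := hw_nonneg N (u + -r₂)
    have g4 := hw_nonneg N (u + r₂)
    have k1 := hw_nonneg N (t + r₁ + r₂)
    have k2 := hw_nonneg N (t + r₁ - r₂)
    have k3 := hw_nonneg N (t - r₁ + r₂)
    have k4 := hw_nonneg N (t - r₁ - r₂)
    set x1 := hw N (u + (t + r₁))
    set x2 := hw N (u + (t - r₁))
    set y1 := hw N (u + -r₂)
    set y2 := hw N (u + r₂)
    have hS4 : S4 N t r₁ r₂ = hw N (t + r₁ + r₂) + hw N (t + r₁ - r₂) + hw N (t - r₁ + r₂) +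
      hw N (t - r₁ - r₂) := rfl
    set z1 := hw N (t + r₁ + r₂)
    set z2 := hw N (t + r₁ - r₂)
    set z3 := hw N (t - r₁ + r₂)
    set z4 := hw N (t - r₁ - r₂)
    have hprod : (y1 + y2) * (x1 + x2) ≤
        2 ^ N * ((z1 + z2 + z3 + z4) * (y1 + y2 + x1 + x2)) := by
      calc (y1 + y2) * (x1 + x2) = x1 * y1 + x1 * y2 + x2 * y1 + x2 * y2 := by ring
        _ ≤ 2 ^ N * z1 * (x1 + y1) + 2 ^ N * z2 * (x1 + y2) + 2 ^ N * z3 * (x2 + y1) +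
            2 ^ N * z4 * (x2 + y2) := by linarith
        _ = 2 ^ N * (z1 * (x1 + y1) + z2 * (x1 + y2) + z3 * (x2 + y1) + z4 * (x2 + y2)) := by ring
        _ ≤ 2 ^ N * (z1 * (y1 + y2 + x1 + x2) + z2 * (y1 + y2 + x1 + x2) +
            z3 * (y1 + y2 + x1 + x2) + z4 * (y1 + y2 + x1 + x2)) := by
            refine mul_le_mul_of_nonneg_left (add_le_add (add_le_add (add_le_add ?_ ?_) ?_) ?_)
              (by positivity) <;> exact mul_le_mul_of_nonneg_left (by linarith) (by assumption)
        _ = _ := by ring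
    calc _ ≤ (C2 * m₂ * (y1 + y2)) * (C1 * m₁ * (x1 + x2)) := by gcongr
      _ = C1 * C2 * m₁ * m₂ * ((y1 + y2) * (x1 + x2)) := by ring
      _ ≤ C1 * C2 * m₁ * m₂ * (2 ^ N * ((z1 + z2 + z3 + z4) * (y1 + y2 + x1 + x2))) := by
        gcongr
      _ = _ := by rw [hc, hS4]; ring
  · rw [integral_const_mul]
    have i1 := hw_affine_integrable hN (-r₂)
    have i2 := hw_affine_integrable hN (r₂)
    have i3 := hw_affine_integrable hN (t + r₁)
    have i4 := hw_affine_integrable hN (t - r₁)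
    rw [integral_add' ((i1.add i2).add i3) i4, integral_add' (i1.add i2) i3, integral_add' i1 i2]
    simp only [hw_affine_integral, ← hH]
    rw [hc]
    ring

lemma Kl_bound {n : ℕ} {ν : ℝ} (hν : 0 < ν) {φ : ℝ → ℝ} (hφ : ContDiff ℝ (⊤ : ℕ∞) φ)
    (hφsupp : Function.support φ ⊆ Set.Icc (1 / 2 : ℝ) 2) (N : ℕ) (hN : 2 ≤ N) :
    ∃ C : ℝ, 0 ≤ C ∧ ∀ t r₁ r₂ : ℝ, 0 < r₁ → 0 < r₂ →
      ‖Kl n ν φ t r₁ r₂‖ ≤ (r₁ * r₂) ^ (-((n : ℝ) - 2) / 2) *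
      (C * (r₁ ^ ν * (1 + r₁) ^ (-(ν + 1 / 2))) * (r₂ ^ ν * (1 + r₂) ^ (-(ν + 1 / 2))) *
        S4 N t r₁ r₂) := by
  have hts : tsupport φ ⊆ Set.Icc (1 / 2 : ℝ) 2 := closure_minimal hφsupp isClosed_Icc
  let η : ContDiffBump (5 / 4 : ℝ) := ⟨3 / 4, 1, by norm_num, by norm_num⟩
  have hs1 : tsupport (fun ρ => φ ρ * ρ) ⊆ Set.Icc (1 / 4 : ℝ) (9 / 4) := by
    refine (tsupport_mul_subset_left (f := φ) (g := fun ρ => ρ)).trans (hts.trans ?_)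
    exact Set.Icc_subset_Icc (by norm_num) (by norm_num)
  have hs2 : tsupport η ⊆ Set.Icc (1 / 4 : ℝ) (9 / 4) := by
    rw [η.tsupport_eq, Real.closedBall_eq_Icc]
    exact Set.Icc_subset_Icc (by simp only [η]; norm_num) (by simp only [η]; norm_num)
  obtain ⟨C, hC, h⟩ := kernel_bound (a := 1 / 4) (b := 9 / 4) (χ₁ := fun ρ => φ ρ * ρ)
    (χ₂ := η) (by norm_num) hν (hφ.mul contDiff_id) hs1 η.contDiff hs2 N hN
  · refine ⟨C, hC, fun t r₁ r₂ hr₁ hr₂ => ?_⟩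
    rw [Kl, norm_mul, Complex.norm_real, Real.norm_of_nonneg (by positivity)]
    gcongr
    refine le_trans (le_of_eq ?_) (h t r₁ r₂ hr₁ hr₂)
    congr 1
    rw [← integral_indicator measurableSet_Ioi]
    congr 1
    ext ρ
    by_cases h0 : φ ρ = 0
    · simp [Set.indicator, h0]
    have hρ := hφsupp h0
    rw [Set.indicator_of_mem (by rw [Set.mem_Ioi]; linarith [hρ.1])]
    have : η ρ = 1 := by
      apply η.one_of_mem_closedBall
      rw [Real.closedBall_eq_Icc]
      constructor
      · have := hρ.1
        simp only [η]
        linarith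
      · have := hρ.2
        simp only [η]
        linarith
    rw [this]
    push_cast
    ring

lemma abstract_holder {μ : Measure ℝ} {p q : ℝ} (hp : 2 ≤ p) (hq : 1 / p + 1 / q = 1)
    {v k f : ℝ → ENNReal} (hv : Measurable v) (hk : Measurable k) (hf : Measurable f)
    (hk1 : ∀ s, k s ≤ 1) :
    (∫⁻ s, v s * k s * f s ∂μ) ^ p ≤
      (∫⁻ s, k s * f s ^ q ∂μ) * (∫⁻ s, v s ^ p * k s ∂μ) * (∫⁻ s, f s ^ q ∂μ) ^ (p - 2) := by
  have hp0 : 0 < p := by linarith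
  have hq' : q * (1 - 1 / p) = 1 := by
    have : q ≠ 0 := by
      rintro rfl
      have : 1 / p ≤ 1 / 2 := one_div_le_one_div_of_le (by norm_num) hp
      norm_num at hq
      norm_num at this
      linarith
    have h1 : 1 - 1 / p = 1 / q := by linarith
    rw [h1]; field_simp
  have hq0 : 0 < q := by
    have : 0 < 1 - 1 / p := by
      have : 1 / p ≤ 1 / 2 := one_div_le_one_div_of_le (by norm_num) hp
      linarith
    by_contra h
    push Not at h
    nlinarith
  have h2p : 0 ≤ 1 - 2 / p := by
    have : 2 / p ≤ 1 := by rw [div_le_one hp0]; exact hp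
    linarith
  have hpt : ∀ s, v s * k s * f s ≤
      (k s * f s ^ q) ^ (1 / p) * (v s ^ p * k s) ^ (1 / p) * (f s ^ q) ^ (1 - 2 / p) := by
    intro s
    rw [ENNReal.mul_rpow_of_nonneg _ _ (by positivity), ENNReal.mul_rpow_of_nonneg _ _ (by positivity),
      ← ENNReal.rpow_mul, ← ENNReal.rpow_mul, ← ENNReal.rpow_mul]
    have e1 : v s ^ (p * (1 / p)) = v s := by
      rw [mul_one_div_cancel hp0.ne', ENNReal.rpow_one]
    have e2 : f s = f s ^ (q * (1 / p)) * f s ^ (q * (1 - 2 / p)) := by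
      rw [← ENNReal.rpow_add_of_nonneg _ _ (by positivity) (by positivity), ← mul_add,
        show 1 / p + (1 - 2 / p) = 1 - 1 / p by ring, hq', ENNReal.rpow_one]
    have e3 : k s ≤ k s ^ (1 / p) * k s ^ (1 / p) := by
      rw [← ENNReal.rpow_add_of_nonneg _ _ (by positivity) (by positivity)]
      calc k s = k s ^ (1 : ℝ) := by simp
        _ ≤ _ := ENNReal.rpow_le_rpow_of_exponent_ge (hk1 s) (by
          have : 1 / p ≤ 1 / 2 := one_div_le_one_div_of_le (by norm_num) hp
          linarith)
    rw [e1]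
    calc v s * k s * f s ≤ v s * (k s ^ (1 / p) * k s ^ (1 / p)) *
          (f s ^ (q * (1 / p)) * f s ^ (q * (1 - 2 / p))) := by
          rw [← e2]; gcongr
      _ = _ := by ring
  have hH := ENNReal.lintegral_prod_norm_pow_le (μ := μ) (Finset.univ : Finset (Fin 3))
    (f := ![fun s => k s * f s ^ q, fun s => v s ^ p * k s, fun s => f s ^ q])
    (by intro i _; fin_cases i <;> simp <;> fun_prop)
    (p := ![1 / p, 1 / p, 1 - 2 / p]) (by simp [Fin.sum_univ_three]; ring)
    (by intro i _; fin_cases i <;> simp <;> first | positivity | simpa using h2p)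
  simp only [Fin.prod_univ_three, Matrix.cons_val] at hH
  have h1 := (lintegral_mono hpt).trans hH
  refine (ENNReal.rpow_le_rpow h1 hp0.le).trans (le_of_eq ?_)
  rw [ENNReal.mul_rpow_of_nonneg _ _ hp0.le, ENNReal.mul_rpow_of_nonneg _ _ hp0.le,
    ← ENNReal.rpow_mul, ← ENNReal.rpow_mul, ← ENNReal.rpow_mul, one_div_mul_cancel hp0.ne',
    ENNReal.rpow_one, ENNReal.rpow_one, show (1 - 2 / p) * p = p - 2 by field_simp]

lemma abstract_schur {μ : Measure ℝ} [SFinite μ] {p q : ℝ} (hp : 2 ≤ p) (hq : 1 / p + 1 / q = 1)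
    {v f : ℝ → ENNReal} {k : ℝ → ℝ → ENNReal} (hv : Measurable v)
    (hk : Measurable (Function.uncurry k)) (hf : Measurable f)
    (hk1 : ∀ r s, k r s ≤ 1) (hsymm : ∀ r s, k r s = k s r) {A : ENNReal}
    (hA : ∀ r, ∫⁻ s, v s ^ p * k r s ∂μ ≤ A) :
    (∫⁻ r, (v r * ∫⁻ s, v s * k r s * f s ∂μ) ^ p ∂μ) ≤
      A ^ (2 : ℝ) * (∫⁻ s, f s ^ q ∂μ) ^ (p - 1) := by
  have hp0 : 0 < p := by linarith
  set F := ∫⁻ s, f s ^ q ∂μ with hF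
  have hkr : ∀ r, Measurable (k r) := fun r => hk.comp measurable_prodMk_left
  calc (∫⁻ r, (v r * ∫⁻ s, v s * k r s * f s ∂μ) ^ p ∂μ)
      ≤ ∫⁻ r, (A * F ^ (p - 2)) * ∫⁻ s, v r ^ p * (k r s * f s ^ q) ∂μ ∂μ := by
        refine lintegral_mono fun r => ?_
        rw [ENNReal.mul_rpow_of_nonneg _ _ hp0.le]
        have h := abstract_holder (μ := μ) hp hq hv (hkr r) hf (hk1 r)
        rw [lintegral_const_mul (v r ^ p) (f := fun s => k r s * f s ^ q)
          ((hkr r).mul (hf.pow_const q))]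
        calc _ ≤ v r ^ p * ((∫⁻ s, k r s * f s ^ q ∂μ) * A * F ^ (p - 2)) := by
              gcongr
              refine h.trans ?_
              gcongr
              exact hA r
          _ = _ := by ring
    _ = (A * F ^ (p - 2)) * ∫⁻ s, ∫⁻ r, v r ^ p * (k r s * f s ^ q) ∂μ ∂μ := by
        have hm : Measurable (Function.uncurry fun r s => v r ^ p * (k r s * f s ^ q)) :=
          ((hv.comp measurable_fst).pow_const p).mul
            (hk.mul ((hf.comp measurable_snd).pow_const q))
        rw [lintegral_const_mul _ hm.lintegral_prod_right, lintegral_lintegral_swap hm.aemeasurable]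
    _ ≤ (A * F ^ (p - 2)) * ∫⁻ s, A * f s ^ q ∂μ := by
        gcongr with s
        calc ∫⁻ r, v r ^ p * (k r s * f s ^ q) ∂μ = ∫⁻ r, (v r ^ p * k s r) * f s ^ q ∂μ := by
              congr 1; ext r; rw [hsymm r s, mul_assoc]
          _ = (∫⁻ r, (v r ^ p * k s r) ∂μ) * f s ^ q :=
              lintegral_mul_const _ ((hv.pow_const p).mul (hkr s))
          _ ≤ _ := by gcongr; exact hA s
    _ = (A * F ^ (p - 2)) * (A * F) := by rw [lintegral_const_mul _ (hf.pow_const q)]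
    _ = _ := by
        rw [show p - 1 = (p - 2) + 1 by ring, ENNReal.rpow_add_of_nonneg _ _ (by linarith) one_pos.le,
          ENNReal.rpow_one, show (2 : ℝ) = ((2 : ℕ) : ℝ) by norm_num, ENNReal.rpow_natCast]
        ring

lemma hw_decay {N : ℕ} {γ t x R : ℝ} (hγ : 0 ≤ γ) (hN : γ + 2 ≤ N) (hR : 0 < R)
    (h : 1 + |t| ≤ (1 + |x|) * R) :
    hw N x ≤ (1 + |t|) ^ (-γ) * R ^ γ * hw 2 x := by
  have hx : 1 ≤ 1 + |x| := by linarith [abs_nonneg x]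
  have hx0 : 0 < 1 + |x| := by linarith
  have h1 : hw N x ≤ (1 + |x|) ^ (-γ) * hw 2 x := by
    have e : ∀ M : ℕ, hw M x = (1 + |x|) ^ (-(M : ℝ)) := by
      intro M
      rw [hw, Real.rpow_neg hx0.le, Real.rpow_natCast]
    rw [e, e, ← Real.rpow_add hx0]
    apply Real.rpow_le_rpow_of_exponent_le hx
    push_cast
    linarith
  refine h1.trans (mul_le_mul_of_nonneg_right ?_ (hw_nonneg 2 x))
  have h2 : (1 + |x|) ^ (-γ) = ((1 + |x|) * R) ^ (-γ) * R ^ γ := by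
    rw [Real.mul_rpow hx0.le hR.le, mul_assoc, ← Real.rpow_add hR]
    simp
  rw [h2]
  exact mul_le_mul_of_nonneg_right
    (Real.rpow_le_rpow_of_nonpos (by positivity) h (neg_nonpos.2 hγ)) (by positivity)

lemma S4_decay {N : ℕ} {γ t r₁ r₂ : ℝ} (hγ : 0 ≤ γ) (hN : γ + 2 ≤ N) (h₁ : 0 < r₁)
    (h₂ : 0 < r₂) :
    S4 N t r₁ r₂ ≤ (1 + |t|) ^ (-γ) * ((1 + r₁) ^ γ * (1 + r₂) ^ γ) * S4 2 t r₁ r₂ := by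
  have key : ∀ x, |t| ≤ |x| + r₁ + r₂ →
      hw N x ≤ (1 + |t|) ^ (-γ) * ((1 + r₁) ^ γ * (1 + r₂) ^ γ) * hw 2 x := by
    intro x hx
    rw [← Real.mul_rpow (by positivity) (by positivity)]
    apply hw_decay hγ hN (by positivity)
    have := abs_nonneg x
    have q1 : 0 ≤ |x| * r₁ := by positivity
    have q2 : 0 ≤ |x| * r₂ := by positivity
    have q3 : 0 ≤ r₁ * r₂ := by positivity
    have q4 : 0 ≤ |x| * r₁ * r₂ := by positivity
    nlinarith
  have tri : ∀ y, |y| ≤ r₁ + r₂ → |t| ≤ |t + y| + r₁ + r₂ := by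
    intro y hy
    have := abs_sub (t + y) y
    rw [add_sub_cancel_right] at this
    linarith
  have tri2 : ∀ x y, x = t + y → |y| ≤ r₁ + r₂ → |t| ≤ |x| + r₁ + r₂ := by
    rintro x y rfl hy
    exact tri y hy
  have a1 := key (t + r₁ + r₂) (tri2 _ (r₁ + r₂) (by ring) (abs_le.2 (by constructor <;> linarith)))
  have a2 := key (t + r₁ - r₂) (tri2 _ (r₁ - r₂) (by ring) (abs_le.2 (by constructor <;> linarith)))
  have a3 := key (t - r₁ + r₂) (tri2 _ (-r₁ + r₂) (by ring) (abs_le.2 (by constructor <;> linarith)))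
  have a4 := key (t - r₁ - r₂) (tri2 _ (-r₁ - r₂) (by ring) (abs_le.2 (by constructor <;> linarith)))
  unfold S4
  rw [mul_add, mul_add, mul_add]
  linarith

/-- The radial weight. -/
noncomputable def Vw (n : ℕ) (ν γ r : ℝ) : ℝ :=
  r ^ (-(((n : ℝ) - 2) / 2 - ν)) * (1 + r) ^ (γ - ν - 1 / 2)

lemma Kl_bound' {n : ℕ} {ν γ : ℝ} (hν : 0 < ν) (hγ : 0 ≤ γ) {φ : ℝ → ℝ}
    (hφ : ContDiff ℝ (⊤ : ℕ∞) φ) (hφsupp : Function.support φ ⊆ Set.Icc (1 / 2 : ℝ) 2) :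
    ∃ C : ℝ, 0 ≤ C ∧ ∀ t r₁ r₂ : ℝ, 0 < r₁ → 0 < r₂ →
      ‖Kl n ν φ t r₁ r₂‖ ≤ (C * (1 + |t|) ^ (-γ)) *
        (Vw n ν γ r₁ * (Vw n ν γ r₂ * (S4 2 t r₁ r₂ / 4))) := by
  obtain ⟨N, hN⟩ := exists_nat_ge (γ + 2)
  have hN2 : 2 ≤ N := by
    have : (2 : ℝ) ≤ N := by linarith
    exact_mod_cast this
  obtain ⟨C, hC, h⟩ := Kl_bound (n := n) hν hφ hφsupp N hN2
  refine ⟨4 * C, by positivity, fun t r₁ r₂ h₁ h₂ => (h t r₁ r₂ h₁ h₂).trans ?_⟩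
  have hV : ∀ r : ℝ, 0 < r → Vw n ν γ r =
      r ^ (-((n : ℝ) - 2) / 2) * (r ^ ν * (1 + r) ^ (-(ν + 1 / 2))) * (1 + r) ^ γ := by
    intro r hr
    have hr1 : 0 < 1 + r := by linarith
    rw [Vw, show -(((n : ℝ) - 2) / 2 - ν) = -((n : ℝ) - 2) / 2 + ν by ring, Real.rpow_add hr,
      show γ - ν - 1 / 2 = -(ν + 1 / 2) + γ by ring, Real.rpow_add hr1]
    ring
  rw [hV r₁ h₁, hV r₂ h₂, Real.mul_rpow h₁.le h₂.le]
  have hS := S4_decay (t := t) hγ hN h₁ h₂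
  calc _ ≤ r₁ ^ (-((n : ℝ) - 2) / 2) * r₂ ^ (-((n : ℝ) - 2) / 2) *
      (C * (r₁ ^ ν * (1 + r₁) ^ (-(ν + 1 / 2))) * (r₂ ^ ν * (1 + r₂) ^ (-(ν + 1 / 2))) *
        ((1 + |t|) ^ (-γ) * ((1 + r₁) ^ γ * (1 + r₂) ^ γ) * S4 2 t r₁ r₂)) := by gcongr
    _ = _ := by ring

lemma S4_symm (N : ℕ) (t r s : ℝ) : S4 N t r s = S4 N t s r := by
  unfold S4
  rw [show t + r + s = t + s + r by ring, show t + r - s = t - s + r by ring,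
    show t - r + s = t + s - r by ring, show t - r - s = t - s - r by ring]
  ring

lemma hw_le_one (N : ℕ) (u : ℝ) : hw N u ≤ 1 := by
  unfold hw
  apply inv_le_one_of_one_le₀
  apply one_le_pow₀
  linarith [abs_nonneg u]

lemma S4_le (N : ℕ) (t r s : ℝ) : S4 N t r s / 4 ≤ 1 := by
  unfold S4
  linarith [hw_le_one N (t + r + s), hw_le_one N (t + r - s), hw_le_one N (t - r + s),
    hw_le_one N (t - r - s)]

lemma S4_nonneg (N : ℕ) (t r s : ℝ) : 0 ≤ S4 N t r s := by
  unfold S4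
  linarith [hw_nonneg N (t + r + s), hw_nonneg N (t + r - s), hw_nonneg N (t - r + s),
    hw_nonneg N (t - r - s)]

lemma S4_continuous (N : ℕ) (t : ℝ) : Continuous fun z : ℝ × ℝ => S4 N t z.1 z.2 := by
  have := hw_continuous N
  unfold S4
  fun_prop

lemma S4_lintegral (t r : ℝ) :
    ∫⁻ s, ENNReal.ofReal (S4 2 t r s / 4) ≤ 4 * ∫⁻ u, ENNReal.ofReal (hw 2 u) := by
  have hm : ∀ c : ℝ, Measurable fun s : ℝ => ENNReal.ofReal (hw 2 (s + c)) := fun c =>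
    ((hw_continuous 2).comp (continuous_id.add continuous_const)).measurable.ennreal_ofReal
  calc ∫⁻ s, ENNReal.ofReal (S4 2 t r s / 4) ≤
      ∫⁻ s, (ENNReal.ofReal (hw 2 (s + (t + r))) + ENNReal.ofReal (hw 2 (s + (-(t + r)))) +
        ENNReal.ofReal (hw 2 (s + (t - r))) + ENNReal.ofReal (hw 2 (s + (-(t - r))))) := by
        refine lintegral_mono fun s => ?_
        have g := hw_nonneg 2
        rw [← ENNReal.ofReal_add (g _) (g _), ← ENNReal.ofReal_add (add_nonneg (g _) (g _)) (g _),
          ← ENNReal.ofReal_add (add_nonneg (add_nonneg (g _) (g _)) (g _)) (g _)]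
        apply ENNReal.ofReal_le_ofReal
        have hn := S4_nonneg 2 t r s
        have : S4 2 t r s = hw 2 (s + (t + r)) + hw 2 (s + (-(t + r))) + hw 2 (s + (t - r)) +
            hw 2 (s + (-(t - r))) := by
          rw [← hw_neg 2 (s + (-(t + r))), ← hw_neg 2 (s + (-(t - r)))]
          unfold S4
          rw [show s + (t + r) = t + r + s by ring, show -(s + -(t + r)) = t + r - s by ring,
            show s + (t - r) = t - r + s by ring, show -(s + -(t - r)) = t - r - s by ring]
        linarith
    _ = _ := by
        rw [lintegral_add_right _ (hm _), lintegral_add_right _ (hm _),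
          lintegral_add_right _ (hm _)]
        have e : ∀ c : ℝ, ∫⁻ s, ENNReal.ofReal (hw 2 (s + c)) = ∫⁻ u, ENNReal.ofReal (hw 2 u) :=
          fun c => lintegral_add_right_eq_self (fun u => ENNReal.ofReal (hw 2 u)) c
        simp only [e]
        ring

lemma lintegral_rMeasure (n : ℕ) {F : ℝ → ENNReal} (hF : Measurable F) :
    ∫⁻ r, F r ∂(rMeasure n) =
      ∫⁻ r in Set.Ioi (0 : ℝ), ENNReal.ofReal (r ^ (n - 1)) * F r := by
  rw [rMeasure, lintegral_withDensity_eq_lintegral_mul _ (by fun_prop) hF]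
  rfl

lemma Vw_nonneg (n : ℕ) (ν γ r : ℝ) (hr : 0 < r) : 0 ≤ Vw n ν γ r := by
  unfold Vw; positivity

lemma Vw_measurable (n : ℕ) (ν γ : ℝ) : Measurable (Vw n ν γ) := by
  unfold Vw; fun_prop

lemma Vw_pow {n : ℕ} (hn : 3 ≤ n) {ν p r : ℝ} (hp : 2 ≤ p) (hr : 0 < r) :
    r ^ (n - 1) * Vw n ν (((n : ℝ) - 1) / 2 * (1 - 2 / p)) r ^ p =
      (r / (1 + r)) ^ ((n : ℝ) - 1 - p * (((n : ℝ) - 2) / 2 - ν)) := by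
  have hr1 : 0 < 1 + r := by linarith
  have hp0 : 0 < p := by linarith
  rw [Vw, Real.mul_rpow (by positivity) (by positivity), ← Real.rpow_mul hr.le,
    ← Real.rpow_mul hr1.le, Real.div_rpow hr.le hr1.le, ← Real.rpow_natCast,
    ← mul_assoc, ← Real.rpow_add hr, div_eq_mul_inv (r ^ _), ← Real.rpow_neg hr1.le,
    Nat.cast_sub (by omega)]
  congr 2
  · push_cast; ring
  · field_simp; ring

lemma ratio_bound {β r : ℝ} (hr : 0 < r) :
    (r / (1 + r)) ^ β ≤ (1 / 2 : ℝ) ^ (min β 0) *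
      ((Set.Ioc (0 : ℝ) 1).indicator (fun x => x ^ (min β 0)) r + 1) := by
  have hb : min β 0 ≤ 0 := min_le_right _ _
  have h1 : (r / (1 + r)) ^ β ≤ (r / (1 + r)) ^ (min β 0) :=
    Real.rpow_le_rpow_of_exponent_ge (by positivity) (by rw [div_le_one (by positivity)]; linarith)
      (min_le_left _ _)
  refine h1.trans ?_
  by_cases h : r ≤ 1
  · rw [Set.indicator_of_mem (show r ∈ Set.Ioc (0 : ℝ) 1 from ⟨hr, h⟩)]
    calc (r / (1 + r)) ^ (min β 0) ≤ (1 / 2 * r) ^ (min β 0) := by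
          apply Real.rpow_le_rpow_of_nonpos (by positivity) _ hb
          rw [le_div_iff₀ (by positivity)]
          nlinarith
      _ = (1 / 2 : ℝ) ^ (min β 0) * r ^ (min β 0) := Real.mul_rpow (by norm_num) hr.le
      _ ≤ _ := by gcongr; linarith
  · push Not at h
    rw [Set.indicator_of_notMem (fun hh => absurd hh.2 (not_le.2 h)), zero_add, mul_one]
    apply Real.rpow_le_rpow_of_nonpos (by norm_num) _ hb
    rw [le_div_iff₀ (by positivity)]
    linarith

lemma marginal {n : ℕ} (hn : 3 ≤ n) {ν p : ℝ} (hp : 2 ≤ p)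
    (hpν : p * ((n : ℝ) - 2 - 2 * ν) < 2 * n) :
    ∃ A : ENNReal, A ≠ ⊤ ∧ ∀ t r : ℝ,
      ∫⁻ s, ENNReal.ofReal (Vw n ν (((n : ℝ) - 1) / 2 * (1 - 2 / p)) s) ^ p *
        ENNReal.ofReal (S4 2 t r s / 4) ∂(rMeasure n) ≤ A := by
  set γ := ((n : ℝ) - 1) / 2 * (1 - 2 / p) with hγ
  set β := (n : ℝ) - 1 - p * (((n : ℝ) - 2) / 2 - ν) with hβ
  have hβ1 : -1 < β := by rw [hβ]; linarith
  have hp0 : 0 < p := by linarith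
  set b := min β 0 with hb
  have hb1 : -1 < b := lt_min hβ1 (by norm_num)
  set D := ENNReal.ofReal ((1 / 2 : ℝ) ^ b) with hD
  set I1 := ∫⁻ r in Set.Ioc (0 : ℝ) 1, ENNReal.ofReal (r ^ b) with hI1
  set I2 := ∫⁻ u, ENNReal.ofReal (hw 2 u) with hI2
  have hI1t : I1 ≠ ⊤ := by
    have h := (intervalIntegral.intervalIntegrable_rpow' (a := 0) (b := 1) hb1).1
    exact (Integrable.lintegral_lt_top h).ne
  have hI2t : I2 ≠ ⊤ := (Integrable.lintegral_lt_top (hw_integrable le_rfl)).ne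
  refine ⟨D * (I1 + 4 * I2), ENNReal.mul_ne_top ENNReal.ofReal_ne_top
    (ENNReal.add_ne_top.2 ⟨hI1t, ENNReal.mul_ne_top (by norm_num) hI2t⟩), fun t r => ?_⟩
  have hSm : Measurable fun s => ENNReal.ofReal (S4 2 t r s / 4) :=
    (((S4_continuous 2 t).comp (Continuous.prodMk_right r)).div_const 4).measurable.ennreal_ofReal
  rw [lintegral_rMeasure n (F := fun s => ENNReal.ofReal (Vw n ν γ s) ^ p *
    ENNReal.ofReal (S4 2 t r s / 4)) (((Vw_measurable n ν γ).ennreal_ofReal.pow_const p).mul hSm)]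
  have hind : Measurable ((Set.Ioc (0 : ℝ) 1).indicator fun x => ENNReal.ofReal (x ^ b)) :=
    Measurable.indicator (by fun_prop) measurableSet_Ioc
  calc _ ≤ ∫⁻ s in Set.Ioi (0 : ℝ), D *
        ((Set.Ioc (0 : ℝ) 1).indicator (fun x => ENNReal.ofReal (x ^ b)) s +
          ENNReal.ofReal (S4 2 t r s / 4)) := by
        refine setLIntegral_mono' measurableSet_Ioi fun s hs => ?_
        have hs0 : 0 < s := hs
        have hV := Vw_nonneg n ν γ s hs0
        rw [← mul_assoc, ENNReal.ofReal_rpow_of_nonneg hV hp0.le,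
          ← ENNReal.ofReal_mul (by positivity), Vw_pow hn hp hs0]
        have h1 := ratio_bound (β := β) hs0
        have hi : (Set.Ioc (0 : ℝ) 1).indicator (fun x => ENNReal.ofReal (x ^ b)) s =
            ENNReal.ofReal ((Set.Ioc (0 : ℝ) 1).indicator (fun x => x ^ b) s) := by
          by_cases h : s ∈ Set.Ioc (0 : ℝ) 1 <;> simp [h]
        have hi0 : 0 ≤ (Set.Ioc (0 : ℝ) 1).indicator (fun x => x ^ b) s :=
          Set.indicator_nonneg (fun x hx => Real.rpow_nonneg hx.1.le _) _
        have hS0 : 0 ≤ S4 2 t r s / 4 := by have := S4_nonneg 2 t r s; positivity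
        have hS1 := S4_le 2 t r s
        rw [hi, ← ENNReal.ofReal_add hi0 hS0, hD, ← ENNReal.ofReal_mul (by positivity),
          ← ENNReal.ofReal_mul (by positivity)]
        apply ENNReal.ofReal_le_ofReal
        calc _ ≤ ((1 / 2 : ℝ) ^ b * ((Set.Ioc (0 : ℝ) 1).indicator (fun x => x ^ b) s + 1)) *
              (S4 2 t r s / 4) := by gcongr
          _ = (1 / 2 : ℝ) ^ b * ((Set.Ioc (0 : ℝ) 1).indicator (fun x => x ^ b) s *
              (S4 2 t r s / 4) + S4 2 t r s / 4) := by ring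
          _ ≤ _ := by
              gcongr
              exact mul_le_of_le_one_right hi0 hS1
    _ ≤ ∫⁻ s, D *
        ((Set.Ioc (0 : ℝ) 1).indicator (fun x => ENNReal.ofReal (x ^ b)) s +
          ENNReal.ofReal (S4 2 t r s / 4)) := setLIntegral_le_lintegral _ _
    _ = D * (I1 + ∫⁻ s, ENNReal.ofReal (S4 2 t r s / 4)) := by
        rw [lintegral_const_mul' _ _ ENNReal.ofReal_ne_top, lintegral_add_left hind,
          lintegral_indicator measurableSet_Ioc]
    _ ≤ _ := by
        gcongr
        exact S4_lintegral t r

/-- Dispersive `L^{p'} → L^p` bound for the spherically symmetric frequency-localized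
half-wave kernel: for `n ≥ 3`, `0 < ν ≤ (n-2)/2`, a smooth bump `φ` supported in `[1/2,2]`
with values in `[0,1]`, and `2 ≤ p` with `p (n-2-2ν) < 2n`, one has
`‖(T_ν g)(t, ·)‖_{L^p(r^{n-1}dr)} ≤ C (1+|t|)^{-((n-1)/2)(1-2/p)} ‖g‖_{L^{p'}(r^{n-1}dr)}`. -/
theorem Tnu_dispersive_bound (n : ℕ) (hn : 3 ≤ n)
    (ν : ℝ) (hν : 0 < ν) (hν' : ν ≤ ((n : ℝ) - 2) / 2)
    (φ : ℝ → ℝ) (hφ : ContDiff ℝ (⊤ : ℕ∞) φ) (hφ01 : ∀ x, φ x ∈ Set.Icc (0 : ℝ) 1)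
    (hφsupp : Function.support φ ⊆ Set.Icc (1 / 2 : ℝ) 2)
    (p p' : ℝ) (hp : 2 ≤ p) (hpν : p * ((n : ℝ) - 2 - 2 * ν) < 2 * n)
    (hp' : 1 / p + 1 / p' = 1) :
    ∃ C : ℝ, 0 < C ∧ ∀ (t : ℝ) (g : ℝ → ℂ), Measurable g → (∃ M : ℝ, ∀ x, ‖g x‖ ≤ M) →
      HasCompactSupport g → tsupport g ⊆ Set.Ioi 0 →
      eLpNorm (fun r₁ => Tnu n ν φ g t r₁) (ENNReal.ofReal p) (rMeasure n) ≤
        ENNReal.ofReal (C * (1 + |t|) ^ (-(((n : ℝ) - 1) / 2) * (1 - 2 / p))) *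
          eLpNorm g (ENNReal.ofReal p') (rMeasure n) := by
  have hp0 : 0 < p := by linarith
  have h12 : 1 / p ≤ 1 / 2 := one_div_le_one_div_of_le (by norm_num) hp
  have hp'0 : 0 < p' := by
    have : 0 < 1 / p' := by linarith
    exact one_div_pos.1 this
  have hn3 : (3 : ℝ) ≤ n := by exact_mod_cast hn
  obtain ⟨A, hAt, hA⟩ := marginal hn hp hpν
  set γ := ((n : ℝ) - 1) / 2 * (1 - 2 / p) with hγ
  have hγ0 : 0 ≤ γ := by
    apply mul_nonneg (by linarith)
    have : 2 / p ≤ 1 := by rw [div_le_one hp0]; exact hp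
    linarith
  obtain ⟨C, hC, hK⟩ := Kl_bound' (n := n) hν hγ0 hφ hφsupp
  refine ⟨C * (A.toReal ^ (2 / p)) + 1, by positivity, fun t g hg _ _ _ => ?_⟩
  have hexp : -(((n : ℝ) - 1) / 2) * (1 - 2 / p) = -γ := by rw [hγ]; ring
  rw [hexp]
  set c := ENNReal.ofReal (C * (1 + |t|) ^ (-γ)) with hc
  set v : ℝ → ENNReal := fun r => ENNReal.ofReal (Vw n ν γ r) with hv
  set k : ℝ → ℝ → ENNReal := fun r s => ENNReal.ofReal (S4 2 t r s / 4) with hk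
  have hvm : Measurable v := (Vw_measurable n ν γ).ennreal_ofReal
  have hkm : Measurable (Function.uncurry k) :=
    ((S4_continuous 2 t).div_const 4).measurable.ennreal_ofReal
  have hfm : Measurable fun s => ‖g s‖ₑ := hg.enorm
  have : SFinite (rMeasure n) := by unfold rMeasure; infer_instance
  have hS := abstract_schur (μ := rMeasure n) hp hp' hvm hkm hfm
    (fun r s => by
      rw [hk]
      exact ENNReal.ofReal_le_one.2 (S4_le 2 t r s))
    (fun r s => by simp only [hk]; rw [S4_symm]) (A := A) (fun r => hA t r)
  have hpt : ∀ r₁ ∈ Set.Ioi (0 : ℝ), ‖Tnu n ν φ g t r₁‖ₑ ≤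
      c * (v r₁ * ∫⁻ s, v s * k r₁ s * ‖g s‖ₑ ∂(rMeasure n)) := by
    intro r₁ hr₁
    have hkr : Measurable (k r₁) := hkm.of_uncurry_left
    have hm : Measurable fun s => v s * k r₁ s * ‖g s‖ₑ := (hvm.mul hkr).mul hfm
    rw [lintegral_rMeasure n hm, ← lintegral_const_mul _ (by fun_prop),
      ← lintegral_const_mul _ (by fun_prop), Tnu]
    refine (enorm_integral_le_lintegral_enorm _).trans
      (setLIntegral_mono' measurableSet_Ioi fun s hs => ?_)
    have hs0 : 0 < s := hs
    have hr0 : 0 < r₁ := hr₁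
    have e1 : ‖Kl n ν φ t r₁ s‖ₑ ≤ c * (v r₁ * (v s * k r₁ s)) := by
      rw [hc]
      simp only [hv, hk]
      rw [← ENNReal.ofReal_mul (Vw_nonneg n ν γ s hs0), ← ENNReal.ofReal_mul
        (Vw_nonneg n ν γ r₁ hr0), ← ENNReal.ofReal_mul (by positivity), ← ofReal_norm]
      exact ENNReal.ofReal_le_ofReal (hK t r₁ s hr0 hs0)
    have e2 : ‖((s ^ (n - 1) : ℝ) : ℂ)‖ₑ = ENNReal.ofReal (s ^ (n - 1)) := by
      rw [← ofReal_norm, Complex.norm_real, Real.norm_of_nonneg (by positivity)]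
    rw [enorm_mul, enorm_mul, e2]
    calc _ ≤ c * (v r₁ * (v s * k r₁ s)) * ‖g s‖ₑ * ENNReal.ofReal (s ^ (n - 1)) := by gcongr
      _ = _ := by ring
  have hae : ∀ᵐ r ∂(rMeasure n), r ∈ Set.Ioi (0 : ℝ) := by
    have : rMeasure n ≪ volume.restrict (Set.Ioi (0 : ℝ)) := withDensity_absolutelyContinuous _ _
    exact this (ae_restrict_mem measurableSet_Ioi)
  have q0 : ENNReal.ofReal p ≠ 0 := by simpa using hp0
  have q0' : ENNReal.ofReal p' ≠ 0 := by simpa using hp'0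
  rw [eLpNorm_eq_lintegral_rpow_enorm_toReal q0 ENNReal.ofReal_ne_top,
    eLpNorm_eq_lintegral_rpow_enorm_toReal q0' ENNReal.ofReal_ne_top,
    ENNReal.toReal_ofReal hp0.le, ENNReal.toReal_ofReal hp'0.le]
  set F := ∫⁻ s, ‖g s‖ₑ ^ p' ∂(rMeasure n) with hF
  have hcp : c ^ p ≠ ⊤ := ENNReal.rpow_ne_top_of_nonneg hp0.le ENNReal.ofReal_ne_top
  calc (∫⁻ r, ‖Tnu n ν φ g t r‖ₑ ^ p ∂(rMeasure n)) ^ (1 / p)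
      ≤ (∫⁻ r, c ^ p * (v r * ∫⁻ s, v s * k r s * ‖g s‖ₑ ∂(rMeasure n)) ^ p
          ∂(rMeasure n)) ^ (1 / p) := by
        gcongr ?_ ^ (1 / p)
        refine lintegral_mono_ae ?_
        filter_upwards [hae] with r hr
        rw [← ENNReal.mul_rpow_of_nonneg _ _ hp0.le]
        exact ENNReal.rpow_le_rpow (hpt r hr) hp0.le
    _ = (c ^ p * ∫⁻ r, (v r * ∫⁻ s, v s * k r s * ‖g s‖ₑ ∂(rMeasure n)) ^ p
          ∂(rMeasure n)) ^ (1 / p) := by rw [lintegral_const_mul' _ _ hcp]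
    _ ≤ (c ^ p * (A ^ (2 : ℝ) * F ^ (p - 1))) ^ (1 / p) := by gcongr
    _ = c * A ^ (2 / p) * F ^ (1 / p') := by
        rw [ENNReal.mul_rpow_of_nonneg _ _ (by positivity),
          ENNReal.mul_rpow_of_nonneg _ _ (by positivity), ← ENNReal.rpow_mul, ← ENNReal.rpow_mul,
          ← ENNReal.rpow_mul, mul_one_div_cancel hp0.ne', ENNReal.rpow_one,
          show (p - 1) * (1 / p) = 1 / p' by
            rw [sub_mul, mul_one_div_cancel hp0.ne']; linarith,
          show (2 : ℝ) * (1 / p) = 2 / p by ring, mul_assoc]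
    _ ≤ _ := by
        gcongr
        have : A ^ (2 / p) = ENNReal.ofReal (A.toReal ^ (2 / p)) := by
          rw [← ENNReal.ofReal_rpow_of_nonneg ENNReal.toReal_nonneg (by positivity),
            ENNReal.ofReal_toReal hAt]
        rw [this, hc, ← ENNReal.ofReal_mul (by positivity)]
        apply ENNReal.ofReal_le_ofReal
        have : 0 ≤ (1 + |t|) ^ (-γ) := by positivity
        nlinarith
end

section
/- For all integers m, N ≥ 0 there exist constants R₀ ≥ 1 and C (depending on m, N and φ) such that for all r₁, r₂ ≥ R₀, all t ∈ ℝ and all s ∈ [0, ∞): |(∂/∂s)^m W(t, 𝐧_s)| ≤ C · [ (1+|t−|𝐧_s||)^{-N} + (1+|t+|𝐧_s||)^{-N} ] · (1+|𝐧_s|)^{-1/2} · [ (1 + r₁r₂ sinh s/|𝐧_s|)^m + (1 + r₁r₂/|𝐧_s|)^{m/2} ]. -/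
open MeasureTheory

/-- `W(t,v) = ∫_{ℝ²} φ(|ξ|) e^{i(t|ξ| − v·ξ)} dξ`. -/
noncomputable def Wfun (φ : ℝ → ℝ) (t : ℝ) (v : EuclideanSpace ℝ (Fin 2)) : ℂ :=
  ∫ ξ : EuclideanSpace ℝ (Fin 2),
    (φ ‖ξ‖ : ℂ) * Complex.exp (Complex.I * ((t * ‖ξ‖ - @inner ℝ _ _ v ξ : ℝ) : ℂ))

/-- `𝐧_s = (r₁+r₂, √(2(cosh s−1) r₁ r₂))`, so `‖𝐧_s‖ = √(r₁²+r₂²+2r₁r₂cosh s)`. -/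
noncomputable def nVec (r₁ r₂ s : ℝ) : EuclideanSpace ℝ (Fin 2) :=
  (WithLp.equiv 2 (Fin 2 → ℝ)).symm ![r₁ + r₂, Real.sqrt (2 * (Real.cosh s - 1) * r₁ * r₂)]

open scoped Real ContDiff

/-- Smooth amplitudes (as functions of the cosine) vanishing left of `-1/2`. -/
def PG (G : ℝ → ℝ) : Prop := ContDiff ℝ ∞ G ∧ ∀ c, c < -1/2 → G c = 0

lemma PG.smul_fun {G : ℝ → ℝ} (h : PG G) {a : ℝ → ℝ} (ha : ContDiff ℝ ∞ a) :
    PG (fun c => a c * G c) :=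
  ⟨ha.mul h.1, fun c hc => by simp [h.2 c hc]⟩

lemma PG.add {G H : ℝ → ℝ} (h : PG G) (h' : PG H) : PG (fun c => G c + H c) :=
  ⟨h.1.add h'.1, fun c hc => by simp [h.2 c hc, h'.2 c hc]⟩

lemma PG.deriv {G : ℝ → ℝ} (h : PG G) : PG (deriv G) := by
  refine ⟨((contDiff_infty_iff_deriv).1 h.1).2, fun c hc => ?_⟩
  have : G =ᶠ[nhds c] fun _ => 0 := by
    filter_upwards [Iio_mem_nhds hc] with y hy using h.2 y hy
  rw [this.deriv_eq]; simp

lemma PG.div {G : ℝ → ℝ} (h : PG G) : PG (fun c => G c / (1 + c)) := by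
  refine ⟨?_, fun c hc => by simp [h.2 c hc]⟩
  rw [contDiff_iff_contDiffAt]
  intro c
  by_cases hc : c < -1/2
  · have : (fun c => G c / (1 + c)) =ᶠ[nhds c] fun _ => 0 := by
      filter_upwards [Iio_mem_nhds hc] with y hy
      simp [h.2 y hy]
    exact (contDiffAt_const).congr_of_eventuallyEq this
  · apply ContDiffAt.div h.1.contDiffAt (by fun_prop)
    intro h0; apply hc; linarith

lemma PG.eq_mul {G : ℝ → ℝ} (h : PG G) (c : ℝ) : G c = (1 + c) * (G c / (1 + c)) := by
  by_cases hc : 1 + c = 0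
  · rw [hc, h.2 c (by linarith)]; simp
  · field_simp

/-- the oscillating exponential -/
noncomputable def ee (x θ : ℝ) : ℂ := Complex.exp (Complex.I * ((x * (1 - Real.cos θ) : ℝ) : ℂ))

lemma norm_ee (x θ : ℝ) : ‖ee x θ‖ = 1 := by
  unfold ee; rw [mul_comm]; exact Complex.norm_exp_ofReal_mul_I _

@[fun_prop]
lemma continuous_ee (x : ℝ) : Continuous (ee x) := by unfold ee; fun_prop

lemma hasDerivAt_ee (x θ : ℝ) :
    HasDerivAt (ee x) (Complex.I * x * Real.sin θ * ee x θ) θ := by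
  have h1 : HasDerivAt (fun θ : ℝ => x * (1 - Real.cos θ)) (x * Real.sin θ) θ := by
    have := ((Real.hasDerivAt_cos θ).const_sub 1).const_mul x
    simpa using this
  have h2 := (h1.ofReal_comp.const_mul Complex.I).cexp
  unfold ee
  convert h2 using 1
  push_cast; ring

noncomputable def AA (G : ℝ → ℝ) (j : ℕ) (x : ℝ) : ℂ :=
  ∫ θ in (-π)..π, ((G (Real.cos θ) * (1 - Real.cos θ) ^ j : ℝ) : ℂ) * ee x θ

lemma hasDerivAt_comp_cos {G : ℝ → ℝ} (h : ContDiff ℝ ∞ G) (θ : ℝ) :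
    HasDerivAt (fun θ => G (Real.cos θ)) (-(Real.sin θ * deriv G (Real.cos θ))) θ := by
  have := ((h.differentiable (by simp)) (Real.cos θ)).hasDerivAt.comp θ (Real.hasDerivAt_cos θ)
  refine this.congr_deriv ?_
  ring

lemma AA_step {G : ℝ → ℝ} (h : PG G) (j : ℕ) {x : ℝ} (hx : 0 < x) :
    AA G (j+1) x = (Complex.I / x) *
      AA (fun c => (c * (G c / (1 + c)) + (-(1 - c^2)) * deriv (fun c => G c / (1 + c)) c)
        + (j : ℝ) * G c) j x := by
  set H : ℝ → ℝ := fun c => G c / (1 + c) with hH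
  have hPH : PG H := h.div
  have hder : ∀ θ : ℝ, HasDerivAt (fun θ : ℝ =>
      ((Real.sin θ * H (Real.cos θ) * (1 - Real.cos θ) ^ j : ℝ) : ℂ) * ee x θ)
      ((((Real.cos θ * H (Real.cos θ) + (-(1 - Real.cos θ^2)) * deriv H (Real.cos θ)
        + (j : ℝ) * G (Real.cos θ)) * (1 - Real.cos θ) ^ j : ℝ) : ℂ) * ee x θ
       + Complex.I * x * (((G (Real.cos θ) * (1 - Real.cos θ) ^ (j+1) : ℝ) : ℂ) * ee x θ)) θ := by
    intro θ
    have h1 := ((Real.hasDerivAt_sin θ).mul (hasDerivAt_comp_cos hPH.1 θ)).mul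
      (((Real.hasDerivAt_cos θ).const_sub 1).pow j)
    have h2 := h1.ofReal_comp.mul (hasDerivAt_ee x θ)
    refine h2.congr_deriv ?_
    have hG : G (Real.cos θ) = (1 + Real.cos θ) * H (Real.cos θ) := h.eq_mul _
    have hs : Real.sin θ ^ 2 = 1 - Real.cos θ ^ 2 := Real.sin_sq θ
    have hsC : ((Real.sin θ : ℝ) : ℂ) ^ 2 = 1 - ((Real.cos θ : ℝ) : ℂ) ^ 2 := by
      rw [← Complex.ofReal_pow, hs]; push_cast; rfl
    rw [hG]
    simp only [Pi.mul_apply, Pi.pow_apply]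
    generalize deriv H (Real.cos θ) = H'
    generalize H (Real.cos θ) = H0
    clear h1 h2 hG hs
    generalize Real.cos θ = c at *
    generalize Real.sin θ = s at *
    rcases j with _ | j
    · push_cast
      linear_combination (-(H':ℂ)+Complex.I * x * H0) * ee x θ * hsC
    · push_cast
      try simp only [Nat.add_sub_cancel]
      linear_combination (-(H':ℂ) * (1 - (c : ℂ)) +Complex.I * x * H0 * (1 - (c : ℂ)) + H0 * (j+1)) * ee x θ * (1 - (c : ℂ))^j * hsC
  have hGc := h.1.continuous
  have hHc := hPH.1.continuous
  have hH'c := hPH.deriv.1.continuous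
  have key := intervalIntegral.integral_eq_sub_of_hasDerivAt (a := -π) (b := π)
    (fun θ _ => hder θ) (by apply Continuous.intervalIntegrable; fun_prop)
  rw [intervalIntegral.integral_add (by apply Continuous.intervalIntegrable; fun_prop)
    (by apply Continuous.intervalIntegrable; fun_prop), intervalIntegral.integral_const_mul] at key
  simp only [Real.sin_pi, Real.sin_neg, neg_zero, zero_mul, Complex.ofReal_zero, sub_zero] at key
  change AA (fun c => (c * H c + (-(1 - c^2)) * deriv H c) + (j : ℝ) * G c) j x + Complex.I * x * AA G (j+1) x = 0 at key
  have hx' : (x : ℂ) ≠ 0 := by exact_mod_cast hx.ne'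
  change AA G (j+1) x = (Complex.I / x) *
      AA (fun c => (c * H c + (-(1 - c^2)) * deriv H c) + (j : ℝ) * G c) j x
  generalize AA (fun c => (c * H c + (-(1 - c^2)) * deriv H c) + (j : ℝ) * G c) j x = Z at *
  field_simp
  linear_combination (-Complex.I) * key + (x * AA G (j+1) x) * Complex.I_sq

lemma exists_bound_Icc {G : ℝ → ℝ} (h : Continuous G) :
    ∃ C, 0 ≤ C ∧ ∀ θ : ℝ, |G (Real.cos θ)| ≤ C := by
  obtain ⟨C, hC⟩ := (isCompact_Icc (a := (-1:ℝ)) (b := 1)).exists_bound_of_continuousOn h.continuousOn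
  exact ⟨C, (norm_nonneg _).trans (hC 0 (by norm_num)), fun θ => hC _ ⟨Real.neg_one_le_cos θ, Real.cos_le_one θ⟩⟩

lemma integral_lorentz {x : ℝ} (hx : 0 < x) :
    ∫ θ in (-π)..π, (1 + (√(x/5) * θ)^2)⁻¹ ≤ 10 / √x := by
  have hs : 0 < √(x/5) := Real.sqrt_pos.2 (by positivity)
  have := intervalIntegral.integral_comp_mul_left (fun y : ℝ => (1 + y^2)⁻¹) (a := -π) (b := π) hs.ne'
  rw [this, integral_inv_one_add_sq, smul_eq_mul, Real.sqrt_div hx.le]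
  have h1 := Real.arctan_lt_pi_div_two (√(x/5) * π)
  have h2 := Real.neg_pi_div_two_lt_arctan (√(x/5) * (-π))
  have h3 := Real.pi_lt_four
  have h5 : √5 ≤ 5/2 := by rw [Real.sqrt_le_iff]; norm_num
  rw [Real.sqrt_div hx.le] at *
  have hsx : 0 < √x := Real.sqrt_pos.2 hx
  have h6 : 0 < √(5:ℝ) := by positivity
  rw [inv_div, div_mul_eq_mul_div]
  gcongr
  nlinarith

lemma AA_zero_bound {G : ℝ → ℝ} (h : PG G) :
    ∃ C, 0 ≤ C ∧ ∀ x : ℝ, 0 < x → ‖AA G 0 x‖ ≤ C / √x := by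
  set H : ℝ → ℝ := fun c => G c / (1 + c) with hH
  have hPH : PG H := h.div
  have hGc := h.1.continuous
  have hHc := hPH.1.continuous
  have hH'c := hPH.deriv.1.continuous
  obtain ⟨C1, hC10, hC1⟩ := exists_bound_Icc hGc
  obtain ⟨C2, hC20, hC2⟩ := exists_bound_Icc hHc
  obtain ⟨C3, hC30, hC3⟩ := exists_bound_Icc hH'c
  refine ⟨(3 * C1 + C2 + C3) * 2 * 10, by positivity, fun x hx => ?_⟩
  set D : ℝ → ℂ := fun θ => 1 + Complex.I * x * ((1 - Real.cos θ : ℝ) : ℂ) with hD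
  have hDre : ∀ θ, (D θ).re = 1 := by intro θ; simp [hD]
  have hDim : ∀ θ, (D θ).im = x * (1 - Real.cos θ) := by intro θ; simp [hD, -Complex.ofReal_cos, -Complex.ofReal_sub]
  have hD0 : ∀ θ, D θ ≠ 0 := fun θ h0 => by have := hDre θ; simp [h0] at this
  have hDc : Continuous D := by fun_prop
  set R : ℝ → ℂ := fun θ => 2 * G (Real.cos θ) / D θ - G (Real.cos θ) / D θ ^ 2
    - ((Real.cos θ * H (Real.cos θ) - (1 - Real.cos θ ^ 2) * deriv H (Real.cos θ) : ℝ) : ℂ) / D θ with hR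
  have hRc : Continuous R := by
    have : ∀ θ, D θ ^ 2 ≠ 0 := fun θ => pow_ne_zero _ (hD0 θ)
    fun_prop (disch := assumption)
  have hder : ∀ θ : ℝ, HasDerivAt (fun θ : ℝ =>
      ((Real.sin θ * H (Real.cos θ) : ℝ) : ℂ) / D θ * ee x θ)
      (((G (Real.cos θ) * (1 - Real.cos θ) ^ 0 : ℝ) : ℂ) * ee x θ - R θ * ee x θ) θ := by
    intro θ
    have hDd : HasDerivAt D (Complex.I * x * Real.sin θ) θ := by
      have := (((Real.hasDerivAt_cos θ).const_sub 1).ofReal_comp.const_mul (Complex.I * x)).const_add 1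
      refine this.congr_deriv ?_
      simp
    have h1 := ((Real.hasDerivAt_sin θ).mul (hasDerivAt_comp_cos hPH.1 θ)).ofReal_comp.div hDd (hD0 θ)
    have h2 := h1.mul (hasDerivAt_ee x θ)
    refine h2.congr_deriv ?_
    have hG : G (Real.cos θ) = (1 + Real.cos θ) * H (Real.cos θ) := h.eq_mul _
    have hsC : ((Real.sin θ : ℝ) : ℂ) ^ 2 = 1 - ((Real.cos θ : ℝ) : ℂ) ^ 2 := by
      rw [← Complex.ofReal_pow, Real.sin_sq θ]; push_cast; rfl
    have hDe : D θ = 1 + Complex.I * x * ((1 - Real.cos θ : ℝ) : ℂ) := rfl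
    simp only [hR, hG]
    simp only [Pi.mul_apply, Pi.div_apply]
    have hd := hD0 θ
    generalize D θ = d at *
    generalize deriv H (Real.cos θ) = H'
    generalize H (Real.cos θ) = H0
    clear h1 h2 hG hDd
    generalize ee x θ = E
    generalize Real.cos θ = c at *
    generalize Real.sin θ = s at *
    push_cast at hDe ⊢
    field_simp
    linear_combination E * ((-(H':ℂ) * d + Complex.I * x * H0 * d - Complex.I * x * H0)) * hsC
      - E * (((H0:ℂ) * (1 + c) * (d - 1))) * hDe
  have key := intervalIntegral.integral_eq_sub_of_hasDerivAt (a := -π) (b := π)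
    (fun θ _ => hder θ) (by apply Continuous.intervalIntegrable; fun_prop)
  rw [intervalIntegral.integral_sub (by apply Continuous.intervalIntegrable; fun_prop)
    (by apply Continuous.intervalIntegrable; fun_prop)] at key
  simp only [Real.sin_pi, Real.sin_neg, neg_zero, zero_mul, Complex.ofReal_zero, sub_zero, zero_div] at key
  have key2 : AA G 0 x = ∫ θ in (-π)..π, R θ * ee x θ := sub_eq_zero.1 key
  rw [key2]
  have hb : ∀ θ ∈ Set.Ioc (-π) π, ‖R θ * ee x θ‖ ≤
      (3 * C1 + C2 + C3) * 2 * (1 + (√(x/5) * θ)^2)⁻¹ := by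
    intro θ hθ
    rw [norm_mul, norm_ee, mul_one]
    have hn1 : 1 ≤ ‖D θ‖ := by
      have := Complex.abs_re_le_norm (D θ); rwa [hDre, abs_one] at this
    have hn2 : x * (1 - Real.cos θ) ≤ ‖D θ‖ := by
      have := Complex.abs_im_le_norm (D θ); rw [hDim] at this; exact (le_abs_self _).trans this
    have hcos := Real.cos_le_one_sub_mul_cos_sq (x := θ) (abs_le.2 ⟨hθ.1.le, hθ.2⟩)
    have hpi : 2 / π^2 ≥ 1/5 := by
      rw [ge_iff_le, div_le_div_iff₀ (by norm_num) (by positivity)]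
      nlinarith [Real.pi_lt_d2, Real.pi_pos]
    have hn3 : (1 + (√(x/5) * θ)^2) ≤ 2 * ‖D θ‖ := by
      rw [mul_pow, Real.sq_sqrt (by positivity)]
      have : 1/5 * θ^2 ≤ 1 - Real.cos θ := by nlinarith [sq_nonneg θ]
      nlinarith
    have hinv : ‖D θ‖⁻¹ ≤ 2 * (1 + (√(x/5) * θ)^2)⁻¹ := by
      rw [← div_eq_mul_inv, inv_eq_one_div, div_le_div_iff₀ (by positivity) (by positivity)]
      linarith
    have hR1 : ‖R θ‖ ≤ (3 * C1 + C2 + C3) * ‖D θ‖⁻¹ := by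
      simp only [hR]
      have a1 : ‖(2 * G (Real.cos θ) / D θ : ℂ)‖ ≤ 2 * C1 * ‖D θ‖⁻¹ := by
        rw [norm_div, norm_mul, Complex.norm_real, div_eq_mul_inv]
        have := hC1 θ
        gcongr
        · simp
        · exact this
      have a2 : ‖(G (Real.cos θ) / D θ ^ 2 : ℂ)‖ ≤ C1 * ‖D θ‖⁻¹ := by
        rw [norm_div, Complex.norm_real, div_eq_mul_inv, norm_pow]
        have := hC1 θ
        gcongr
        · exact this
        · nlinarith
      have a3 : ‖(((Real.cos θ * H (Real.cos θ) - (1 - Real.cos θ ^ 2) * deriv H (Real.cos θ) : ℝ) : ℂ) / D θ : ℂ)‖ ≤ (C2 + C3) * ‖D θ‖⁻¹ := by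
        rw [norm_div, Complex.norm_real, div_eq_mul_inv]
        gcongr
        refine (norm_sub_le _ _).trans ?_
        rw [norm_mul, norm_mul]
        have b1 : ‖Real.cos θ‖ ≤ 1 := Real.abs_cos_le_one θ
        have b2 : ‖1 - Real.cos θ ^ 2‖ ≤ 1 := by
          rw [Real.norm_eq_abs, abs_le]; constructor <;> nlinarith [Real.cos_sq_le_one θ, sq_nonneg (Real.cos θ)]
        have := mul_le_mul b1 (hC2 θ) (abs_nonneg _) zero_le_one
        have := mul_le_mul b2 (hC3 θ) (abs_nonneg _) zero_le_one
        simp only [Real.norm_eq_abs] at *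
        linarith
      refine (norm_sub_le _ _).trans ?_
      have := norm_sub_le (2 * G (Real.cos θ) / D θ : ℂ) (G (Real.cos θ) / D θ ^ 2 : ℂ)
      linarith
    calc ‖R θ‖ ≤ _ := hR1
      _ ≤ (3 * C1 + C2 + C3) * (2 * (1 + (√(x/5) * θ)^2)⁻¹) := by gcongr
      _ = _ := by ring
  have hpos : ∀ θ : ℝ, (1 + (√(x/5) * θ)^2) ≠ 0 := fun θ => by positivity
  refine (intervalIntegral.norm_integral_le_of_norm_le (by linarith [Real.pi_pos])
    (Filter.Eventually.of_forall hb) ?_).trans ?_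
  · apply Continuous.intervalIntegrable
    fun_prop (disch := assumption)
  · rw [intervalIntegral.integral_const_mul]
    calc _ ≤ (3 * C1 + C2 + C3) * 2 * (10 / √x) := by gcongr; exact integral_lorentz hx
      _ = _ := by ring

lemma AA_bound (j : ℕ) : ∀ {G : ℝ → ℝ}, PG G →
    ∃ C, 0 ≤ C ∧ ∀ x : ℝ, 0 < x → ‖AA G j x‖ ≤ C / (√x * x ^ j) := by
  induction j with
  | zero => intro G h; simpa using AA_zero_bound h
  | succ j ih =>
    intro G h
    have h2 : PG (fun c => (c * (G c / (1 + c)) + (-(1 - c^2)) * deriv (fun c => G c / (1 + c)) c)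
        + (j : ℝ) * G c) :=
      ((h.div.smul_fun (a := fun c => c) (by fun_prop)).add
        (h.div.deriv.smul_fun (a := fun c => -(1-c^2)) (by fun_prop))).add
        (h.smul_fun (a := fun _ => (j:ℝ)) (by fun_prop))
    obtain ⟨C, hC, hb⟩ := ih h2
    refine ⟨C, hC, fun x hx => ?_⟩
    rw [AA_step h j hx, norm_mul]
    have : ‖(Complex.I / x : ℂ)‖ = 1 / x := by
      rw [norm_div, Complex.norm_I, Complex.norm_real, Real.norm_of_nonneg hx.le]
    rw [this]
    calc _ ≤ 1 / x * (C / (√x * x ^ j)) := by gcongr; exact hb x hx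
      _ = _ := by
        have : 0 < √x := Real.sqrt_pos.2 hx
        rw [pow_succ]
        field_simp

/-- Smooth radial profiles supported in `[1,2]`. -/
def PS (ψ : ℝ → ℝ) : Prop := ContDiff ℝ ∞ ψ ∧ Function.support ψ ⊆ Set.Icc 1 2

lemma PS.deriv {ψ : ℝ → ℝ} (h : PS ψ) : PS (deriv ψ) := by
  refine ⟨((contDiff_infty_iff_deriv).1 h.1).2, ?_⟩
  exact support_deriv_subset.trans (closure_minimal h.2 isClosed_Icc)

lemma PS.mul {ψ a : ℝ → ℝ} (h : PS ψ) (ha : ContDiff ℝ ∞ a) : PS (fun r => ψ r * a r) := by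
  refine ⟨h.1.mul ha, fun r hr => h.2 ?_⟩
  simp only [Function.mem_support] at *
  exact left_ne_zero_of_mul hr

lemma PS.one {ψ : ℝ → ℝ} (h : PS ψ) : ψ 1 = 0 := by
  have h1 : Filter.Tendsto ψ (nhdsWithin 1 (Set.Iio 1)) (nhds (ψ 1)) :=
    h.1.continuous.continuousAt.tendsto.mono_left nhdsWithin_le_nhds
  refine tendsto_nhds_unique (h1.congr' (f₂ := fun _ => (0:ℝ)) ?_) tendsto_const_nhds
  filter_upwards [self_mem_nhdsWithin] with r hr
  by_contra h0
  exact absurd (h.2 h0).1 (not_le.2 hr)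

lemma PS.two {ψ : ℝ → ℝ} (h : PS ψ) : ψ 2 = 0 := by
  have h1 : Filter.Tendsto ψ (nhdsWithin 2 (Set.Ioi 2)) (nhds (ψ 2)) :=
    h.1.continuous.continuousAt.tendsto.mono_left nhdsWithin_le_nhds
  refine tendsto_nhds_unique (h1.congr' (f₂ := fun _ => (0:ℝ)) ?_) tendsto_const_nhds
  filter_upwards [self_mem_nhdsWithin] with r hr
  by_contra h0
  exact absurd (h.2 h0).2 (not_le.2 hr)

lemma PS.bound {ψ : ℝ → ℝ} (h : PS ψ) : ∃ C, 0 ≤ C ∧ ∀ r ∈ Set.Icc (1:ℝ) 2, |ψ r| ≤ C := by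
  obtain ⟨C, hC⟩ := (isCompact_Icc (a := (1:ℝ)) (b := 2)).exists_bound_of_continuousOn
    h.1.continuous.continuousOn
  exact ⟨C, (norm_nonneg _).trans (hC 1 (by norm_num)), hC⟩

/-- the radial Fourier integral -/
noncomputable def KK (ψ : ℝ → ℝ) (l : ℝ) : ℂ :=
  ∫ r in (1:ℝ)..2, (ψ r : ℂ) * Complex.exp (Complex.I * ((r * l : ℝ) : ℂ))

lemma norm_exp_I (y : ℝ) : ‖Complex.exp (Complex.I * (y : ℂ))‖ = 1 := by
  rw [mul_comm]; exact Complex.norm_exp_ofReal_mul_I _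

lemma continuous_KK {ψ : ℝ → ℝ} (h : Continuous ψ) : Continuous (KK ψ) := by
  unfold KK
  apply intervalIntegral.continuous_parametric_intervalIntegral_of_continuous'
  unfold Function.uncurry
  fun_prop

lemma KK_bound {ψ : ℝ → ℝ} (h : PS ψ) : ∃ C, 0 ≤ C ∧ ∀ l, ‖KK ψ l‖ ≤ C := by
  obtain ⟨C, hC, hb⟩ := h.bound
  refine ⟨C, hC, fun l => ?_⟩
  have := intervalIntegral.norm_integral_le_of_norm_le_const (a := 1) (b := 2) (C := C)
    (f := fun r : ℝ => (ψ r : ℂ) * Complex.exp (Complex.I * ((r * l : ℝ) : ℂ))) (fun r hr => by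
      rw [Set.uIoc_of_le (by norm_num)] at hr
      rw [norm_mul, norm_exp_I, mul_one, Complex.norm_real]
      exact hb r ⟨hr.1.le, hr.2⟩)
  norm_num at this
  simpa [KK] using this

lemma KK_deriv {ψ : ℝ → ℝ} (h : PS ψ) (l : ℝ) : (l : ℂ) * KK ψ l = Complex.I * KK (deriv ψ) l := by
  have hder : ∀ r : ℝ, HasDerivAt (fun r : ℝ => (ψ r : ℂ) * Complex.exp (Complex.I * ((r * l : ℝ) : ℂ)))
      (((deriv ψ r : ℝ) : ℂ) * Complex.exp (Complex.I * ((r * l : ℝ) : ℂ)) +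
       Complex.I * l * ((ψ r : ℂ) * Complex.exp (Complex.I * ((r * l : ℝ) : ℂ)))) r := by
    intro r
    have h1 := ((h.1.differentiable (by simp)) r).hasDerivAt.ofReal_comp
    have h2 := ((((hasDerivAt_id r).mul_const l).ofReal_comp).const_mul Complex.I).cexp
    refine (h1.mul h2).congr_deriv ?_
    simp only [id]
    push_cast; ring
  have hc := h.1.continuous
  have hc' := h.deriv.1.continuous
  have key := intervalIntegral.integral_eq_sub_of_hasDerivAt (a := 1) (b := 2)
    (fun θ _ => hder θ) (by apply Continuous.intervalIntegrable; fun_prop)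
  rw [intervalIntegral.integral_add (by apply Continuous.intervalIntegrable; fun_prop)
    (by apply Continuous.intervalIntegrable; fun_prop), intervalIntegral.integral_const_mul] at key
  simp only [h.one, h.two, Complex.ofReal_zero, zero_mul, sub_zero] at key
  change KK (deriv ψ) l + Complex.I * l * KK ψ l = 0 at key
  linear_combination (-Complex.I) * key + l * KK ψ l * Complex.I_sq

lemma hasDerivAt_KK {ψ : ℝ → ℝ} (h : PS ψ) (l : ℝ) :
    HasDerivAt (KK ψ) (Complex.I * KK (fun r => ψ r * r) l) l := by
  have hc := h.1.continuous
  obtain ⟨C, hC, hb⟩ := (h.mul (a := fun r => r) (by fun_prop)).bound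
  have := (intervalIntegral.hasDerivAt_integral_of_dominated_loc_of_deriv_le (𝕜 := ℝ) (μ := volume)
    (F := fun l r => (ψ r : ℂ) * Complex.exp (Complex.I * ((r * l : ℝ) : ℂ)))
    (F' := fun l r => Complex.I * (((ψ r * r : ℝ) : ℂ) * Complex.exp (Complex.I * ((r * l : ℝ) : ℂ))))
    (x₀ := l) (s := Set.univ) (a := 1) (b := 2) (bound := fun _ => C) Filter.univ_mem
    (Filter.Eventually.of_forall fun l => by
      apply Continuous.aestronglyMeasurable; fun_prop)
    (by apply Continuous.intervalIntegrable; fun_prop)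
    (by apply Continuous.aestronglyMeasurable; fun_prop)
    (Filter.Eventually.of_forall fun r hr l _ => by
      rw [Set.uIoc_of_le (by norm_num)] at hr
      rw [norm_mul, norm_mul, norm_exp_I, mul_one, Complex.norm_real, Complex.norm_I, one_mul]
      exact hb r ⟨hr.1.le, hr.2⟩)
    (by simp)
    (Filter.Eventually.of_forall fun r hr l _ => by
      have h2 := (((((hasDerivAt_id l).const_mul r).ofReal_comp).const_mul Complex.I).cexp).const_mul (ψ r : ℂ)
      refine h2.congr_deriv ?_
      simp only [id]
      push_cast; ring)).2
  rw [intervalIntegral.integral_const_mul] at this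
  exact this

lemma KK_conj (ψ : ℝ → ℝ) (l : ℝ) : KK ψ (-l) = (starRingEnd ℂ) (KK ψ l) := by
  unfold KK
  rw [← intervalIntegral.intervalIntegral_conj]
  congr 1
  ext r
  rw [map_mul, Complex.conj_ofReal, ← Complex.exp_conj, map_mul, Complex.conj_ofReal, Complex.conj_I]
  push_cast; ring_nf

noncomputable def VV (G : ℝ → ℝ) (j : ℕ) (ψ : ℝ → ℝ) (t ρ : ℝ) : ℂ :=
  ∫ θ in (-π)..π, ((G (Real.cos θ) * (ρ * (1 - Real.cos θ)) ^ j : ℝ) : ℂ) * KK ψ (t - ρ * Real.cos θ)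

lemma VV_step {G : ℝ → ℝ} (hG : PG G) (j : ℕ) {ψ : ℝ → ℝ} (h : PS ψ) (t ρ : ℝ) :
    ((t - ρ : ℝ) : ℂ) * VV G j ψ t ρ = Complex.I * VV G j (deriv ψ) t ρ - VV G (j+1) ψ t ρ := by
  unfold VV
  have hc1 := continuous_KK h.1.continuous
  have hc2 := continuous_KK h.deriv.1.continuous
  have hG := hG.1.continuous
  rw [← intervalIntegral.integral_const_mul, ← intervalIntegral.integral_const_mul,
    ← intervalIntegral.integral_sub (by apply Continuous.intervalIntegrable; fun_prop)
      (by apply Continuous.intervalIntegrable; fun_prop)]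
  congr 1
  ext θ
  have := KK_deriv h (t - ρ * Real.cos θ)
  generalize Real.cos θ = c at *
  push_cast at this ⊢
  linear_combination (G c * (ρ * (1 - c))^j) * this

lemma VV_swap {G : ℝ → ℝ} (hG : PG G) (j : ℕ) {ψ : ℝ → ℝ} (h : PS ψ) (t ρ : ℝ) :
    VV G j ψ t ρ = ∫ r in (1:ℝ)..2, (ψ r : ℂ) * Complex.exp (Complex.I * ((r * (t - ρ) : ℝ) : ℂ)) *
      (ρ : ℂ)^j * AA G j (ρ * r) := by
  have hG := hG.1.continuous
  have hψ := h.1.continuous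
  unfold VV KK AA
  simp_rw [← intervalIntegral.integral_const_mul]
  rw [intervalIntegral_intervalIntegral_swap]
  · congr 1
    ext r
    congr 1
    ext θ
    have : Complex.exp (Complex.I * ((r * (t - ρ * Real.cos θ) : ℝ) : ℂ)) =
      Complex.exp (Complex.I * ((r * (t - ρ) : ℝ) : ℂ)) * ee (ρ * r) θ := by
      unfold ee
      rw [← Complex.exp_add]; congr 1; push_cast; ring
    rw [this, mul_pow]; push_cast; ring
  · refine IntegrableOn.mono_set (t := Set.Icc (-π) π ×ˢ Set.Icc 1 2) ?_ ?_
    · apply ContinuousOn.integrableOn_compact (isCompact_Icc.prod isCompact_Icc)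
      apply Continuous.continuousOn
      unfold Function.uncurry
      fun_prop
    · rw [Set.uIoc_of_le (by linarith [Real.pi_pos]), Set.uIoc_of_le (by norm_num)]
      exact Set.prod_mono Set.Ioc_subset_Icc_self Set.Ioc_subset_Icc_self

lemma VV_base {G : ℝ → ℝ} (hG : PG G) (j : ℕ) {ψ : ℝ → ℝ} (h : PS ψ) :
    ∃ C, 0 ≤ C ∧ ∀ t ρ : ℝ, 0 < ρ → ‖VV G j ψ t ρ‖ ≤ C / √ρ := by
  obtain ⟨C, hC, hb⟩ := AA_bound j hG
  obtain ⟨C', hC', hb'⟩ := h.bound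
  refine ⟨C' * C, by positivity, fun t ρ hρ => ?_⟩
  rw [VV_swap hG j h]
  refine (intervalIntegral.norm_integral_le_of_norm_le_const (C := C' * C / √ρ) fun r hr => ?_).trans ?_
  · rw [Set.uIoc_of_le (by norm_num)] at hr
    rw [norm_mul, norm_mul, norm_mul, norm_exp_I, mul_one, Complex.norm_real, norm_pow, Complex.norm_real,
      Real.norm_of_nonneg hρ.le]
    have hr0 : 1 < r := hr.1
    have h1 := hb' r ⟨hr.1.le, hr.2⟩
    have h2 := hb (ρ * r) (by positivity)
    have h3 : ρ^j * ‖AA G j (ρ * r)‖ ≤ C / √ρ := by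
      refine (mul_le_mul_of_nonneg_left h2 (by positivity)).trans ?_
      have e1 : √ρ ≤ √(ρ * r) := Real.sqrt_le_sqrt (by nlinarith)
      have e2 : 1 ≤ r^j := one_le_pow₀ hr0.le
      have e0 : 0 < √ρ := Real.sqrt_pos.2 hρ
      have e3 : C / (√(ρ * r) * (ρ * r)^j) ≤ C / (√ρ * ρ ^ j) := by
        gcongr
        nlinarith
      calc _ ≤ ρ^j * (C / (√ρ * ρ ^ j)) := by gcongr
        _ = _ := by field_simp
    rw [mul_assoc]
    calc _ ≤ C' * (C / √ρ) := by gcongr; exact h1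
      _ = _ := by ring
  · norm_num

lemma VV_decay {G : ℝ → ℝ} (hG : PG G) (N : ℕ) : ∀ (j : ℕ) {ψ : ℝ → ℝ}, PS ψ →
    ∃ C, 0 ≤ C ∧ ∀ t ρ : ℝ, 0 < ρ → |t - ρ|^N * ‖VV G j ψ t ρ‖ ≤ C / √ρ := by
  induction N with
  | zero => intro j ψ h; simpa using VV_base hG j h
  | succ N ih =>
    intro j ψ h
    obtain ⟨C1, h1, hb1⟩ := ih j h.deriv
    obtain ⟨C2, h2, hb2⟩ := ih (j+1) h
    refine ⟨C1 + C2, by positivity, fun t ρ hρ => ?_⟩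
    have e : |t - ρ| * ‖VV G j ψ t ρ‖ ≤ ‖VV G j (deriv ψ) t ρ‖ + ‖VV G (j+1) ψ t ρ‖ := by
      have := congrArg norm (VV_step hG j h t ρ)
      rw [norm_mul, Complex.norm_real, Real.norm_eq_abs] at this
      rw [this]
      refine (norm_sub_le _ _).trans ?_
      rw [norm_mul, Complex.norm_I, one_mul]
    calc _ = |t - ρ|^N * (|t - ρ| * ‖VV G j ψ t ρ‖) := by ring
      _ ≤ |t - ρ|^N * (‖VV G j (deriv ψ) t ρ‖ + ‖VV G (j+1) ψ t ρ‖) := by gcongr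
      _ ≤ C1 / √ρ + C2 / √ρ := by rw [mul_add]; exact add_le_add (hb1 t ρ hρ) (hb2 t ρ hρ)
      _ = _ := by ring

lemma VV_decay' {G : ℝ → ℝ} (hG : PG G) (N : ℕ) {ψ : ℝ → ℝ} (h : PS ψ) :
    ∃ C, 0 ≤ C ∧ ∀ t ρ : ℝ, 0 < ρ → ‖VV G 0 ψ t ρ‖ ≤ C / √ρ * ((1 + |t - ρ|)^N)⁻¹ := by
  obtain ⟨C0, h0, hb0⟩ := VV_decay hG 0 0 h
  obtain ⟨C1, h1, hb1⟩ := VV_decay hG N 0 h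
  refine ⟨2^N * (C0 + C1), by positivity, fun t ρ hρ => ?_⟩
  rw [← div_eq_mul_inv, le_div_iff₀ (by positivity)]
  have a0 := hb0 t ρ hρ
  have a1 := hb1 t ρ hρ
  have key : (1 + |t - ρ|)^N ≤ 2^N * (1 + |t - ρ|^N) := by
    rcases le_total |t - ρ| 1 with hl | hl
    · calc _ ≤ (2:ℝ)^N := by gcongr; linarith
        _ ≤ _ := by
          have : 0 ≤ |t - ρ|^N := by positivity
          have : (0:ℝ) < 2^N := by positivity
          nlinarith
    · calc _ ≤ (2 * |t - ρ|)^N := by gcongr; linarith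
        _ = 2^N * |t - ρ|^N := by ring
        _ ≤ _ := by gcongr; linarith
  calc _ ≤ ‖VV G 0 ψ t ρ‖ * (2^N * (1 + |t - ρ|^N)) := by gcongr
    _ = 2^N * (|t - ρ|^0 * ‖VV G 0 ψ t ρ‖ + |t - ρ|^N * ‖VV G 0 ψ t ρ‖) := by ring
    _ ≤ 2^N * (C0 / √ρ + C1 / √ρ) := by gcongr
    _ = _ := by ring

noncomputable def psi (φ : ℝ → ℝ) (k : ℕ) : ℝ → ℝ := fun r => φ r * r ^ (k+1)

lemma PS_psi {φ : ℝ → ℝ} (h : PS φ) (k : ℕ) : PS (psi φ k) := h.mul (by fun_prop)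

noncomputable def ww (φ : ℝ → ℝ) (k : ℕ) (t ρ : ℝ) : ℂ :=
  (-Complex.I)^k * ∫ θ in (-π)..π, ((Real.cos θ ^ k : ℝ) : ℂ) * KK (psi φ k) (t - ρ * Real.cos θ)

noncomputable def chi (c : ℝ) : ℝ := Real.smoothTransition (c + 1/2)

lemma chi_add (c : ℝ) : chi c + chi (-c) = 1 := by
  unfold chi Real.smoothTransition
  have h1 := Real.smoothTransition.pos_denom (c + 1/2)
  have e1 : 1 - (c + 1/2) = -c + 1/2 := by ring
  have e2 : 1 - (-c + 1/2) = c + 1/2 := by ring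
  rw [e1] at h1
  rw [e1, e2, add_comm (expNegInvGlue (-c + 1/2)), ← add_div, div_self h1.ne']

lemma PG_chi (k : ℕ) : PG (fun c => c^k * chi c) := by
  refine PG.smul_fun (G := chi) ⟨?_, fun c hc => ?_⟩ (by fun_prop)
  · exact (Real.smoothTransition.contDiff (n := ⊤)).comp (g := Real.smoothTransition) (f := fun c : ℝ => c + 1/2) (by fun_prop)
  · exact Real.smoothTransition.zero_of_nonpos (by linarith)

lemma ww_decomp {φ : ℝ → ℝ} (h : PS φ) (k : ℕ) (t ρ : ℝ) :
    ww φ k t ρ = (-Complex.I)^k * (VV (fun c => c^k * chi c) 0 (psi φ k) t ρ +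
      (-1)^k * (starRingEnd ℂ) (VV (fun c => c^k * chi c) 0 (psi φ k) (-t) ρ)) := by
  have hc := continuous_KK (PS_psi h k).1.continuous
  have hchi : Continuous chi := by
    unfold chi; exact Real.smoothTransition.continuous.comp (by fun_prop)
  unfold ww
  congr 1
  set F : ℝ → ℂ := fun θ => ((Real.cos θ ^ k * chi (-Real.cos θ) : ℝ) : ℂ) * KK (psi φ k) (t - ρ * Real.cos θ) with hF
  have hper : Function.Periodic F (2 * π) := by intro θ; simp only [hF, Real.cos_add_two_pi]
  have hconj : (-1)^k * (starRingEnd ℂ) (VV (fun c => c^k * chi c) 0 (psi φ k) (-t) ρ)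
      = ∫ θ in (-π)..π, F θ := by
    have h1 := hper.intervalIntegral_add_eq (-π) 0
    have h2 : ∫ θ in (-π)..π, F (θ + π) = ∫ θ in (-π + π)..(π + π), F θ :=
      intervalIntegral.integral_comp_add_right F π
    rw [show -π + 2 * π = π by ring] at h1
    rw [h1, show (0:ℝ) = -π + π by ring, show -π + π + 2 * π = π + π by ring, ← h2]
    unfold VV
    rw [← intervalIntegral.intervalIntegral_conj, ← intervalIntegral.integral_const_mul]
    congr 1
    ext θ
    simp only [hF, Real.cos_add_pi, pow_zero, mul_one, neg_neg]
    rw [map_mul, Complex.conj_ofReal, ← KK_conj, neg_pow (Real.cos θ)]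
    rw [show -(-t - ρ * Real.cos θ) = t - ρ * -Real.cos θ by ring]
    push_cast; ring
  rw [hconj]
  unfold VV
  rw [← intervalIntegral.integral_add (by apply Continuous.intervalIntegrable; fun_prop)
    (by apply Continuous.intervalIntegrable; fun_prop)]
  congr 1
  ext θ
  have := chi_add (Real.cos θ)
  have : (chi (Real.cos θ) : ℂ) + chi (-Real.cos θ) = 1 := by exact_mod_cast this
  simp only [hF, pow_zero, mul_one]
  generalize Real.cos θ = c at *
  push_cast
  linear_combination (-((c:ℂ)^k * KK (psi φ k) (t - ρ * c))) * this

lemma ww_bound {φ : ℝ → ℝ} (h : PS φ) (k N : ℕ) : ∃ C, 0 ≤ C ∧ ∀ t ρ : ℝ, 1 ≤ ρ →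
    ‖ww φ k t ρ‖ ≤ C * (((1 + |t - ρ|) ^ (-(N : ℝ)) + (1 + |t + ρ|) ^ (-(N : ℝ))) *
      (1 + ρ) ^ (-(1 : ℝ) / 2)) := by
  obtain ⟨C, hC, hb⟩ := VV_decay' (PG_chi k) N (PS_psi h k)
  refine ⟨2 * C, by positivity, fun t ρ hρ => ?_⟩
  have hρ0 : 0 < ρ := by linarith
  have h1 := hb t ρ hρ0
  have h2 := hb (-t) ρ hρ0
  rw [show |-t - ρ| = |t + ρ| by rw [← abs_neg]; congr 1; ring] at h2
  rw [ww_decomp h, norm_mul, norm_pow, norm_neg, Complex.norm_I, one_pow, one_mul]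
  have h3 : 1 / √ρ ≤ 2 * (1 + ρ) ^ (-(1 : ℝ) / 2) := by
    rw [neg_div, Real.rpow_neg (by positivity), ← Real.sqrt_eq_rpow, ← div_eq_mul_inv,
      div_le_div_iff₀ (by positivity) (by positivity)]
    have : √(1 + ρ) ≤ √(2^2 * ρ) := Real.sqrt_le_sqrt (by linarith)
    rw [Real.sqrt_mul (by positivity), Real.sqrt_sq (by norm_num)] at this
    linarith
  rw [Real.rpow_neg (by positivity), Real.rpow_neg (by positivity), Real.rpow_natCast, Real.rpow_natCast]
  refine (norm_add_le _ _).trans ?_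
  rw [norm_mul, norm_pow, norm_neg, norm_one, one_pow, one_mul, RCLike.norm_conj]
  calc _ ≤ C / √ρ * ((1 + |t - ρ|)^N)⁻¹ + C / √ρ * ((1 + |t + ρ|)^N)⁻¹ := add_le_add h1 h2
    _ = C * (((1 + |t - ρ|)^N)⁻¹ + ((1 + |t + ρ|)^N)⁻¹) * (1 / √ρ) := by ring
    _ ≤ C * (((1 + |t - ρ|)^N)⁻¹ + ((1 + |t + ρ|)^N)⁻¹) * (2 * (1 + ρ) ^ (-(1 : ℝ) / 2)) := by gcongr
    _ = _ := by ring

lemma hasDerivAt_ww {φ : ℝ → ℝ} (h : PS φ) (k : ℕ) (t ρ : ℝ) :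
    HasDerivAt (ww φ k t) (ww φ (k+1) t ρ) ρ := by
  have hc := continuous_KK (PS_psi h k).1.continuous
  have hc' := continuous_KK (PS_psi h (k+1)).1.continuous
  obtain ⟨C, hC, hb⟩ := KK_bound (PS_psi h (k+1))
  have hpsi : (fun r => psi φ k r * r) = psi φ (k+1) := by ext r; simp only [psi]; ring
  have := (intervalIntegral.hasDerivAt_integral_of_dominated_loc_of_deriv_le (𝕜 := ℝ) (μ := volume)
    (F := fun ρ θ => ((Real.cos θ ^ k : ℝ) : ℂ) * KK (psi φ k) (t - ρ * Real.cos θ))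
    (F' := fun ρ θ => (-Complex.I) * (((Real.cos θ ^ (k+1) : ℝ) : ℂ) * KK (psi φ (k+1)) (t - ρ * Real.cos θ)))
    (x₀ := ρ) (s := Set.univ) (a := -π) (b := π) (bound := fun _ => C) Filter.univ_mem
    (Filter.Eventually.of_forall fun l => by
      apply Continuous.aestronglyMeasurable; fun_prop)
    (by apply Continuous.intervalIntegrable; fun_prop)
    (by apply Continuous.aestronglyMeasurable; fun_prop)
    (Filter.Eventually.of_forall fun θ _ ρ _ => by
      rw [norm_mul, norm_mul, norm_neg, Complex.norm_real, Complex.norm_I, one_mul, norm_pow]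
      have e1 : ‖Real.cos θ‖^(k+1) ≤ 1 := pow_le_one₀ (norm_nonneg _) (Real.abs_cos_le_one θ)
      have e2 := hb (t - ρ * Real.cos θ)
      have e3 := mul_le_mul e1 e2 (norm_nonneg _) zero_le_one
      linarith)
    (by simp)
    (Filter.Eventually.of_forall fun θ _ ρ _ => by
      have h1 : HasDerivAt (fun ρ : ℝ => t - ρ * Real.cos θ) (-(Real.cos θ)) ρ := by
        simpa using ((hasDerivAt_id ρ).mul_const (Real.cos θ)).const_sub t
      have h2 := ((hasDerivAt_KK (PS_psi h k) (t - ρ * Real.cos θ)).scomp ρ h1).const_mul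
        ((Real.cos θ ^ k : ℝ) : ℂ)
      refine h2.congr_deriv ?_
      rw [hpsi, Complex.real_smul]
      generalize Real.cos θ = c
      push_cast; ring)).2
  rw [intervalIntegral.integral_const_mul] at this
  refine (this.const_mul ((-Complex.I)^k)).congr_deriv ?_
  unfold ww
  ring

lemma contDiff_ww {φ : ℝ → ℝ} (h : PS φ) (t : ℝ) (n : ℕ) : ∀ k, ContDiff ℝ n (ww φ k t) := by
  have hd : ∀ k, deriv (ww φ k t) = ww φ (k+1) t := fun k => funext fun ρ => (hasDerivAt_ww h k t ρ).deriv
  have hdiff : ∀ k, Differentiable ℝ (ww φ k t) := fun k ρ => (hasDerivAt_ww h k t ρ).differentiableAt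
  induction n with
  | zero => intro k; exact contDiff_zero.2 (hdiff k).continuous
  | succ n ih =>
    intro k
    push_cast
    rw [contDiff_succ_iff_deriv]
    refine ⟨hdiff k, by simp, ?_⟩
    rw [hd]; exact ih (k+1)

lemma exists_isometry (v : EuclideanSpace ℝ (Fin 2)) :
    ∃ L : ℂ ≃ₗᵢ[ℝ] EuclideanSpace ℝ (Fin 2), L (‖v‖ : ℂ) = v := by
  let e := Complex.orthonormalBasisOneI.repr
  have he : ‖e.symm v‖ = ‖v‖ := e.symm.norm_map v
  obtain ⟨a, ha⟩ : ∃ a : Circle, (a : ℂ) * (‖v‖ : ℂ) = e.symm v := by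
    refine ⟨Circle.exp (Complex.arg (e.symm v)), ?_⟩
    rw [Circle.coe_exp, ← he, mul_comm]
    exact Complex.norm_mul_exp_arg_mul_I _
  refine ⟨(rotation a).trans e, ?_⟩
  rw [LinearIsometryEquiv.trans_apply, rotation_apply, ha, e.apply_symm_apply]

lemma Wfun_eq {φ : ℝ → ℝ} (h : PS φ) (t : ℝ) (v : EuclideanSpace ℝ (Fin 2)) :
    Wfun φ t v = ww φ 0 t ‖v‖ := by
  obtain ⟨L, hL⟩ := exists_isometry v
  have hφ := h.1.continuous
  unfold Wfun
  rw [← L.measurePreserving.integral_comp L.toHomeomorph.measurableEmbedding]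
  have hin : ∀ ζ : ℂ, @inner ℝ _ _ v (L ζ) = ‖v‖ * ζ.re := by
    intro ζ
    conv_lhs => rw [← hL]
    rw [L.inner_map_map, Complex.inner]
    simp [mul_comm]
  simp_rw [hin, L.norm_map]
  rw [← Complex.integral_comp_polarCoord_symm]
  rw [polarCoord_target]
  rw [setIntegral_eq_of_subset_of_forall_sdiff_eq_zero (s := Set.Ioc 1 2 ×ˢ Set.Ioo (-π) π)
    (measurableSet_Ioi.prod measurableSet_Ioo)]
  rotate_left
  · exact Set.prod_mono (fun r hr => lt_trans one_pos hr.1) le_rfl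
  · rintro ⟨r, θ⟩ ⟨h1, h2⟩
    have hr : r ∉ Set.Ioc 1 2 := fun hr => h2 ⟨hr, h1.2⟩
    have : φ r = 0 := by
      by_contra h0
      have h3 := h.2 h0
      rcases h3.1.eq_or_lt with h4 | h4
      · exact h0 (h4 ▸ h.one)
      · exact hr ⟨h4, h3.2⟩
    have hr0 : 0 < r := h1.1
    rw [Complex.norm_polarCoord_symm]
    simp [abs_of_pos hr0, this]
  · have hpolar_eq : ∫ p in Set.Ioc (1:ℝ) 2 ×ˢ Set.Ioo (-π) π, p.1 • ((φ ‖Complex.polarCoord.symm p‖ : ℂ) *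
        Complex.exp (Complex.I * ((t * ‖Complex.polarCoord.symm p‖ - ‖v‖ * (Complex.polarCoord.symm p).re : ℝ) : ℂ)))
      = ∫ p in Set.Ioc (1:ℝ) 2 ×ˢ Set.Ioo (-π) π, ((psi φ 0 p.1 : ℂ) *
        Complex.exp (Complex.I * ((p.1 * (t - ‖v‖ * Real.cos p.2) : ℝ) : ℂ))) := by
      refine setIntegral_congr_fun (measurableSet_Ioc.prod measurableSet_Ioo) ?_
      rintro ⟨r, θ⟩ hp
      have hr0 : 0 < r := lt_trans one_pos hp.1.1
      have hre : (Complex.polarCoord.symm (r, θ)).re = r * Real.cos θ := by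
        rw [Complex.polarCoord_symm_apply]; simp [-Complex.ofReal_cos, -Complex.ofReal_sin]
      simp only [hre, Complex.norm_polarCoord_symm, abs_of_pos hr0, psi, Complex.real_smul]
      rw [show t * r - ‖v‖ * (r * Real.cos θ) = r * (t - ‖v‖ * Real.cos θ) by ring]
      push_cast; ring
    rw [hpolar_eq]
    have hcont : Continuous (fun p : ℝ × ℝ => ((psi φ 0 p.1 : ℂ) *
        Complex.exp (Complex.I * ((p.1 * (t - ‖v‖ * Real.cos p.2) : ℝ) : ℂ)))) := by
      have := (PS_psi h 0).1.continuous
      fun_prop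
    rw [Measure.volume_eq_prod, setIntegral_prod]
    · unfold ww KK
      simp only [pow_zero, one_mul, Complex.ofReal_one]
      rw [intervalIntegral_intervalIntegral_swap]
      · rw [intervalIntegral.integral_of_le (by norm_num)]
        congr 1
        ext r
        rw [intervalIntegral.integral_of_le (by linarith [Real.pi_pos]), integral_Ioc_eq_integral_Ioo]
      · refine IntegrableOn.mono_set (t := Set.Icc (-π) π ×ˢ Set.Icc 1 2) ?_ ?_
        · apply ContinuousOn.integrableOn_compact (isCompact_Icc.prod isCompact_Icc)
          exact (hcont.comp continuous_swap).continuousOn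
        · rw [Set.uIoc_of_le (by linarith [Real.pi_pos]), Set.uIoc_of_le (by norm_num)]
          exact Set.prod_mono Set.Ioc_subset_Icc_self Set.Ioc_subset_Icc_self
    · rw [← Measure.volume_eq_prod]
      refine IntegrableOn.mono_set (t := Set.Icc 1 2 ×ˢ Set.Icc (-π) π) ?_ ?_
      · exact hcont.continuousOn.integrableOn_compact (isCompact_Icc.prod isCompact_Icc)
      · exact Set.prod_mono Set.Ioc_subset_Icc_self Set.Ioo_subset_Icc_self

noncomputable def rr (r₁ r₂ s : ℝ) : ℝ := √(r₁^2 + r₂^2 + 2 * r₁ * r₂ * Real.cosh s)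
noncomputable def sS (r₁ r₂ s : ℝ) : ℝ := r₁ * r₂ * Real.sinh s / rr r₁ r₂ s
noncomputable def cC (r₁ r₂ s : ℝ) : ℝ := r₁ * r₂ * Real.cosh s / rr r₁ r₂ s

lemma norm_nVec {r₁ r₂ : ℝ} (h1 : 1 ≤ r₁) (h2 : 1 ≤ r₂) (s : ℝ) :
    ‖nVec r₁ r₂ s‖ = rr r₁ r₂ s := by
  have hc := Real.one_le_cosh s
  have : 0 ≤ 2 * (Real.cosh s - 1) * r₁ * r₂ := by
    have : 0 ≤ Real.cosh s - 1 := by linarith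
    positivity
  rw [EuclideanSpace.norm_eq, rr]
  congr 1
  simp only [Fin.sum_univ_two, nVec, Real.norm_eq_abs, sq_abs]
  simp
  rw [Real.sq_sqrt this]; ring

lemma rr_pos_aux {r₁ r₂ : ℝ} (h1 : 1 ≤ r₁) (h2 : 1 ≤ r₂) (s : ℝ) :
    1 ≤ r₁^2 + r₂^2 + 2 * r₁ * r₂ * Real.cosh s := by
  have hc := Real.one_le_cosh s
  have : 0 ≤ 2 * r₁ * r₂ * Real.cosh s := by positivity
  nlinarith

lemma one_le_rr {r₁ r₂ : ℝ} (h1 : 1 ≤ r₁) (h2 : 1 ≤ r₂) (s : ℝ) : 1 ≤ rr r₁ r₂ s :=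
  Real.one_le_sqrt.2 (rr_pos_aux h1 h2 s)

lemma hasDerivAt_rr {r₁ r₂ : ℝ} (h1 : 1 ≤ r₁) (h2 : 1 ≤ r₂) (s : ℝ) :
    HasDerivAt (rr r₁ r₂) (sS r₁ r₂ s) s := by
  have h := rr_pos_aux h1 h2 s
  have hd := ((Real.hasDerivAt_cosh s).const_mul (2 * r₁ * r₂)).const_add (r₁^2 + r₂^2)
  refine (hd.sqrt (by positivity)).congr_deriv ?_
  have := one_le_rr h1 h2 s
  unfold sS rr at *
  field_simp

lemma hasDerivAt_inv_rr {r₁ r₂ : ℝ} (h1 : 1 ≤ r₁) (h2 : 1 ≤ r₂) (s : ℝ) :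
    HasDerivAt (fun s => (rr r₁ r₂ s)⁻¹) (-(sS r₁ r₂ s * (rr r₁ r₂ s)⁻¹ ^ 2)) s := by
  have := one_le_rr h1 h2 s
  refine ((hasDerivAt_rr h1 h2 s).inv (by positivity)).congr_deriv ?_
  field_simp

lemma hasDerivAt_sS {r₁ r₂ : ℝ} (h1 : 1 ≤ r₁) (h2 : 1 ≤ r₂) (s : ℝ) :
    HasDerivAt (sS r₁ r₂) (cC r₁ r₂ s - sS r₁ r₂ s ^ 2 * (rr r₁ r₂ s)⁻¹) s := by
  have := one_le_rr h1 h2 s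
  refine (((Real.hasDerivAt_sinh s).const_mul (r₁ * r₂)).mul (hasDerivAt_inv_rr h1 h2 s)).congr_deriv ?_
  unfold sS cC
  field_simp
  ring

lemma hasDerivAt_cC {r₁ r₂ : ℝ} (h1 : 1 ≤ r₁) (h2 : 1 ≤ r₂) (s : ℝ) :
    HasDerivAt (cC r₁ r₂) (sS r₁ r₂ s - cC r₁ r₂ s * sS r₁ r₂ s * (rr r₁ r₂ s)⁻¹) s := by
  have := one_le_rr h1 h2 s
  refine (((Real.hasDerivAt_cosh s).const_mul (r₁ * r₂)).mul (hasDerivAt_inv_rr h1 h2 s)).congr_deriv ?_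
  unfold sS cC
  field_simp
  ring

/-- the monomials spanning all derivatives -/
noncomputable def mono (φ : ℝ → ℝ) (t r₁ r₂ : ℝ) (k a b c : ℕ) (s : ℝ) : ℂ :=
  ww φ k t (rr r₁ r₂ s) * ((sS r₁ r₂ s ^ a * cC r₁ r₂ s ^ b * (rr r₁ r₂ s)⁻¹ ^ c : ℝ) : ℂ)

lemma deriv_mono {φ : ℝ → ℝ} (h : PS φ) (t : ℝ) {r₁ r₂ : ℝ} (h1 : 1 ≤ r₁) (h2 : 1 ≤ r₂) (k a b c : ℕ) :
    deriv (mono φ t r₁ r₂ k a b c) =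
      mono φ t r₁ r₂ (k+1) (a+1) b c + ((a : ℝ) • mono φ t r₁ r₂ k (a-1) (b+1) c +
      ((b : ℝ) • mono φ t r₁ r₂ k (a+1) (b-1) c +
      (-(a + b + c : ℝ)) • mono φ t r₁ r₂ k (a+1) b (c+1))) := by
  funext s
  have d1 := (hasDerivAt_ww h k t (rr r₁ r₂ s)).scomp s (hasDerivAt_rr h1 h2 s)
  have d2 := ((((hasDerivAt_sS h1 h2 s).pow a).mul ((hasDerivAt_cC h1 h2 s).pow b)).mul
    ((hasDerivAt_inv_rr h1 h2 s).pow c)).ofReal_comp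
  have d3 := d1.mul d2
  refine HasDerivAt.deriv (f := mono φ t r₁ r₂ k a b c) (d3.congr_deriv ?_)
  simp only [mono, Pi.add_apply, Pi.smul_apply, Complex.real_smul, Pi.mul_apply, Pi.pow_apply,
    Function.comp_apply]
  clear d1 d2 d3
  generalize ww φ (k+1) t (rr r₁ r₂ s) = w1
  generalize ww φ k t (rr r₁ r₂ s) = w0
  generalize (rr r₁ r₂ s)⁻¹ = i
  generalize sS r₁ r₂ s = S
  generalize cC r₁ r₂ s = K
  rcases a with _ | a <;> rcases b with _ | b <;> rcases c with _ | c <;>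
  · try simp only [Nat.add_sub_cancel]
    push_cast
    ring

lemma contDiff_mono {φ : ℝ → ℝ} (h : PS φ) (t : ℝ) {r₁ r₂ : ℝ} (h1 : 1 ≤ r₁) (h2 : 1 ≤ r₂)
    (n k a b c : ℕ) : ContDiff ℝ n (mono φ t r₁ r₂ k a b c) := by
  have hr : ContDiff ℝ n (rr r₁ r₂) := by
    unfold rr
    apply ContDiff.sqrt
    · have := Real.contDiff_cosh (n := n); fun_prop
    · intro s; linarith [rr_pos_aux h1 h2 s]
  have hr0 : ∀ s, rr r₁ r₂ s ≠ 0 := fun s => by linarith [one_le_rr h1 h2 s]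
  have hS : ContDiff ℝ n (sS r₁ r₂) := by
    unfold sS
    exact ContDiff.div (contDiff_const.mul Real.contDiff_sinh) hr hr0
  have hC : ContDiff ℝ n (cC r₁ r₂) := by
    unfold cC
    exact ContDiff.div (contDiff_const.mul Real.contDiff_cosh) hr hr0
  unfold mono
  refine ((contDiff_ww h t n k).comp hr).mul ?_
  exact Complex.ofRealCLM.contDiff.comp (((hS.pow a).mul (hC.pow b)).mul ((hr.inv hr0).pow c))

noncomputable def EE (N : ℕ) (t ρ : ℝ) : ℝ :=
  ((1 + |t - ρ|) ^ (-(N : ℝ)) + (1 + |t + ρ|) ^ (-(N : ℝ))) * (1 + ρ) ^ (-(1 : ℝ) / 2)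

noncomputable def MM (r₁ r₂ s : ℝ) : ℝ := max (1 + sS r₁ r₂ s) (√(1 + r₁ * r₂ / rr r₁ r₂ s))

lemma EE_nonneg (N : ℕ) (t : ℝ) {ρ : ℝ} (h : 0 ≤ ρ) : 0 ≤ EE N t ρ := by
  unfold EE; positivity

lemma mono_bound {φ : ℝ → ℝ} (h : PS φ) (N m : ℕ) : ∀ k a b c : ℕ, ∃ C, 0 ≤ C ∧
    ∀ r₁ r₂ t s : ℝ, 1 ≤ r₁ → 1 ≤ r₂ → 0 ≤ s →
    ‖iteratedDeriv m (mono φ t r₁ r₂ k a b c) s‖ ≤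
      C * (EE N t (rr r₁ r₂ s) * MM r₁ r₂ s ^ (m + a + 2 * b)) := by
  have hS0 : ∀ r₁ r₂ s : ℝ, 1 ≤ r₁ → 1 ≤ r₂ → 0 ≤ s → 0 ≤ sS r₁ r₂ s := by
    intro r₁ r₂ s h1 h2 hs
    have := one_le_rr h1 h2 s
    have := Real.sinh_nonneg_iff.2 hs
    unfold sS; positivity
  have hM1 : ∀ r₁ r₂ s : ℝ, 1 ≤ r₁ → 1 ≤ r₂ → 0 ≤ s → 1 ≤ MM r₁ r₂ s := by
    intro r₁ r₂ s h1 h2 hs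
    have := hS0 r₁ r₂ s h1 h2 hs
    exact le_max_of_le_left (by linarith)
  induction m with
  | zero =>
    intro k a b c
    obtain ⟨C, hC, hb⟩ := ww_bound h k N
    refine ⟨C * 2^b, by positivity, fun r₁ r₂ t s h1 h2 hs => ?_⟩
    have hr := one_le_rr h1 h2 s
    have hS := hS0 r₁ r₂ s h1 h2 hs
    have hM := hM1 r₁ r₂ s h1 h2 hs
    have hSM : 1 + sS r₁ r₂ s ≤ MM r₁ r₂ s := le_max_left _ _
    have hBM : r₁ * r₂ / rr r₁ r₂ s ≤ MM r₁ r₂ s ^ 2 := by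
      have e : √(1 + r₁ * r₂ / rr r₁ r₂ s) ≤ MM r₁ r₂ s := le_max_right _ _
      rw [Real.sqrt_le_left (by linarith)] at e
      linarith
    have hK0 : 0 ≤ cC r₁ r₂ s := by
      have := Real.cosh_pos s
      unfold cC; positivity
    have hK : cC r₁ r₂ s ≤ 2 * MM r₁ r₂ s ^ 2 := by
      have e : cC r₁ r₂ s ≤ sS r₁ r₂ s + r₁ * r₂ / rr r₁ r₂ s := by
        have hcs : Real.cosh s ≤ Real.sinh s + 1 := by
          have := Real.cosh_sub_sinh s
          have : Real.exp (-s) ≤ 1 := Real.exp_le_one_iff.2 (by linarith)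
          linarith
        unfold cC sS
        rw [← add_div]
        gcongr
        have : 0 ≤ r₁ * r₂ := by positivity
        nlinarith
      nlinarith
    have hw := hb t _ hr
    have hE := EE_nonneg N t (ρ := rr r₁ r₂ s) (by linarith)
    change _ ≤ C * EE N t (rr r₁ r₂ s) at hw
    rw [iteratedDeriv_zero, mono, norm_mul, Complex.norm_real, Real.norm_of_nonneg (by positivity)]
    have hi : (rr r₁ r₂ s)⁻¹ ^ c ≤ 1 := pow_le_one₀ (by positivity) (inv_le_one_of_one_le₀ hr)
    calc _ ≤ (C * EE N t (rr r₁ r₂ s)) * (MM r₁ r₂ s ^ a * (2 * MM r₁ r₂ s ^ 2) ^ b * 1) := by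
          gcongr
          linarith
      _ = _ := by rw [mul_pow, zero_add, pow_add, pow_mul]; ring
  | succ m ih =>
    intro k a b c
    obtain ⟨C1, hC1, hb1⟩ := ih (k+1) (a+1) b c
    obtain ⟨C2, hC2, hb2⟩ := ih k (a-1) (b+1) c
    obtain ⟨C3, hC3, hb3⟩ := ih k (a+1) (b-1) c
    obtain ⟨C4, hC4, hb4⟩ := ih k (a+1) b (c+1)
    refine ⟨C1 + (a * C2 + (b * C3 + (a + b + c) * C4)), by positivity, fun r₁ r₂ t s h1 h2 hs => ?_⟩
    have hE := EE_nonneg N t (ρ := rr r₁ r₂ s) (by linarith [one_le_rr h1 h2 s])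
    have hM := hM1 r₁ r₂ s h1 h2 hs
    have cd : ∀ k a b c, ContDiffAt ℝ m (mono φ t r₁ r₂ k a b c) s :=
      fun k a b c => (contDiff_mono h t h1 h2 m k a b c).contDiffAt
    have cd' : ∀ (x : ℝ) k a b c, ContDiffAt ℝ m (x • mono φ t r₁ r₂ k a b c) s :=
      fun x k a b c => (cd k a b c).const_smul x
    have cadd : ∀ {f g : ℝ → ℂ}, ContDiffAt ℝ m f s → ContDiffAt ℝ m g s →
        ContDiffAt ℝ m (f + g) s := fun hf hg => hf.add hg
    rw [iteratedDeriv_succ', deriv_mono h t h1 h2]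
    rw [iteratedDeriv_add (cd _ _ _ _) (cadd (cd' _ _ _ _ _) (cadd (cd' _ _ _ _ _) (cd' _ _ _ _ _))),
      iteratedDeriv_add (cd' _ _ _ _ _) (cadd (cd' _ _ _ _ _) (cd' _ _ _ _ _)),
      iteratedDeriv_add (cd' _ _ _ _ _) (cd' _ _ _ _ _),
      iteratedDeriv_const_smul (cd _ _ _ _), iteratedDeriv_const_smul (cd _ _ _ _),
      iteratedDeriv_const_smul (cd _ _ _ _)]
    set X := EE N t (rr r₁ r₂ s) * MM r₁ r₂ s ^ (m + 1 + a + 2 * b) with hX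
    have hX0 : 0 ≤ X := by positivity
    have hmono : ∀ e, e ≤ m + 1 + a + 2 * b → EE N t (rr r₁ r₂ s) * MM r₁ r₂ s ^ e ≤ X := by
      intro e he
      exact mul_le_mul_of_nonneg_left (pow_le_pow_right₀ hM he) hE
    have b1 := (hb1 r₁ r₂ t s h1 h2 hs).trans
      (mul_le_mul_of_nonneg_left (hmono _ (by omega)) hC1)
    have b4 := (hb4 r₁ r₂ t s h1 h2 hs).trans
      (mul_le_mul_of_nonneg_left (hmono _ (by omega)) hC4)
    have b2 : ‖(a:ℝ) • iteratedDeriv m (mono φ t r₁ r₂ k (a-1) (b+1) c) s‖ ≤ a * (C2 * X) := by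
      rw [norm_smul, Real.norm_of_nonneg (by positivity)]
      rcases Nat.eq_zero_or_pos a with ha | ha
      · simp [ha]
      · exact mul_le_mul_of_nonneg_left ((hb2 r₁ r₂ t s h1 h2 hs).trans
          (mul_le_mul_of_nonneg_left (hmono _ (by omega)) hC2)) (by positivity)
    have b3 : ‖(b:ℝ) • iteratedDeriv m (mono φ t r₁ r₂ k (a+1) (b-1) c) s‖ ≤ b * (C3 * X) := by
      rw [norm_smul, Real.norm_of_nonneg (by positivity)]
      rcases Nat.eq_zero_or_pos b with ha | ha
      · simp [ha]
      · exact mul_le_mul_of_nonneg_left ((hb3 r₁ r₂ t s h1 h2 hs).trans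
          (mul_le_mul_of_nonneg_left (hmono _ (by omega)) hC3)) (by positivity)
    have b4' : ‖(-(a + b + c : ℝ)) • iteratedDeriv m (mono φ t r₁ r₂ k (a+1) b (c+1)) s‖ ≤
        (a + b + c) * (C4 * X) := by
      rw [norm_smul, norm_neg, Real.norm_of_nonneg (by positivity)]
      exact mul_le_mul_of_nonneg_left b4 (by positivity)
    refine (norm_add_le_of_le b1 (norm_add_le_of_le b2 (norm_add_le_of_le b3 b4'))).trans (le_of_eq ?_)
    ring

theorem W_nVec_deriv_bound
    (φ : ℝ → ℝ) (hφ : ContDiff ℝ (⊤ : ℕ∞) φ) (hφsupp : Function.support φ ⊆ Set.Icc 1 2)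
    (m N : ℕ) :
    ∃ R₀ C : ℝ, 1 ≤ R₀ ∧ 0 < C ∧
      ∀ r₁ r₂ t s : ℝ, R₀ ≤ r₁ → R₀ ≤ r₂ → 0 ≤ s →
        ‖iteratedDeriv m (fun u => Wfun φ t (nVec r₁ r₂ u)) s‖ ≤
          C * ((1 + |t - ‖nVec r₁ r₂ s‖|) ^ (-(N : ℝ)) +
                (1 + |t + ‖nVec r₁ r₂ s‖|) ^ (-(N : ℝ))) *
            (1 + ‖nVec r₁ r₂ s‖) ^ (-(1 : ℝ) / 2) *
            ((1 + r₁ * r₂ * Real.sinh s / ‖nVec r₁ r₂ s‖) ^ (m : ℝ) +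
              (1 + r₁ * r₂ / ‖nVec r₁ r₂ s‖) ^ ((m : ℝ) / 2)) := by
  have h : PS φ := ⟨hφ, hφsupp⟩
  obtain ⟨C, hC, hb⟩ := mono_bound h N m 0 0 0 0
  refine ⟨1, C + 1, le_rfl, by positivity, fun r₁ r₂ t s h1 h2 hs => ?_⟩
  have hf : (fun u => Wfun φ t (nVec r₁ r₂ u)) = mono φ t r₁ r₂ 0 0 0 0 := by
    funext u
    rw [Wfun_eq h, norm_nVec h1 h2, mono]
    simp
  rw [hf, norm_nVec h1 h2]
  have hr := one_le_rr h1 h2 s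
  have hE := EE_nonneg N t (ρ := rr r₁ r₂ s) (by linarith)
  have hsh := Real.sinh_nonneg_iff.2 hs
  have hB : 0 ≤ 1 + r₁ * r₂ / rr r₁ r₂ s := by positivity
  have hA : 0 ≤ 1 + sS r₁ r₂ s := by unfold sS; positivity
  have hMM : MM r₁ r₂ s ^ m ≤ (1 + sS r₁ r₂ s) ^ (m : ℝ) +
      (1 + r₁ * r₂ / rr r₁ r₂ s) ^ ((m : ℝ) / 2) := by
    have e1 : 0 ≤ (1 + sS r₁ r₂ s) ^ (m : ℝ) := by positivity
    have e2 : 0 ≤ (1 + r₁ * r₂ / rr r₁ r₂ s) ^ ((m : ℝ) / 2) := by positivity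
    unfold MM
    rcases max_choice (1 + sS r₁ r₂ s) (√(1 + r₁ * r₂ / rr r₁ r₂ s)) with e | e
    · rw [e, ← Real.rpow_natCast]; linarith
    · rw [e, Real.sqrt_eq_rpow, ← Real.rpow_mul_natCast hB]
      rw [show (1/2 : ℝ) * m = m / 2 by ring]; linarith
  have hfin := hb r₁ r₂ t s h1 h2 hs
  simp only [add_zero, mul_zero] at hfin
  have hM0 : 0 ≤ MM r₁ r₂ s := le_max_of_le_left hA
  calc _ ≤ _ := hfin
    _ ≤ (C + 1) * (EE N t (rr r₁ r₂ s) * ((1 + sS r₁ r₂ s) ^ (m : ℝ) +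
      (1 + r₁ * r₂ / rr r₁ r₂ s) ^ ((m : ℝ) / 2))) := by gcongr; linarith
    _ = _ := by unfold EE sS; ring
end

section
/- For every ν > 0 there exists a constant C_ν such that the derivative of the Bessel function satisfies |J_ν'(r)| ≤ C_ν · r^{ν-1} · (1+r)^{-ν+1/2} for all r > 0; moreover, if ν > 1/2 then J_ν'(r) = J_{ν-1}(r) − ν J_ν(r)/r for all r > 0. -/
open MeasureTheory

/-- The truncated Fourier integral of `h`. -/
noncomputable def bI (h : ℝ → ℂ) (r : ℝ) : ℂ :=
  ∫ s in (-1 : ℝ)..1, Complex.exp (Complex.I * (s : ℂ) * (r : ℂ)) * h s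

/-- The weight. -/
noncomputable def bW (μ s : ℝ) : ℂ := (((1 - s ^ 2) ^ μ : ℝ) : ℂ)

lemma norm_exp_bI (s r : ℝ) : ‖Complex.exp (Complex.I * (s : ℂ) * (r : ℂ))‖ = 1 := by
  rw [Complex.norm_exp]; simp

lemma cont_exp_bI (r : ℝ) :
    Continuous (fun s : ℝ => Complex.exp (Complex.I * (s : ℂ) * (r : ℂ))) := by
  fun_prop

lemma bI_integrable {h : ℝ → ℂ} (hh : IntervalIntegrable h volume (-1) 1) (r : ℝ) :
    IntervalIntegrable (fun s : ℝ => Complex.exp (Complex.I * (s : ℂ) * (r : ℂ)) * h s)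
      volume (-1) 1 :=
  hh.continuousOn_mul (cont_exp_bI r).continuousOn

lemma is_integrable {h : ℝ → ℂ} (hh : IntervalIntegrable h volume (-1) 1) :
    IntervalIntegrable (fun s : ℝ => (Complex.I * (s : ℂ)) * h s) volume (-1) 1 :=
  hh.continuousOn_mul (by fun_prop)

lemma aesm_uIoc {h : ℝ → ℂ} (hh : IntervalIntegrable h volume (-1) 1) :
    AEStronglyMeasurable h (volume.restrict (Set.uIoc (-1) 1)) :=
  (intervalIntegrable_iff.1 hh).aestronglyMeasurable

lemma bI_hasDerivAt {h : ℝ → ℂ} (hh : IntervalIntegrable h volume (-1) 1) (r : ℝ) :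
    HasDerivAt (bI h) (bI (fun s => (Complex.I * (s : ℂ)) * h s) r) r := by
  have := (intervalIntegral.hasDerivAt_integral_of_dominated_loc_of_deriv_le
    (μ := volume) (a := -1) (b := 1) (bound := fun s => ‖h s‖)
    (F := fun (r : ℝ) (s : ℝ) => Complex.exp (Complex.I * (s : ℂ) * (r : ℂ)) * h s)
    (F' := fun (r : ℝ) (s : ℝ) => Complex.exp (Complex.I * (s : ℂ) * (r : ℂ)) *
      ((Complex.I * (s : ℂ)) * h s))
    (x₀ := r) (s := Set.univ) Filter.univ_mem
    (Filter.Eventually.of_forall fun x => aesm_uIoc (bI_integrable hh x))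
    (bI_integrable hh r)
    (aesm_uIoc (bI_integrable (is_integrable hh) r))
    (Filter.Eventually.of_forall fun t ht x _ => ?_) hh.norm
    (Filter.Eventually.of_forall fun t ht x _ => ?_)).2
  · exact this
  · rw [Set.uIoc_of_le (by norm_num)] at ht
    rw [norm_mul, norm_exp_bI, one_mul, norm_mul, norm_mul, Complex.norm_I, one_mul,
      Complex.norm_real]
    have : ‖t‖ ≤ 1 := by rw [Real.norm_eq_abs, abs_le]; exact ⟨ht.1.le, ht.2⟩
    exact mul_le_of_le_one_left (norm_nonneg _) this
  · have h1 : HasDerivAt (fun x : ℝ => Complex.I * (t : ℂ) * (x : ℂ)) (Complex.I * (t : ℂ)) x := by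
      simpa using (Complex.ofRealCLM.hasDerivAt (x := x)).const_mul (Complex.I * (t : ℂ))
    have := (h1.cexp).mul_const (h t)
    refine this.congr_deriv ?_
    ring

lemma bI_norm_le {h : ℝ → ℂ} (hh : IntervalIntegrable h volume (-1) 1) (r : ℝ) :
    ‖bI h r‖ ≤ ∫ s in (-1 : ℝ)..1, ‖h s‖ := by
  refine intervalIntegral.norm_integral_le_of_norm_le (by norm_num)
    (Filter.Eventually.of_forall fun t _ => ?_) hh.norm
  rw [norm_mul, norm_exp_bI, one_mul]

lemma bW_integrable {μ : ℝ} (hμ : -1 < μ) : IntervalIntegrable (bW μ) volume (-1) 1 := by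
  suffices IntervalIntegrable (fun s : ℝ => (1 - s ^ 2) ^ μ) volume (-1) 1 by
    exact ⟨this.1.ofReal, this.2.ofReal⟩
  have h0 : IntervalIntegrable (fun s : ℝ => s ^ μ) volume 0 1 :=
    intervalIntegral.intervalIntegrable_rpow' hμ
  have h1 : IntervalIntegrable (fun s : ℝ => (1 - s ^ 2) ^ μ) volume 0 1 := by
    have h2 := (h0.comp_sub_left 1).symm
    norm_num at h2
    have h3 : ContinuousOn (fun s : ℝ => (1 + s) ^ μ) (Set.uIcc 0 1) := by
      rw [Set.uIcc_of_le (by norm_num)]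
      refine ContinuousOn.rpow_const (by fun_prop) fun x hx => Or.inl ?_
      have := hx.1; linarith
    refine (h2.mul_continuousOn h3).congr ?_
    intro s hs
    rw [Set.uIoc_of_le (by norm_num)] at hs
    simp only
    rw [← Real.mul_rpow (by linarith [hs.2]) (by linarith [hs.1])]
    ring_nf
  have h4 := (h1.comp_sub_left 0).symm
  norm_num at h4
  exact h4.trans h1

lemma bW_contOn {μ : ℝ} (hμ : 0 ≤ μ) : Continuous (bW μ) := by
  unfold bW
  refine Complex.continuous_ofReal.comp ?_
  exact Continuous.rpow_const (by fun_prop) fun x => Or.inr hμ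

lemma bW_hasDerivAt {μ s : ℝ} (hs : s ∈ Set.Ioo (-1 : ℝ) 1) :
    HasDerivAt (bW μ) (-2 * (μ : ℂ) * (s : ℂ) * bW (μ - 1) s) s := by
  have hp : 0 < 1 - s ^ 2 := by nlinarith [hs.1, hs.2]
  have h1 : HasDerivAt (fun s : ℝ => 1 - s ^ 2) (-(2 * s)) s := by
    simpa using ((hasDerivAt_id s).pow 2).const_sub 1
  have h2 := (h1.rpow_const (p := μ) (Or.inl hp.ne')).ofReal_comp
  refine h2.congr_deriv ?_
  simp only [bW, Complex.ofReal_mul, Complex.ofReal_neg]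
  push_cast
  ring

lemma bW_succ {μ s : ℝ} (hs : s ∈ Set.Ioo (-1 : ℝ) 1) :
    bW μ s = (1 - (s : ℂ) ^ 2) * bW (μ - 1) s := by
  have hp : 0 < 1 - s ^ 2 := by nlinarith [hs.1, hs.2]
  unfold bW
  rw [Real.rpow_sub_one hp.ne']
  have : (1 - (s : ℂ) ^ 2) ≠ 0 := by exact_mod_cast hp.ne'
  push_cast
  field_simp

lemma bW_bdry {μ : ℝ} (hμ : 0 < μ) : bW μ 1 = 0 ∧ bW μ (-1) = 0 := by
  unfold bW
  norm_num [Real.zero_rpow hμ.ne']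

lemma exp_hasDerivAt (r s : ℝ) :
    HasDerivAt (fun s : ℝ => Complex.exp (Complex.I * (s : ℂ) * (r : ℂ)))
      (Complex.exp (Complex.I * (s : ℂ) * (r : ℂ)) * (Complex.I * r)) s := by
  have h1 : HasDerivAt (fun x : ℝ => Complex.I * (x : ℂ) * (r : ℂ)) (Complex.I * r) s := by
    simpa using ((Complex.ofRealCLM.hasDerivAt (x := s)).const_mul Complex.I).mul_const (r : ℂ)
  exact h1.cexp

/-- First integration by parts (recurrence). -/
lemma bI_rec {μ : ℝ} (hμ : 0 < μ) (r : ℝ) :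
    2 * (μ : ℂ) * bI (bW (μ - 1)) r = (1 + 2 * (μ : ℂ)) * bI (bW μ) r
      + r * bI (fun s => (Complex.I * (s : ℂ)) * bW μ s) r := by
  have i0 := bW_integrable (μ := μ - 1) (by linarith)
  have i1 := bW_integrable (μ := μ) (by linarith)
  have j0 := (bI_integrable i0 r).const_mul (2 * (μ : ℂ))
  have j1 := (bI_integrable i1 r).const_mul (1 + 2 * (μ : ℂ))
  have j2 := (bI_integrable (is_integrable i1) r).const_mul (r : ℂ)
  have key := intervalIntegral.integral_eq_sub_of_hasDerivAt_of_le (a := -1) (b := 1)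
    (f := fun s : ℝ => Complex.exp (Complex.I * (s : ℂ) * (r : ℂ)) * ((s : ℂ) * bW μ s))
    (f' := _) (by norm_num)
    (((cont_exp_bI r).mul (Complex.continuous_ofReal.mul (bW_contOn hμ.le))).continuousOn)
    (fun s hs => ?_) ((j1.add j2).sub j0)
  · rw [intervalIntegral.integral_sub (j1.add j2) j0, intervalIntegral.integral_add j1 j2,
      intervalIntegral.integral_const_mul, intervalIntegral.integral_const_mul,
      intervalIntegral.integral_const_mul, (bW_bdry hμ).1, (bW_bdry hμ).2] at key
    unfold bI
    linear_combination -key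
  · have := (exp_hasDerivAt r s).mul
      ((Complex.ofRealCLM.hasDerivAt (x := s)).mul (bW_hasDerivAt (μ := μ) hs))
    refine this.congr_deriv ?_
    simp only [Complex.ofRealCLM_apply, Complex.ofReal_one, Pi.mul_apply]
    rw [bW_succ (μ := μ) hs]
    ring

/-- Second integration by parts (Bessel equation). -/
lemma bI_ode {μ : ℝ} (hμ : -1 < μ) (r : ℝ) :
    (r : ℂ) * (bI (fun s => (Complex.I * (s : ℂ)) * ((Complex.I * (s : ℂ)) * bW μ s)) r
      + bI (bW μ) r) = - (2 * ((μ : ℂ) + 1)) * bI (fun s => (Complex.I * (s : ℂ)) * bW μ s) r := by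
  have i1 := bW_integrable hμ
  have j0 := (bI_integrable i1 r).const_mul (Complex.I * (r : ℂ))
  have j1 := (bI_integrable (is_integrable i1) r).const_mul (Complex.I * (2 * ((μ : ℂ) + 1)))
  have j2 := (bI_integrable (is_integrable (is_integrable i1)) r).const_mul (Complex.I * (r : ℂ))
  have key := intervalIntegral.integral_eq_sub_of_hasDerivAt_of_le (a := -1) (b := 1)
    (f := fun s : ℝ => Complex.exp (Complex.I * (s : ℂ) * (r : ℂ)) * (bW (μ + 1) s))
    (f' := _) (by norm_num)
    (((cont_exp_bI r).mul (bW_contOn (by linarith))).continuousOn)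
    (fun s hs => ?_) ((j2.add j0).add j1)
  · rw [intervalIntegral.integral_add (j2.add j0) j1, intervalIntegral.integral_add j2 j0,
      intervalIntegral.integral_const_mul, intervalIntegral.integral_const_mul,
      intervalIntegral.integral_const_mul, (bW_bdry (μ := μ + 1) (by linarith)).1,
      (bW_bdry (μ := μ + 1) (by linarith)).2] at key
    unfold bI
    apply mul_left_cancel₀ Complex.I_ne_zero
    linear_combination key
  · have := (exp_hasDerivAt r s).mul (bW_hasDerivAt (μ := μ + 1) hs)
    refine this.congr_deriv ?_
    rw [bW_succ (μ := μ + 1) hs]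
    simp only [add_sub_cancel_right]
    push_cast
    linear_combination (Complex.exp (Complex.I * (s : ℂ) * (r : ℂ)) * bW μ s *
      (- (2 * ((μ : ℂ) + 1)) * s - Complex.I * r * s ^ 2)) * Complex.I_sq

/-- Energy estimate: solutions of the Bessel-type equation. -/
lemma energy (a : ℝ) (f f₁ f₂ : ℝ → ℂ) (hf : ∀ r, HasDerivAt f (f₁ r) r)
    (hf₁ : ∀ r, HasDerivAt f₁ (f₂ r) r)
    (ode : ∀ r : ℝ, (r : ℂ) * (f₂ r + f r) = - (2 * (a : ℂ)) * f₁ r) :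
    ∃ M : ℝ, 0 ≤ M ∧ ∀ r : ℝ, 1 ≤ r → ‖((r ^ a : ℝ) : ℂ) * f r‖ ≤ M ∧
      ‖((r ^ a : ℝ) : ℂ) * (f₁ r + (a : ℂ) / r * f r)‖ ≤ M := by
  set w : ℝ → ℂ := fun r => ((r ^ a : ℝ) : ℂ) * f r with hw
  set v : ℝ → ℂ := fun r => ((r ^ a : ℝ) : ℂ) * (f₁ r + (a : ℂ) / r * f r) with hv
  have hr : ∀ r : ℝ, 0 < r → HasDerivAt (fun r : ℝ => ((r ^ a : ℝ) : ℂ))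
      (((r ^ a : ℝ) : ℂ) * (a / r)) r := by
    intro r h
    have := ((Real.hasDerivAt_rpow_const (x := r) (p := a) (Or.inl h.ne'))).ofReal_comp
    refine this.congr_deriv ?_
    rw [Real.rpow_sub_one h.ne']
    push_cast
    ring
  have hw' : ∀ r : ℝ, 0 < r → HasDerivAt w (v r) r := by
    intro r h
    refine ((hr r h).mul (hf r)).congr_deriv ?_
    simp only [hv]; ring
  have hv' : ∀ r : ℝ, 0 < r → HasDerivAt v ((((a * (a - 1) / r ^ 2 : ℝ) : ℂ) - 1) * w r) r := by
    intro r h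
    have hc : (r : ℂ) ≠ 0 := by exact_mod_cast h.ne'
    have h1 : HasDerivAt (fun r : ℝ => (a : ℂ) / r) (-(a : ℂ) / r ^ 2) r := by
      have := ((hasDerivAt_inv h.ne').const_mul a).ofReal_comp
      convert this using 1
      · ext x; push_cast; rfl
      · push_cast; field_simp
    refine ((hr r h).mul ((hf₁ r).add (h1.mul (hf r)))).congr_deriv ?_
    have o := ode r
    have o' : f₂ r = - (2 * (a : ℂ)) * f₁ r / r - f r := by
      field_simp; linear_combination o
    simp only [hw, Pi.add_apply, Pi.mul_apply]
    rw [o']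
    push_cast
    field_simp
    ring
  set k : ℝ := |a * (a - 1)| with hk
  set E : ℝ → ℝ := fun r => (‖w r‖ ^ 2 + ‖v r‖ ^ 2) * Real.exp (k / r) with hE
  have hE' : ∀ r : ℝ, 0 < r → ∃ d, d ≤ 0 ∧ HasDerivAt E d r := by
    intro r h
    have h1 : HasDerivAt (fun r : ℝ => k / r) (- k / r ^ 2) r := by
      refine ((hasDerivAt_inv h.ne').const_mul k).congr_deriv ?_
      ring
    have := (((hw' r h).norm_sq).add ((hv' r h).norm_sq)).mul h1.exp
    refine ⟨_, ?_, this⟩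
    have e1 : ((((a * (a - 1) / r ^ 2 : ℝ) : ℂ) - 1) * w r) =
        ((a * (a - 1) / r ^ 2 - 1 : ℝ)) • w r := by
      rw [Complex.real_smul]; push_cast; ring
    rw [e1, real_inner_smul_right, real_inner_comm (w r) (v r)]
    set p := inner ℝ (w r) (v r) with hp
    have hcs : |p| ≤ ‖w r‖ * ‖v r‖ := abs_real_inner_le_norm _ _
    have h2 : 2 * (a * (a - 1)) * p ≤ k * (‖w r‖ ^ 2 + ‖v r‖ ^ 2) := by
      have : (a * (a - 1)) * p ≤ k * (‖w r‖ * ‖v r‖) := by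
        calc _ ≤ |(a * (a - 1)) * p| := le_abs_self _
          _ = k * |p| := abs_mul _ _
          _ ≤ _ := by gcongr
      nlinarith [mul_nonneg (abs_nonneg (a * (a - 1))) (sq_nonneg (‖w r‖ - ‖v r‖))]
    have e2 : (2 * p + 2 * ((a * (a - 1) / r ^ 2 - 1) * p)) * Real.exp (k / r) +
        (‖w r‖ ^ 2 + ‖v r‖ ^ 2) * (Real.exp (k / r) * (-k / r ^ 2)) =
        - (Real.exp (k / r) / r ^ 2 * (k * (‖w r‖ ^ 2 + ‖v r‖ ^ 2) - 2 * (a * (a - 1)) * p)) := by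
      field_simp
      ring
    have h3 : 0 ≤ Real.exp (k / r) / r ^ 2 *
      (k * (‖w r‖ ^ 2 + ‖v r‖ ^ 2) - 2 * (a * (a - 1)) * p) :=
      mul_nonneg (by positivity) (by linarith)
    simp only [Pi.add_apply]
    linarith
  have anti : AntitoneOn E (Set.Ici 1) := by
    apply antitoneOn_of_deriv_nonpos (convex_Ici 1)
    · intro x hx
      obtain ⟨d, _, hd⟩ := hE' x (lt_of_lt_of_le one_pos hx)
      exact hd.continuousAt.continuousWithinAt
    · intro x hx
      rw [interior_Ici] at hx
      obtain ⟨d, _, hd⟩ := hE' x (lt_trans one_pos hx)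
      exact hd.differentiableAt.differentiableWithinAt
    · intro x hx
      rw [interior_Ici] at hx
      obtain ⟨d, hd0, hd⟩ := hE' x (lt_trans one_pos hx)
      rw [hd.deriv]; exact hd0
  refine ⟨Real.sqrt (E 1), Real.sqrt_nonneg _, fun r h => ?_⟩
  have h1 : E r ≤ E 1 := anti (Set.mem_Ici.2 le_rfl) h h
  have h2 : ‖w r‖ ^ 2 + ‖v r‖ ^ 2 ≤ E r := by
    have : 1 ≤ Real.exp (k / r) := Real.one_le_exp (by positivity)
    exact le_mul_of_one_le_right (by positivity) this
  constructor
  · exact Real.le_sqrt_of_sq_le (by nlinarith [sq_nonneg ‖v r‖])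
  · exact Real.le_sqrt_of_sq_le (by nlinarith [sq_nonneg ‖w r‖])

lemma rpow_lower (e x : ℝ) (h1 : 1 ≤ x) (h2 : x ≤ 2) : (2 : ℝ) ^ (-|e|) ≤ x ^ e := by
  calc (2 : ℝ) ^ (-|e|) ≤ x ^ (-|e|) :=
        Real.rpow_le_rpow_of_nonpos (by linarith) h2 (by simp)
    _ ≤ x ^ e := Real.rpow_le_rpow_of_exponent_le h1 (neg_abs_le e)

lemma besselJ_hasDerivAt (ν : ℝ) (hν : 0 < ν) (r : ℝ) (hr : 0 < r) :
    HasDerivAt (besselJ ν)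
      ((((r / 2) ^ ν / (Real.Gamma (ν + 1 / 2) * Real.Gamma (1 / 2)) : ℝ) : ℂ) *
        ((ν : ℂ) / r * bI (bW (ν - 1 / 2)) r
          + bI (fun s => (Complex.I * (s : ℂ)) * bW (ν - 1 / 2) s) r)) r := by
  have h1 : HasDerivAt (fun r : ℝ => ((r / 2) ^ ν /
      (Real.Gamma (ν + 1 / 2) * Real.Gamma (1 / 2)) : ℝ))
      ((r / 2) ^ ν / (Real.Gamma (ν + 1 / 2) * Real.Gamma (1 / 2)) * (ν / r)) r := by
    have := ((((hasDerivAt_id r).div_const 2).rpow_const (p := ν)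
      (Or.inl (by simp [hr.ne']))).div_const (Real.Gamma (ν + 1 / 2) * Real.Gamma (1 / 2)))
    refine this.congr_deriv ?_
    have h2 : r / 2 ≠ 0 := by positivity
    simp only [id]
    rw [Real.rpow_sub_one h2]
    field_simp
  refine (h1.ofReal_comp.mul
    (bI_hasDerivAt (bW_integrable (μ := ν - 1 / 2) (by linarith)) r)).congr_deriv ?_
  push_cast
  ring

theorem besselJ_deriv_bound (ν : ℝ) (hν : 0 < ν) :
    (∃ C : ℝ, 0 < C ∧ ∀ r : ℝ, 0 < r →
      ‖deriv (besselJ ν) r‖ ≤ C * r ^ (ν - 1) * (1 + r) ^ (-ν + 1 / 2)) ∧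
    (1 / 2 < ν → ∀ r : ℝ, 0 < r →
      deriv (besselJ ν) r = besselJ (ν - 1) r - (ν : ℂ) * besselJ ν r / (r : ℂ)) := by
  have hi := bW_integrable (μ := ν - 1 / 2) (by linarith)
  constructor
  · set f := bI (bW (ν - 1 / 2)) with hf
    set f₁ := bI (fun s => (Complex.I * (s : ℂ)) * bW (ν - 1 / 2) s) with hf₁
    obtain ⟨M, hM, hb⟩ := energy (ν + 1 / 2) f f₁ _ (bI_hasDerivAt hi)
      (bI_hasDerivAt (is_integrable hi)) (fun r => by
        have := bI_ode (μ := ν - 1 / 2) (by linarith) r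
        rw [this]; push_cast; ring)
    obtain ⟨A, hA⟩ : ∃ A, ∀ r, ‖f r‖ ≤ A := ⟨_, bI_norm_le hi⟩
    obtain ⟨B, hB⟩ : ∃ B, ∀ r, ‖f₁ r‖ ≤ B := ⟨_, bI_norm_le (is_integrable hi)⟩
    have hA0 : 0 ≤ A := (norm_nonneg _).trans (hA 0)
    have hB0 : 0 ≤ B := (norm_nonneg _).trans (hB 0)
    have hG1 : 0 < Real.Gamma (ν + 1 / 2) := Real.Gamma_pos_of_pos (by linarith)
    have hG2 : 0 < Real.Gamma (1 / 2) := Real.Gamma_pos_of_pos (by norm_num)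
    set c : ℝ := ((1 / 2) ^ ν / (Real.Gamma (ν + 1 / 2) * Real.Gamma (1 / 2))) with hc
    have hc0 : 0 < c := by positivity
    set m : ℝ := (2 : ℝ) ^ (-|(-ν + 1 / 2)|) with hm
    have hm0 : 0 < m := by positivity
    have hcr : ∀ r : ℝ, 0 < r →
        (r / 2) ^ ν / (Real.Gamma (ν + 1 / 2) * Real.Gamma (1 / 2)) = c * r ^ ν := by
      intro r hr
      rw [div_eq_mul_one_div r 2, Real.mul_rpow hr.le (by norm_num), hc]
      ring
    set D : ℝ := c * (ν * A + B + 2 * M) with hD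
    have hD0 : 0 ≤ D := by positivity
    refine ⟨D / m + 1, by positivity, fun r hr => ?_⟩
    have hrc : (r : ℂ) ≠ 0 := by exact_mod_cast hr.ne'
    have main : ‖deriv (besselJ ν) r‖ ≤ D / m * (r ^ (ν - 1) * (1 + r) ^ (-ν + 1 / 2)) := by
      rw [(besselJ_hasDerivAt ν hν r hr).deriv, hcr r hr]
      rcases le_total r 1 with h | h
      · have h1 : m ≤ (1 + r) ^ (-ν + 1 / 2) := rpow_lower _ _ (by linarith) (by linarith)
        have h2 : ‖(((c * r ^ ν : ℝ)) : ℂ) * ((ν : ℂ) / r * f r + f₁ r)‖ ≤ D * r ^ (ν - 1) := by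
          have h3 : ‖(ν : ℂ) / r * f r + f₁ r‖ ≤ (ν * A + B) / r := by
            calc _ ≤ ‖(ν : ℂ) / r * f r‖ + ‖f₁ r‖ := norm_add_le _ _
              _ ≤ ν / r * A + B := by
                  rw [norm_mul, norm_div, Complex.norm_real, Complex.norm_real,
                    Real.norm_of_nonneg hν.le, Real.norm_of_nonneg hr.le]
                  gcongr
                  · exact hA r
                  · exact hB r
              _ ≤ ν / r * A + B / r := by
                  gcongr
                  rw [le_div_iff₀ hr]; nlinarith
              _ = _ := by ring
          rw [norm_mul, Complex.norm_real, Real.norm_of_nonneg (by positivity)]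
          calc _ ≤ c * r ^ ν * ((ν * A + B) / r) := by gcongr
            _ = c * (ν * A + B) * r ^ (ν - 1) := by
                rw [Real.rpow_sub_one hr.ne']; ring
            _ ≤ _ := by
                gcongr
                rw [hD]; exact mul_le_mul_of_nonneg_left (by linarith) hc0.le
        calc _ ≤ D * r ^ (ν - 1) := h2
          _ = D / m * (r ^ (ν - 1) * m) := by field_simp
          _ ≤ _ := by gcongr
      · have h1 : m ≤ ((1 + r) / r) ^ (-ν + 1 / 2) := by
          apply rpow_lower
          · rw [le_div_iff₀ hr]; linarith
          · rw [div_le_iff₀ hr]; linarith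
        obtain ⟨b1, b2⟩ := hb r h
        have e : (((c * r ^ ν : ℝ)) : ℂ) * ((ν : ℂ) / r * f r + f₁ r) =
            ((c * r ^ (-(1 / 2) : ℝ) : ℝ) : ℂ) *
            ((((r ^ (ν + 1 / 2) : ℝ) : ℂ) * (f₁ r + ((ν + 1 / 2 : ℝ) : ℂ) / r * f r))
              - ((1 / (2 * r) : ℝ) : ℂ) * (((r ^ (ν + 1 / 2) : ℝ) : ℂ) * f r)) := by
          have : r ^ ν = r ^ (-(1 / 2) : ℝ) * r ^ (ν + 1 / 2) := by
            rw [← Real.rpow_add hr]; ring_nf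
          rw [this]
          push_cast
          field_simp
          ring
        have h2 : ‖(((c * r ^ ν : ℝ)) : ℂ) * ((ν : ℂ) / r * f r + f₁ r)‖ ≤
            D * r ^ (-(1 / 2) : ℝ) := by
          rw [e, norm_mul, Complex.norm_real, Real.norm_of_nonneg (by positivity)]
          have h4 : 1 / (2 * r) ≤ 1 := by rw [div_le_one (by positivity)]; linarith
          have h3 : ‖(((r ^ (ν + 1 / 2) : ℝ) : ℂ) * (f₁ r + ((ν + 1 / 2 : ℝ) : ℂ) / r * f r))
              - ((1 / (2 * r) : ℝ) : ℂ) * (((r ^ (ν + 1 / 2) : ℝ) : ℂ) * f r)‖ ≤ 2 * M := by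
            refine (norm_sub_le _ _).trans ?_
            rw [norm_mul ((1 / (2 * r) : ℝ) : ℂ), Complex.norm_real ((1 / (2 * r) : ℝ)),
              Real.norm_of_nonneg (by positivity)]
            have := mul_le_mul h4 b1 (norm_nonneg _) zero_le_one
            linarith
          calc _ ≤ c * r ^ (-(1 / 2) : ℝ) * (2 * M) := by gcongr
            _ = c * (2 * M) * r ^ (-(1 / 2) : ℝ) := by ring
            _ ≤ _ := by
                gcongr
                rw [hD]; gcongr
                have : 0 ≤ ν * A + B := by positivity
                linarith
        have e3 : r ^ (-(1 / 2) : ℝ) * ((1 + r) / r) ^ (-ν + 1 / 2) =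
            r ^ (ν - 1) * (1 + r) ^ (-ν + 1 / 2) := by
          rw [Real.div_rpow (by positivity) hr.le]
          have : r ^ (-(1 / 2) : ℝ) = r ^ (ν - 1) * r ^ (-ν + 1 / 2) := by
            rw [← Real.rpow_add hr]; ring_nf
          rw [this]
          have : 0 < r ^ (-ν + 1 / 2) := by positivity
          field_simp
        calc _ ≤ D * r ^ (-(1 / 2) : ℝ) := h2
          _ = D / m * (r ^ (-(1 / 2) : ℝ) * m) := by field_simp
          _ ≤ D / m * (r ^ (-(1 / 2) : ℝ) * ((1 + r) / r) ^ (-ν + 1 / 2)) := by gcongr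
          _ = _ := by rw [e3]
    have : 0 ≤ r ^ (ν - 1) * (1 + r) ^ (-ν + 1 / 2) := by positivity
    nlinarith
  · intro h r hr
    have hrc : (r : ℂ) ≠ 0 := by exact_mod_cast hr.ne'
    rw [(besselJ_hasDerivAt ν hν r hr).deriv]
    have hrec := bI_rec (μ := ν - 1 / 2) (by linarith) r
    have eJ : ∀ ν : ℝ, besselJ ν r =
      (((r / 2) ^ ν / (Real.Gamma (ν + 1 / 2) * Real.Gamma (1 / 2)) : ℝ) : ℂ) *
        bI (bW (ν - 1 / 2)) r := fun ν => rfl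
    rw [eJ, eJ]
    have hG : Real.Gamma (ν + 1 / 2) = (ν - 1 / 2) * Real.Gamma (ν - 1 / 2) := by
      rw [← Real.Gamma_add_one (by linarith)]; ring_nf
    have hG1 : 0 < Real.Gamma (ν - 1 / 2) := Real.Gamma_pos_of_pos (by linarith)
    have hG2 : 0 < Real.Gamma (1 / 2) := Real.Gamma_pos_of_pos (by norm_num)
    have hn : 0 < ν - 1 / 2 := by linarith
    have ec : (r / 2) ^ (ν - 1) / (Real.Gamma (ν - 1 + 1 / 2) * Real.Gamma (1 / 2)) =
        (r / 2) ^ ν / (Real.Gamma (ν + 1 / 2) * Real.Gamma (1 / 2)) * (2 * (ν - 1 / 2) / r) := by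
      rw [hG, Real.rpow_sub_one (by positivity), show ν - 1 + 1 / 2 = ν - 1 / 2 by ring]
      generalize Real.Gamma (ν - 1 / 2) = g at *
      generalize ν - 1 / 2 = n at *
      field_simp
    rw [ec, show ν - 1 - 1 / 2 = ν - 1 / 2 - 1 by ring]
    generalize (r / 2) ^ ν / (Real.Gamma (ν + 1 / 2) * Real.Gamma (1 / 2)) = c
    push_cast at hrec ⊢
    field_simp
    field_simp at hrec
    linear_combination (-c : ℂ) * hrec
end
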